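/- Let W(k) = {A ∈ ℝ : A > 1 and ⌊A^{k!}⌋ is a prime number for every k ≥ 1}. Then every element of the sub-boundary ∂̃W(k) is transcendental, i.e., not a root of any nonzero polynomial with rational coefficients. -/

import Mathlib

/-- The set `W(k)` of `A > 1` such that `⌊A ^ (k !)⌋` is prime for every `k ≥ 1`. -/
def Wfact : Set ℝ :=
  {A : ℝ | 1 < A ∧ ∀ k : ℕ, 1 ≤ k → Prime ⌊A ^ Nat.factorial k⌋}

/-- `U` is a connected component of `S` (as a subset of `ℝ`). -/
def IsCCompOf (U S : Set ℝ) : Prop := ∃ x ∈ S, U = connectedComponentIn S x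

/-- The left sub-boundary of `X ⊆ ℝ`. -/
def subL (X : Set ℝ) : Set ℝ :=
  {A : ℝ | ∃ U : Set ℝ, IsCCompOf U Xᶜ ∧ BddAbove U ∧ A = sSup U}

/-- The right sub-boundary of `X ⊆ ℝ`. -/
def subR (X : Set ℝ) : Set ℝ :=
  {A : ℝ | ∃ U : Set ℝ, IsCCompOf U Xᶜ ∧ BddBelow U ∧ A = sInf U}

/-- The sub-boundary of `X ⊆ ℝ`. -/
def subB (X : Set ℝ) : Set ℝ := subL X ∪ subR X


namespace HH
open Finset

/-- moving average -/
noncomputable def avg (B : ℕ) (g : ℕ → ℝ) (k : ℕ) : ℝ := (1 / (B:ℝ)) * ∑ i ∈ range B, g (k + i)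

lemma avg_abs_le {B : ℕ} (hB : 1 ≤ B) {g : ℕ → ℝ} {c : ℝ} (h1 : ∀ j, |g j| ≤ c) (k : ℕ) :
    |avg B g k| ≤ c := by
  have hB' : (0:ℝ) < B := by exact_mod_cast hB
  unfold avg
  rw [abs_mul, abs_of_pos (by positivity), div_mul_eq_mul_div, one_mul, div_le_iff₀ hB']
  calc |∑ i ∈ range B, g (k+i)| ≤ ∑ i ∈ range B, |g (k+i)| := abs_sum_le_sum_abs _ _
    _ ≤ ∑ i ∈ range B, c := sum_le_sum fun i _ => h1 _
    _ = c * B := by simp [mul_comm]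

lemma avg_sub_sq_le {B : ℕ} (hB : 1 ≤ B) (g : ℕ → ℝ) (k : ℕ) (c : ℝ) :
    (avg B g k - c)^2 ≤ (1/(B:ℝ)) * ∑ i ∈ range B, (g (k+i) - c)^2 := by
  have hB' : (0:ℝ) < B := by exact_mod_cast hB
  have h : avg B g k - c = (1/(B:ℝ)) * ∑ i ∈ range B, (g (k+i) - c) := by
    unfold avg
    rw [sum_sub_distrib]; simp; field_simp
  rw [h, mul_pow]
  have := sq_sum_le_card_mul_sum_sq (s := range B) (f := fun i => g (k+i) - c)
  rw [card_range] at this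
  calc (1/(B:ℝ))^2 * (∑ i ∈ range B, (g (k+i) - c))^2
      ≤ (1/(B:ℝ))^2 * (B * ∑ i ∈ range B, (g (k+i) - c)^2) := by gcongr
    _ = _ := by field_simp

/-- Step 1 -/
lemma comb_step1 (g G : ℕ → ℝ) (N i : ℕ) (ε : ℝ) (hε0 : 0 ≤ ε) (hε1 : ε ≤ 1)
    (h1 : ∀ j, |g j| ≤ 1 + ε) (hG : ∀ j, |G j| ≤ 1 + ε) (hi : i ≤ N)
    (h3 : (N+i:ℕ) * G (N+i) - ε * N ≤ ∑ j ∈ range (N+i), g j * G (N+i-j))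
    (h4 : 1 - ε ≤ G (N+i)) :
    ∑ j ∈ range (N+i), (g j - G (N+i-j))^2 ≤ 18 * ε * N := by
  have e : ∑ j ∈ range (N+i), (g j - G (N+i-j))^2 = ∑ j ∈ range (N+i), ((g j)^2 + (G (N+i-j))^2)
      - 2 * ∑ j ∈ range (N+i), g j * G (N+i-j) := by
    rw [mul_sum, ← sum_sub_distrib]; refine sum_congr rfl fun j _ => by ring
  have hsq : ∀ x : ℝ, |x| ≤ 1 + ε → x^2 ≤ 1 + 3*ε := fun x hx => by
    rw [← sq_abs]; nlinarith [abs_nonneg x]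
  have b : ∑ j ∈ range (N+i), ((g j)^2 + (G (N+i-j))^2) ≤ ∑ j ∈ range (N+i), (2 + 6*ε) :=
    sum_le_sum fun j _ => by linarith [hsq _ (h1 j), hsq _ (hG (N+i-j))]
  simp only [sum_const, card_range, nsmul_eq_mul] at b
  rw [e]
  have hi' : (i:ℝ) ≤ N := by exact_mod_cast hi
  push_cast at *
  have hNi : (0:ℝ) ≤ (N:ℝ) + i := by positivity
  nlinarith [mul_le_mul_of_nonneg_left h4 hNi, mul_le_mul_of_nonneg_left hi' hε0]

/-- Step 2 -/
lemma comb_step2 (g : ℕ → ℝ) (N B : ℕ) (ε : ℝ) (hε0 : 0 ≤ ε) (hε1 : ε ≤ 1) (hB : 1 ≤ B) (hBN : B ≤ N)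
    (h1 : ∀ j, |g j| ≤ 1 + ε)
    (h3 : ∀ J < N + B, J * avg B g J - ε * N ≤ ∑ j ∈ range J, g j * avg B g (J-j))
    (h4 : ∀ i < B, 1 - ε ≤ avg B g (N+i)) :
    ∑ j ∈ range N, (g j - avg B g j)^2 ≤ 72 * ε * N := by
  have hB' : (0:ℝ) < B := by exact_mod_cast hB
  have s1 : ∀ i < B, ∑ j ∈ range (N+i), (g j - avg B g (N+i-j))^2 ≤ 18 * ε * N := fun i hi =>
    comb_step1 g _ N i ε hε0 hε1 h1 (avg_abs_le hB h1) (by omega) (h3 _ (by omega)) (h4 i hi)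
  have s2 : ∀ i < B, ∑ j ∈ range N, (g (j+i) - avg B g (N-j))^2 ≤ 18 * ε * N := fun i hi => by
    refine le_trans ?_ (s1 i hi)
    have : ∑ j ∈ range N, (g (j+i) - avg B g (N-j))^2
        = ∑ j ∈ Ico i (N+i), (g j - avg B g (N+i-j))^2 := by
      rw [sum_Ico_eq_sum_range]
      have : N + i - i = N := by omega
      rw [this]
      refine sum_congr rfl fun j _ => ?_
      have h : N + i - (i + j) = N - j := by omega
      rw [h, add_comm i j]
    rw [this]
    refine sum_le_sum_of_subset_of_nonneg ?_ fun _ _ _ => sq_nonneg _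
    intro j; simp
  have s3 : ∑ j ∈ range N, (avg B g j - avg B g (N-j))^2 ≤ 18 * ε * N := by
    calc _ ≤ ∑ j ∈ range N, (1/(B:ℝ)) * ∑ i ∈ range B, (g (j+i) - avg B g (N-j))^2 :=
          sum_le_sum fun j _ => avg_sub_sq_le hB g j _
      _ = (1/(B:ℝ)) * ∑ i ∈ range B, ∑ j ∈ range N, (g (j+i) - avg B g (N-j))^2 := by
          rw [← mul_sum, sum_comm]
      _ ≤ (1/(B:ℝ)) * ∑ i ∈ range B, 18 * ε * N := by
          gcongr with i hi; exact s2 i (mem_range.1 hi)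
      _ = _ := by simp; field_simp
  have s4 := s2 0 (by omega)
  simp only [add_zero] at s4
  calc _ ≤ ∑ j ∈ range N, (2 * (g j - avg B g (N-j))^2 + 2 * (avg B g j - avg B g (N-j))^2) :=
        sum_le_sum fun j _ => by nlinarith [sq_nonneg ((g j - avg B g (N-j)) + (avg B g j - avg B g (N-j)))]
    _ = 2 * ∑ j ∈ range N, (g j - avg B g (N-j))^2 + 2 * ∑ j ∈ range N, (avg B g j - avg B g (N-j))^2 := by
        rw [sum_add_distrib, mul_sum, mul_sum]
    _ ≤ _ := by linarith

/-- Step 3 -/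
lemma comb_step3 (g G : ℕ → ℝ) (N : ℕ) (ε : ℝ) (hε0 : 0 ≤ ε) (hε1 : ε ≤ 1/100)
    (h1 : ∀ j, |g j| ≤ 1 + ε) (hG : ∀ j, |G j| ≤ 1 + ε)
    (h3 : N * G N - ε * N ≤ ∑ j ∈ range N, g j * G (N-j))
    (h4 : 1 - ε ≤ G N) :
    ∑ j ∈ range N, |(1 - |g j|)| ≤ 5 * ε * N ∧ ∑ j ∈ range N, |1 - (g j)^2| ≤ 11 * ε * N := by
  have a : (1 - 2*ε) * N ≤ (1+ε) * ∑ j ∈ range N, |g j| := by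
    calc (1-2*ε)*N ≤ N * G N - ε * N := by nlinarith [(Nat.cast_nonneg N : (0:ℝ) ≤ N)]
      _ ≤ _ := h3
      _ ≤ ∑ j ∈ range N, (1+ε) * |g j| := sum_le_sum fun j _ => by
          calc g j * G (N-j) ≤ |g j * G (N-j)| := le_abs_self _
            _ = |G (N-j)| * |g j| := by rw [abs_mul, mul_comm]
            _ ≤ _ := by gcongr; exact hG _
      _ = _ := by rw [mul_sum]
  have hN : (0:ℝ) ≤ N := by positivity
  have b : (1 - 3*ε)*N ≤ ∑ j ∈ range N, |g j| := by
    by_contra hc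
    push Not at hc
    nlinarith [mul_nonneg hε0 hN, mul_nonneg hε0 hε0]
  have c : ∑ j ∈ range N, |(1 - |g j|)| ≤ 5 * ε * N := by
    calc _ ≤ ∑ j ∈ range N, (1 + 2*ε - |g j|) := sum_le_sum fun j _ => by
          rw [abs_le]; constructor <;> linarith [h1 j]
      _ = (1+2*ε)*N - ∑ j ∈ range N, |g j| := by rw [sum_sub_distrib]; simp; ring
      _ ≤ _ := by linarith
  refine ⟨c, ?_⟩
  calc _ ≤ ∑ j ∈ range N, 2.1 * |(1 - |g j|)| := sum_le_sum fun j _ => by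
        rw [← sq_abs, show 1 - |g j|^2 = (1+|g j|) * (1-|g j|) by ring, abs_mul,
          abs_of_nonneg (by positivity)]
        gcongr
        linarith [h1 j]
    _ = 2.1 * ∑ j ∈ range N, |(1 - |g j|)| := by rw [mul_sum]
    _ ≤ _ := by nlinarith [mul_nonneg hε0 hN]

lemma sum_abs_le_of_sq (s : Finset ι) (f : ι → ℝ) (c n : ℝ) (hc : 0 ≤ c) (hn : (#s : ℝ) ≤ n)
    (h : n * ∑ i ∈ s, (f i)^2 ≤ c^2) : ∑ i ∈ s, |f i| ≤ c := by
  refine abs_le_of_sq_le_sq' ?_ hc |>.2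
  have := sq_sum_le_card_mul_sum_sq (s := s) (f := fun i => |f i|)
  simp only [sq_abs] at this
  refine this.trans (le_trans ?_ h)
  have : 0 ≤ ∑ i ∈ s, (f i)^2 := sum_nonneg fun _ _ => sq_nonneg _
  gcongr

/-- the defect -/
lemma comb_step4 (g : ℕ → ℝ) (G : ℕ → ℝ) (N : ℕ) (ε σ : ℝ) (hσ : 0 < σ) (hσ1 : σ ≤ 1/100) (hε : ε = σ^4)
    (hN : 1 ≤ ε * N)
    (h1 : ∀ j, |g j| ≤ 1 + ε)
    (h2 : ∀ J ≤ N, |∑ j ∈ range J, g j| ≤ ε * N)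
    (h3 : ∀ J < N, J * G J - ε * N ≤ ∑ j ∈ range J, g j * G (J-j))
    (hu : ∑ j ∈ range N, |g j - G j| ≤ 9 * σ^2 * N) :
    ∑ J ∈ range N, |∑ j ∈ range J, g j * g (J-j) - J * g J| ≤ 46 * σ^2 * N^2 := by
  have hε0 : 0 ≤ ε := by rw [hε]; positivity
  have hεσ : ε ≤ σ^2 / 10000 := by
    rw [hε]; nlinarith [sq_nonneg σ, mul_le_mul hσ1 hσ1 hσ.le (by norm_num)]
  have hσ2 : σ^2 ≤ 1/10000 := by nlinarith
  have hN0 : (0:ℝ) ≤ N := by positivity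
  set u : ℕ → ℝ := fun j => |g j - G j| with hudef
  have hu0 : ∀ j, 0 ≤ u j := fun j => abs_nonneg _
  set q : ℕ → ℝ := fun J => ∑ j ∈ range J, g j * g (J-j) - J * g J with hq
  have hlow : ∀ J ∈ range N, -(N * u J + 11 * σ^2 * N) ≤ q J := by
    intro J hJ
    have hJN := mem_range.1 hJ
    have hJN' : (J:ℝ) ≤ N := by exact_mod_cast hJN.le
    have a := h3 J hJN
    have b : ∑ j ∈ range J, g j * G (J-j) ≤ ∑ j ∈ range J, g j * g (J-j) + (1+ε) * (9*σ^2*N) := by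
      have : ∑ j ∈ range J, u (J-j) ≤ 9*σ^2*N := by
        refine le_trans ?_ hu
        have : ∑ j ∈ range J, u (J-j) = ∑ j ∈ range J, u (j+1) := by
          rw [← sum_range_reflect]
          refine sum_congr rfl fun j hj => ?_
          have := mem_range.1 hj
          congr 1; omega
        rw [this]
        have h5 : ∑ j ∈ range J, u (j+1) ≤ ∑ j ∈ range (J+1), u j := by
          rw [sum_range_succ']; linarith [hu0 0]
        refine h5.trans (sum_le_sum_of_subset_of_nonneg ?_ fun _ _ _ => hu0 _)
        intro j; simp; omega
      calc _ ≤ ∑ j ∈ range J, (g j * g (J-j) + (1+ε) * u (J-j)) := sum_le_sum fun j _ => by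
            have : g j * (G (J-j) - g (J-j)) ≤ (1+ε) * u (J-j) := by
              calc _ ≤ |g j * (G (J-j) - g (J-j))| := le_abs_self _
                _ = |g j| * u (J-j) := by rw [abs_mul, abs_sub_comm]
                _ ≤ _ := by gcongr; exact h1 _
            linarith
        _ = ∑ j ∈ range J, g j * g (J-j) + (1+ε) * ∑ j ∈ range J, u (J-j) := by
            rw [sum_add_distrib, mul_sum]
        _ ≤ _ := by gcongr
    have c : J * g J - N * u J ≤ J * G J := by
      have : J * (g J - G J) ≤ N * u J := by
        calc J * (g J - G J) ≤ J * u J := by gcongr; exact le_abs_self _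
          _ ≤ _ := by gcongr
      linarith
    have hs : 0 ≤ σ^2 * N := by positivity
    have d : (1+ε) * (9*σ^2*N) + ε * N ≤ 11 * σ^2 * N := by
      nlinarith [mul_le_mul_of_nonneg_right hεσ hN0, mul_le_mul_of_nonneg_right hεσ hs]
    simp only [hq]; linarith
  -- sum of q
  have hsum : ∑ J ∈ range N, q J ≤ 6 * ε * N^2 := by
    have a : -(2 * ε * N^2) ≤ ∑ J ∈ range N, (J:ℝ) * g J := by
      have e : ∑ J ∈ range N, (J:ℝ) * g J = ∑ i ∈ range N, (∑ J ∈ range N, g J - ∑ J ∈ range (i+1), g J) := by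
        have : ∀ M : ℕ, ∑ J ∈ range M, (J:ℝ) * g J = ∑ i ∈ range M, (∑ J ∈ range M, g J - ∑ J ∈ range (i+1), g J) := by
          intro M
          induction M with
          | zero => simp
          | succ M ih =>
            rw [sum_range_succ, ih, sum_range_succ _ M]
            simp only [sum_range_succ _ M, sub_self, add_zero]
            simp only [add_sub_right_comm _ (g M), sum_add_distrib]
            simp
        exact this N
      rw [e]
      calc -(2 * ε * N^2) = ∑ i ∈ range N, (-(2 * ε * N)) := by simp; ring
        _ ≤ _ := sum_le_sum fun i hi => by
          have h5 := abs_le.1 (h2 N le_rfl)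
          have h6 := abs_le.1 (h2 (i+1) (mem_range.1 hi))
          linarith
    have b : ∑ J ∈ range N, ∑ j ∈ range J, g j * g (J-j) ≤ 4 * ε * N^2 := by
      have e : ∑ J ∈ range N, ∑ j ∈ range J, g j * g (J-j)
          = ∑ j ∈ range N, g j * (∑ k ∈ range (N - j), g k - g 0) := by
        have e1 : ∑ J ∈ range N, ∑ j ∈ range J, g j * g (J-j)
            = ∑ j ∈ range N, ∑ J ∈ Ico (j+1) N, g j * g (J-j) := by
          refine sum_comm' fun x y => ?_
          simp; omega
        rw [e1]
        refine sum_congr rfl fun j hj => ?_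
        have hj := mem_range.1 hj
        rw [← mul_sum, sum_Ico_eq_sum_range]
        congr 1
        obtain ⟨m, hm⟩ : ∃ m, N - j = m + 1 := ⟨N - j - 1, by omega⟩
        rw [hm, sum_range_succ', show N - (j+1) = m by omega, add_sub_cancel_right]
        refine sum_congr rfl fun k _ => ?_
        congr 1; omega
      rw [e]
      calc _ ≤ ∑ j ∈ range N, (1+ε) * (3 * ε * N) := sum_le_sum fun j hj => by
            calc _ ≤ |g j * (∑ k ∈ range (N - j), g k - g 0)| := le_abs_self _
              _ = |g j| * |∑ k ∈ range (N - j), g k - g 0| := abs_mul _ _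
              _ ≤ (1+ε) * (3*ε*N) := by
                refine mul_le_mul (h1 j) ?_ (abs_nonneg _) (by positivity)
                have h5 := h2 (N-j) (by omega)
                have h6 := h1 0
                have := abs_sub (∑ k ∈ range (N - j), g k) (g 0)
                linarith
        _ = (1+ε) * 3 * ε * N^2 := by simp; ring
        _ ≤ _ := by nlinarith [mul_nonneg hε0 (sq_nonneg (N:ℝ))]
    simp only [hq, sum_sub_distrib]
    linarith
  calc ∑ J ∈ range N, |q J| ≤ ∑ J ∈ range N, (q J + 2 * (N * u J + 11 * σ^2 * N)) := by
        refine sum_le_sum fun J hJ => ?_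
        have h5 := hlow J hJ
        have h6 : 0 ≤ N * u J + 11 * σ^2 * N := by have := hu0 J; positivity
        rw [abs_le]; constructor <;> linarith
    _ = ∑ J ∈ range N, q J + 2 * N * ∑ J ∈ range N, u J + 22 * σ^2 * N^2 := by
        simp only [sum_add_distrib, ← mul_sum]; simp; ring
    _ ≤ 6 * ε * N^2 + 2 * N * (9*σ^2*N) + 22*σ^2*N^2 := by gcongr
    _ ≤ _ := by nlinarith [mul_le_mul_of_nonneg_right hεσ (sq_nonneg (N:ℝ)), mul_nonneg (sq_nonneg σ) (sq_nonneg (N:ℝ))]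
end HH

namespace HH
open Finset

/-- Steps 5, 6: total multiplicative defect -/
lemma comb_step6 (g : ℕ → ℝ) (N : ℕ) (ε σ : ℝ) (hσ : 0 < σ) (hσ1 : σ ≤ 1/100) (hε : ε = σ^4)
    (h1 : ∀ j, |g j| ≤ 1 + ε)
    (hsq : ∑ j ∈ range N, |1 - (g j)^2| ≤ 11 * ε * N)
    (hq : ∑ J ∈ range N, |∑ j ∈ range J, g j * g (J-j) - J * g J| ≤ 46 * σ^2 * N^2) :
    ∑ J ∈ range N, ∑ j ∈ range J, |g J - g j * g (J-j)| ≤ 12 * σ * N^2 := by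
  have hε0 : 0 ≤ ε := by rw [hε]; positivity
  have hεσ : ε ≤ σ^2 / 10000 := by
    rw [hε]; nlinarith [sq_nonneg σ, mul_le_mul hσ1 hσ1 hσ.le (by norm_num)]
  have hσ2 : σ^2 ≤ 1/10000 := by nlinarith
  have hN0 : (0:ℝ) ≤ N := by positivity
  set Z : ℝ := ∑ J ∈ range N, (J:ℝ) with hZ
  have hZ0 : 0 ≤ Z := sum_nonneg fun _ _ => by positivity
  have hZN : Z ≤ N^2 := by
    calc Z ≤ ∑ J ∈ range N, (N:ℝ) := sum_le_sum fun J hJ => by exact_mod_cast (mem_range.1 hJ).le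
      _ = N^2 := by simp; ring
  set T : ℝ := ∑ J ∈ range N, ∑ j ∈ range J, g J * (g j * g (J-j)) with hT
  have hTl : Z - 11*ε*N^2 - 47*σ^2*N^2 ≤ T := by
    have e : T = ∑ J ∈ range N, g J * (∑ j ∈ range J, g j * g (J-j) - J * g J) + ∑ J ∈ range N, (J:ℝ) * (g J)^2 := by
      rw [hT, ← sum_add_distrib]
      refine sum_congr rfl fun J _ => ?_
      rw [← mul_sum]; ring
    have a : -(47 * σ^2 * N^2) ≤ ∑ J ∈ range N, g J * (∑ j ∈ range J, g j * g (J-j) - J * g J) := by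
      calc -(47 * σ^2 * N^2) ≤ -((1+ε) * (46 * σ^2 * N^2)) := by
            have : 0 ≤ σ^2 * N^2 := by positivity
            nlinarith
        _ ≤ -((1+ε) * ∑ J ∈ range N, |∑ j ∈ range J, g j * g (J-j) - J * g J|) := by gcongr
        _ = ∑ J ∈ range N, -((1+ε) * |∑ j ∈ range J, g j * g (J-j) - J * g J|) := by
            rw [mul_sum, sum_neg_distrib]
        _ ≤ _ := sum_le_sum fun J _ => by
            refine neg_le.1 (le_trans (neg_le_abs _) ?_)
            rw [abs_mul]; gcongr; exact h1 J
    have b : Z - 11*ε*N^2 ≤ ∑ J ∈ range N, (J:ℝ) * (g J)^2 := by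
      have : Z - ∑ J ∈ range N, (J:ℝ) * (g J)^2 ≤ N * (11 * ε * N) := by
        calc Z - ∑ J ∈ range N, (J:ℝ) * (g J)^2 = ∑ J ∈ range N, (J:ℝ) * (1 - (g J)^2) := by
              rw [hZ, ← sum_sub_distrib]; exact sum_congr rfl fun J _ => by ring
          _ ≤ ∑ J ∈ range N, (N:ℝ) * |1 - (g J)^2| := sum_le_sum fun J hJ => by
              have : (J:ℝ) ≤ N := by exact_mod_cast (mem_range.1 hJ).le
              calc _ ≤ (J:ℝ) * |1 - (g J)^2| := by gcongr; exact le_abs_self _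
                _ ≤ _ := by gcongr
          _ = (N:ℝ) * ∑ J ∈ range N, |1 - (g J)^2| := by rw [mul_sum]
          _ ≤ _ := by gcongr
      linarith
    linarith
  have hD : ∑ J ∈ range N, ∑ j ∈ range J, (g J - g j * g (J-j))^2 ≤ 124 * σ^2 * N^2 := by
    have e : ∑ J ∈ range N, ∑ j ∈ range J, (g J - g j * g (J-j))^2
        = ∑ J ∈ range N, ∑ j ∈ range J, ((g J)^2 + (g j)^2 * (g (J-j))^2) - 2 * T := by
      rw [hT, mul_sum, ← sum_sub_distrib]
      refine sum_congr rfl fun J _ => ?_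
      rw [mul_sum, ← sum_sub_distrib]
      exact sum_congr rfl fun j _ => by ring
    have hs : ∀ j, (g j)^2 ≤ 1 + 3*ε := fun j => by
      rw [← sq_abs]; nlinarith [abs_nonneg (g j), h1 j]
    have b : ∑ J ∈ range N, ∑ j ∈ range J, ((g J)^2 + (g j)^2 * (g (J-j))^2) ≤ Z * (2 + 10*ε) := by
      calc _ ≤ ∑ J ∈ range N, ∑ j ∈ range J, (2 + 10*ε) := by
            refine sum_le_sum fun J _ => sum_le_sum fun j _ => ?_
            have := mul_le_mul (hs j) (hs (J-j)) (sq_nonneg _) (by positivity)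
            nlinarith [hs J]
        _ = _ := by
            rw [hZ, sum_mul]; refine sum_congr rfl fun J _ => ?_
            rw [sum_const, card_range, nsmul_eq_mul]
    rw [e]
    have : Z * (10*ε) ≤ N^2 * (10*ε) := by gcongr
    have h7 := mul_le_mul_of_nonneg_right hεσ (sq_nonneg (N:ℝ))
    have h8 : 0 ≤ σ^2 * N^2 := by positivity
    nlinarith
  rw [sum_sigma'] at hD ⊢
  refine sum_abs_le_of_sq _ (fun x : (_ : ℕ) × ℕ => g x.1 - g x.2 * g (x.1 - x.2)) _ (N^2) (by positivity) ?_ ?_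
  · rw [card_sigma]; push_cast; simpa [hZ] using hZN
  · calc _ ≤ (N:ℝ)^2 * (124 * σ^2 * N^2) := by gcongr
      _ ≤ _ := by nlinarith [mul_nonneg (sq_nonneg σ) (sq_nonneg ((N:ℝ)^2))]

lemma comb_step7 (g : ℕ → ℝ) (N M : ℕ) (ε P : ℝ) (hM : 3 * M ≤ N) (hε0 : 0 ≤ ε) (hε1 : ε ≤ 1)
    (h1 : ∀ j, |g j| ≤ 1 + ε)
    (hP : ∑ J ∈ range N, ∑ j ∈ range J, |g J - g j * g (J-j)| ≤ P) :
    (∑ j ∈ range M, |g j|) * ∑ s ∈ Ico 1 M, |g (2*s) - (g s)^2| ≤ 4 * P := by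
  rw [sum_sigma'] at hP
  have key : ∀ φ : ℕ × ℕ → (_ : ℕ) × ℕ, (∀ p ∈ range M ×ˢ Ico 1 M, φ p ∈ (range N).sigma fun J => range J) →
      Set.InjOn φ (range M ×ˢ Ico 1 M : Finset (ℕ × ℕ)) →
      ∑ p ∈ range M ×ˢ Ico 1 M, |g (φ p).1 - g (φ p).2 * g ((φ p).1 - (φ p).2)| ≤ P := by
    intro φ h5 h6
    refine le_trans ?_ hP
    rw [← sum_image (f := fun x : (_ : ℕ) × ℕ => |g x.1 - g x.2 * g (x.1 - x.2)|) h6]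
    refine sum_le_sum_of_subset_of_nonneg ?_ fun _ _ _ => abs_nonneg _
    intro x hx
    obtain ⟨p, hp, rfl⟩ := mem_image.1 hx
    exact h5 p hp
  have k1 := key (fun p => ⟨p.1 + 2*p.2, p.1⟩) (by
      rintro ⟨j, s⟩ h; simp at h ⊢; omega) (by
      rintro ⟨j, s⟩ _ ⟨j', s'⟩ _ h; simp at h ⊢; omega)
  have k2 := key (fun p => ⟨p.1 + 2*p.2, p.1 + p.2⟩) (by
      rintro ⟨j, s⟩ h; simp at h ⊢; omega) (by
      rintro ⟨j, s⟩ _ ⟨j', s'⟩ _ h; simp at h ⊢; omega)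
  have k3 := key (fun p => ⟨p.1 + p.2, p.1⟩) (by
      rintro ⟨j, s⟩ h; simp at h ⊢; omega) (by
      rintro ⟨j, s⟩ _ ⟨j', s'⟩ _ h; simp at h ⊢; omega)
  rw [sum_mul_sum, ← sum_product']
  have hP0 : 0 ≤ P := le_trans (sum_nonneg fun _ _ => abs_nonneg _) k1
  calc _ ≤ ∑ p ∈ range M ×ˢ Ico 1 M, (|g (p.1 + 2*p.2) - g p.1 * g (p.1 + 2*p.2 - p.1)|
          + |g (p.1+2*p.2) - g (p.1+p.2) * g (p.1 + 2*p.2 - (p.1+p.2))|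
          + (1+ε) * |g (p.1+p.2) - g p.1 * g (p.1+p.2-p.1)|) := by
        refine sum_le_sum fun p _ => ?_
        obtain ⟨j, s⟩ := p
        have e1 : j + 2*s - j = 2*s := by omega
        have e2 : j + 2*s - (j+s) = s := by omega
        have e3 : j + s - j = s := by omega
        simp only [e1, e2, e3]
        rw [← abs_mul]
        have e4 : g j * (g (2*s) - (g s)^2) = -(g (j+2*s) - g j * g (2*s)) + (g (j+2*s) - g (j+s) * g s)
            + g s * (g (j+s) - g j * g s) := by ring
        rw [e4]
        refine (abs_add_le _ _).trans (add_le_add ((abs_add_le _ _).trans (by rw [abs_neg])) ?_)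
        rw [abs_mul]; gcongr; exact h1 s
    _ ≤ P + P + (1+ε) * P := by
        rw [sum_add_distrib, sum_add_distrib, ← mul_sum]
        gcongr
    _ ≤ 4 * P := by nlinarith

set_option maxHeartbeats 1000000 in
/-- The combinatorial core. -/
theorem comb_core (g : ℕ → ℝ) (N B : ℕ) (ε σ : ℝ) (hσ : 0 < σ) (hσ1 : σ ≤ 1/100000) (hε : ε = σ^4)
    (hB : 1 ≤ B) (hBε : 1 / (B:ℝ) ≤ ε) (hBN : (B:ℝ) ≤ ε * N)
    (h1 : ∀ j, |g j| ≤ 1 + ε)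
    (h2 : ∀ J ≤ N, |∑ j ∈ range J, g j| ≤ ε * N)
    (h3 : ∀ J < N + B, J * avg B g J - ε * N ≤ ∑ j ∈ range J, g j * avg B g (J-j))
    (h4 : ∀ i < B, 1 - ε ≤ avg B g (N+i)) : False := by
  have hε0 : 0 < ε := by rw [hε]; positivity
  have hσ2 : σ^2 ≤ σ/100000 := by nlinarith
  have hεσ : ε ≤ σ/100000 := by
    rw [hε]
    calc σ^4 = σ^2 * σ^2 := by ring
      _ ≤ 1 * (σ/100000) := by gcongr; nlinarith
      _ = _ := by ring
  have hB1 : (1:ℝ) ≤ B := by exact_mod_cast hB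
  have hN1 : 1 ≤ ε * N := hB1.trans hBN
  have hN0 : (0:ℝ) ≤ N := by positivity
  have hBN' : B ≤ N := by
    have : (B:ℝ) ≤ N := by nlinarith
    exact_mod_cast this
  set G := avg B g with hG
  have hGb : ∀ j, |G j| ≤ 1 + ε := avg_abs_le hB h1
  have s2 := comb_step2 g N B ε hε0.le (by linarith) hB hBN' h1 h3 h4
  have hu : ∑ j ∈ range N, |g j - G j| ≤ 9 * σ^2 * N := by
    refine sum_abs_le_of_sq _ (fun j => g j - G j) _ N (by positivity) (by simp) ?_
    calc _ ≤ N * (72 * ε * N) := by gcongr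
      _ ≤ _ := by rw [hε]; nlinarith [mul_nonneg (sq_nonneg (σ^2)) (sq_nonneg (N:ℝ))]
  obtain ⟨s3, s3'⟩ := comb_step3 g G N ε hε0.le (by linarith) h1 hGb (h3 N (by omega)) (h4 0 (by omega))
  have s4 := comb_step4 g G N ε σ hσ (by linarith) hε hN1 h1 h2 (fun J hJ => h3 J (by omega)) hu
  have s6 := comb_step6 g N ε σ hσ (by linarith) hε h1 s3' s4
  obtain ⟨M, hM4, hM5⟩ : ∃ M, 4 * M ≤ N ∧ N < 4 * M + 4 := ⟨N/4, by omega, by omega⟩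
  have hM5' : (N:ℝ) < 4 * M + 4 := by exact_mod_cast hM5
  have hM4' : (4:ℝ) * M ≤ N := by exact_mod_cast hM4
  have s7 := comb_step7 g N M ε _ (by omega) hε0.le (by linarith) h1 s6
  have hNbig : (10000:ℝ) ≤ N := by nlinarith
  have hMN : (N:ℝ)/8 ≤ M := by linarith
  have sub : range M ⊆ range N := by intro j; simp; omega
  have a : (N:ℝ)/16 ≤ ∑ j ∈ range M, |g j| := by
    have : ∑ j ∈ range M, (1 - |g j|) ≤ 5 * ε * N := by
      calc _ ≤ ∑ j ∈ range M, |(1 - |g j|)| := sum_le_sum fun j _ => le_abs_self _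
        _ ≤ ∑ j ∈ range N, |(1 - |g j|)| := sum_le_sum_of_subset_of_nonneg sub fun _ _ _ => abs_nonneg _
        _ ≤ _ := s3
    rw [sum_sub_distrib] at this
    simp at this
    nlinarith
  set X := ∑ s ∈ Ico 1 M, |g (2*s) - (g s)^2| with hX
  have hX0 : 0 ≤ X := sum_nonneg fun _ _ => abs_nonneg _
  have hXle : X ≤ 768 * σ * N := by
    have : (N:ℝ)/16 * X ≤ 4 * (12 * σ * N^2) := (mul_le_mul_of_nonneg_right a hX0).trans s7
    have hNp : (0:ℝ) < N := by linarith
    nlinarith [this]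
  have b : (M:ℝ) - 1 - 11*ε*N - 768*σ*N ≤ ∑ s ∈ Ico 1 M, g (2*s) := by
    have h5 : ∑ s ∈ Ico 1 M, (1 - g (2*s)) ≤ ∑ s ∈ Ico 1 M, (|1 - (g s)^2| + |g (2*s) - (g s)^2|) :=
      sum_le_sum fun s _ => by
        have := le_abs_self (1 - (g s)^2)
        have := neg_le_abs (g (2*s) - (g s)^2)
        linarith
    rw [sum_add_distrib, sum_sub_distrib] at h5
    have h6 : ∑ s ∈ Ico 1 M, |1 - (g s)^2| ≤ 11 * ε * N :=
      le_trans (sum_le_sum_of_subset_of_nonneg (by intro j; simp; omega) fun _ _ _ => abs_nonneg _) s3'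
    simp only [sum_const, Nat.card_Ico, nsmul_eq_mul, mul_one] at h5
    have : ((M - 1 : ℕ):ℝ) = M - 1 := by rw [Nat.cast_sub (by by_contra h; push Not at h; interval_cases M; norm_num at hMN; linarith)]; simp
    rw [this] at h5
    linarith
  have c : ∑ s ∈ Ico 1 M, g (2*s) ≤ ∑ s ∈ range M, G (2*s) + 9*σ^2*N + (1+ε) := by
    have h5 : ∑ s ∈ Ico 1 M, g (2*s) = ∑ s ∈ range M, g (2*s) - g 0 := by
      rw [sum_Ico_eq_sub _ (by by_contra h; push Not at h; interval_cases M; norm_num at hMN; linarith)]; simp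
    have h6 : ∑ s ∈ range M, (g (2*s) - G (2*s)) ≤ 9*σ^2*N := by
      calc _ ≤ ∑ s ∈ range M, |g (2*s) - G (2*s)| := sum_le_sum fun _ _ => le_abs_self _
        _ = ∑ k ∈ (range M).image (fun s => 2*s), |g k - G k| := by
          rw [sum_image]; intro a _ b _ h; simp at h; exact h
        _ ≤ ∑ k ∈ range N, |g k - G k| := by
          refine sum_le_sum_of_subset_of_nonneg ?_ fun _ _ _ => abs_nonneg _
          intro k; simp; rintro x hx rfl; omega
        _ ≤ _ := hu
    rw [sum_sub_distrib] at h6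
    have := neg_le_abs (g 0)
    have := h1 0
    linarith
  have d : ∀ s, G (2*s) ≤ (G (2*s) + G (2*s+1))/2 + 2 * ε := by
    intro s
    have e : G (2*s+1) - G (2*s) = (1/(B:ℝ)) * (g (2*s+B) - g (2*s)) := by
      simp only [hG, avg, ← mul_sub]
      congr 1
      have := sum_range_succ (fun i => g (2*s+i)) B
      have h' := sum_range_succ' (fun i => g (2*s+i)) B
      simp only [add_zero] at h'
      have e2 : ∀ i, 2*s + 1 + i = 2*s + (i+1) := fun i => by ring
      simp only [e2]
      linarith
    have f : -(4 * ε) ≤ G (2*s+1) - G (2*s) := by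
      rw [e]
      have h5 : -4 ≤ g (2*s+B) - g (2*s) := by
        linarith [neg_le_abs (g (2*s+B)), le_abs_self (g (2*s)), h1 (2*s+B), h1 (2*s)]
      have h6 : (0:ℝ) ≤ 1/(B:ℝ) := by positivity
      nlinarith
    linarith
  have e : ∑ s ∈ range M, G (2*s) ≤ (∑ k ∈ range (2*M), G k)/2 + 2*ε*M := by
    have h5 : ∀ m : ℕ, ∑ k ∈ range (2*m), G k = ∑ s ∈ range m, (G (2*s) + G (2*s+1)) := by
      intro m
      induction m with
      | zero => simp
      | succ m ih =>
        rw [sum_range_succ, ← ih, show 2*(m+1) = 2*m+1+1 by ring, sum_range_succ, sum_range_succ]; ring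
    rw [h5]
    calc _ ≤ ∑ s ∈ range M, ((G (2*s) + G (2*s+1))/2 + 2*ε) := sum_le_sum fun s _ => d s
      _ = _ := by rw [sum_add_distrib, sum_div]; simp; ring
  have f : ∑ k ∈ range (2*M), G k ≤ ε*N + 9*σ^2*N := by
    have h5 : ∑ k ∈ range (2*M), (G k - g k) ≤ 9*σ^2*N := by
      calc _ ≤ ∑ k ∈ range (2*M), |g k - G k| := sum_le_sum fun k _ => by
            rw [abs_sub_comm]; exact le_abs_self _
        _ ≤ ∑ k ∈ range N, |g k - G k| := by
          refine sum_le_sum_of_subset_of_nonneg ?_ fun _ _ _ => abs_nonneg _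
          intro k; simp; omega
        _ ≤ _ := hu
    rw [sum_sub_distrib] at h5
    have := (abs_le.1 (h2 (2*M) (by omega))).2
    linarith
  have hσN : σ * N ≤ N / 100000 := by nlinarith
  have h9 : σ^2*N ≤ σ*N/100000 := by
    calc σ^2*N ≤ σ/100000*N := by gcongr
      _ = _ := by ring
  have h10 : ε * N ≤ σ*N/100000 := by
    calc ε*N ≤ σ/100000*N := by gcongr
      _ = _ := by ring
  have h11 : ε * M ≤ σ*N/100000 := by
    refine le_trans ?_ h10
    have : (M:ℝ) ≤ N := by linarith
    gcongr
  have r1 : 11*ε*N = 11*(ε*N) := by ring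
  have r2 : 768*σ*N = 768*(σ*N) := by ring
  have r3 : 9*σ^2*N = 9*(σ^2*N) := by ring
  have r4 : 2*ε*M = 2*(ε*M) := by ring
  rw [r1, r2] at b
  rw [r3] at c f
  rw [r4] at e
  linarith
end HH

namespace HH
open Finset ArithmeticFunction
open scoped ArithmeticFunction.Moebius ArithmeticFunction.vonMangoldt

/-- hyperbola rearrangement -/
lemma sum_hyper (f : ℕ → ℕ → ℝ) (N : ℕ) :
    ∑ k ∈ Ioc 0 N, ∑ j ∈ Ioc 0 (N / k), f k j =
      ∑ n ∈ Ioc 0 N, ∑ p ∈ n.divisorsAntidiagonal, f p.1 p.2 := by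
  rw [sum_sigma', sum_sigma']
  refine sum_bij' (fun x _ => ⟨x.1 * x.2, (x.1, x.2)⟩) (fun x _ => ⟨x.2.1, x.2.2⟩) ?_ ?_ ?_ ?_ ?_
  · rintro ⟨k, j⟩ h
    simp only [mem_sigma, mem_Ioc, Nat.mem_divisorsAntidiagonal] at h ⊢
    have := (Nat.le_div_iff_mul_le h.1.1).1 h.2.2
    refine ⟨⟨Nat.mul_pos h.1.1 h.2.1, by linarith [Nat.mul_comm j k]⟩, trivial, (Nat.mul_pos h.1.1 h.2.1).ne'⟩
  · rintro ⟨n, k, j⟩ h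
    simp only [mem_sigma, mem_Ioc, Nat.mem_divisorsAntidiagonal] at h ⊢
    obtain ⟨⟨h1, h2⟩, rfl, h4⟩ := h
    have hk : 0 < k := Nat.pos_of_mul_pos_right h1
    have hj : 0 < j := Nat.pos_of_mul_pos_left h1
    refine ⟨⟨hk, le_trans (Nat.le_mul_of_pos_right _ hj) h2⟩, hj, ?_⟩
    rw [Nat.le_div_iff_mul_le hk, mul_comm]; exact h2
  · rintro ⟨k, j⟩ h; rfl
  · rintro ⟨n, k, j⟩ h
    simp only [mem_sigma, mem_Ioc, Nat.mem_divisorsAntidiagonal] at h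
    obtain ⟨⟨h1, h2⟩, rfl, h4⟩ := h
    rfl
  · rintro ⟨k, j⟩ h; rfl

/-- sum over divisors against moebius, as a powerset sum -/
lemma sum_moebius_powerset (n : ℕ) (hn : n ≠ 0) (f : ℕ → ℝ) :
    ∑ m ∈ n.divisors, (μ m : ℝ) * f m =
      ∑ I ∈ n.primeFactors.powerset, (-1:ℝ)^(#I) * f (∏ p ∈ I, p) := by
  have h1 : ∑ m ∈ n.divisors, (μ m : ℝ) * f m
      = ∑ m ∈ n.divisors with Squarefree m, (μ m : ℝ) * f m := by
    rw [sum_filter]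
    refine sum_congr rfl fun m _ => ?_
    split_ifs with h
    · rfl
    · simp [moebius_eq_zero_of_not_squarefree h]
  rw [h1, Nat.sum_divisors_filter_squarefree hn]
  have h2 : (UniqueFactorizationMonoid.normalizedFactors n).toFinset = n.primeFactors := by
    ext p
    rw [Multiset.mem_toFinset, UniqueFactorizationMonoid.mem_normalizedFactors_iff hn, Nat.mem_primeFactors,
      ← Nat.prime_iff]
    exact ⟨fun h => ⟨h.1, h.2, hn⟩, fun h => ⟨h.1, h.2.1⟩⟩
  rw [h2]
  refine sum_congr rfl fun I hI => ?_
  have hI' : ∀ p ∈ I, p.Prime := fun p hp => Nat.prime_of_mem_primeFactors (mem_powerset.1 hI hp)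
  have h3 : I.val.prod = ∏ p ∈ I, p := (Finset.prod_val I)
  rw [h3]
  congr 1
  have h4 : (μ (∏ p ∈ I, p) : ℤ) = ∏ p ∈ I, μ p := by
    exact isMultiplicative_moebius.map_prod_of_prime I hI'
  rw [h4, prod_congr rfl (fun p hp => moebius_apply_prime (hI' p hp))]
  simp

lemma harmonic_est (u : ℝ) (hu : 0 < u) :
    |(∑ j ∈ Ioc 0 ⌊u⌋₊, (1:ℝ)/j) - Real.log u - Real.eulerMascheroniConstant| ≤ 2 / u := by
  have hh : ∀ n : ℕ, (∑ j ∈ Ioc 0 n, (1:ℝ)/j) = (harmonic n : ℝ) := by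
    intro n
    rw [harmonic_eq_sum_Icc]; push_cast
    simp [← Finset.Icc_add_one_left_eq_Ioc]
  rw [hh]
  have g1 := Real.one_half_lt_eulerMascheroniConstant
  have g2 := Real.eulerMascheroniConstant_lt_two_thirds
  rcases lt_or_ge u 1 with h | h
  · rw [Nat.floor_eq_zero.2 h]
    simp only [harmonic_zero, Rat.cast_zero, zero_sub]
    have h3 : Real.log u < 0 := Real.log_neg hu h
    have h4 := Real.log_le_sub_one_of_pos (inv_pos.2 hu)
    rw [Real.log_inv] at h4
    have h5 : 1 < u⁻¹ := (one_lt_inv₀ hu).2 h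
    rw [abs_le, div_eq_mul_inv]; constructor <;> linarith
  · set n := ⌊u⌋₊ with hn
    have hn1 : 1 ≤ n := Nat.one_le_floor_iff _ |>.2 h
    have hn1' : (1:ℝ) ≤ n := by exact_mod_cast hn1
    have hnu : (n:ℝ) ≤ u := Nat.floor_le hu.le
    have hun : u < n + 1 := Nat.lt_floor_add_one u
    have a1 := Real.eulerMascheroniSeq_lt_eulerMascheroniConstant n
    have a2 := Real.eulerMascheroniConstant_lt_eulerMascheroniSeq' n
    rw [Real.eulerMascheroniSeq] at a1
    rw [Real.eulerMascheroniSeq', if_neg (by omega)] at a2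
    have b1 := Real.log_le_sub_one_of_pos (show 0 < ((n:ℝ)+1)/u by positivity)
    rw [Real.log_div (by positivity) (by positivity)] at b1
    have b2 := Real.log_le_sub_one_of_pos (show 0 < u/(n:ℝ) by positivity)
    rw [Real.log_div (by positivity) (by positivity)] at b2
    have c1 : ((n:ℝ)+1)/u - 1 ≤ 2/u := by
      rw [div_sub_one (by positivity)]; gcongr; linarith
    have c2 : u/(n:ℝ) - 1 ≤ 2/u := by
      rw [div_sub_one (by positivity), div_le_div_iff₀ (by positivity) (by positivity)]
      nlinarith
    rw [abs_le]; constructor <;> linarith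

lemma moebius_abs_le (k : ℕ) : |(μ k : ℝ)| ≤ 1 := by
  have := abs_moebius_le_one (n := k)
  exact_mod_cast this

/-- coprime moebius coefficient -/
noncomputable def cm (e k : ℕ) : ℝ := if Nat.Coprime k e then (μ k : ℝ) else 0

lemma cm_abs_le (e k : ℕ) : |cm e k| ≤ 1 := by
  unfold cm; split_ifs
  · exact moebius_abs_le k
  · simp

lemma sum_cm (e n : ℕ) (he : e ≠ 0) (hn : n ≠ 0) :
    ∑ k ∈ n.divisors, cm e k = if n.primeFactors ⊆ e.primeFactors then 1 else 0 := by
  have h1 : ∑ k ∈ n.divisors, cm e k = ∑ k ∈ n.divisors, (μ k:ℝ) * (if Nat.Coprime k e then 1 else 0) :=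
    sum_congr rfl fun k _ => by simp [cm]
  rw [h1, sum_moebius_powerset n hn]
  have h2 : ∀ I ∈ n.primeFactors.powerset, (-1:ℝ)^(#I) * (if Nat.Coprime (∏ p ∈ I, p) e then 1 else 0)
      = if I ⊆ n.primeFactors \ e.primeFactors then (-1:ℝ)^(#I) else 0 := by
    intro I hI
    rw [mem_powerset] at hI
    have : Nat.Coprime (∏ p ∈ I, p) e ↔ I ⊆ n.primeFactors \ e.primeFactors := by
      rw [Nat.coprime_prod_left_iff]
      constructor
      · intro h p hp
        rw [mem_sdiff]
        refine ⟨hI hp, fun h' => ?_⟩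
        have hpp := Nat.prime_of_mem_primeFactors h'
        exact (hpp.coprime_iff_not_dvd.1 (h p hp)) (Nat.dvd_of_mem_primeFactors h')
      · intro h p hp
        have h3 := mem_sdiff.1 (h hp)
        have hpp := Nat.prime_of_mem_primeFactors h3.1
        refine hpp.coprime_iff_not_dvd.2 fun hd => h3.2 (Nat.mem_primeFactors.2 ⟨hpp, hd, he⟩)
    simp [this]
  rw [sum_congr rfl h2, ← sum_filter]
  have h3 : (n.primeFactors.powerset.filter fun I => I ⊆ n.primeFactors \ e.primeFactors)
      = (n.primeFactors \ e.primeFactors).powerset := by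
    ext I; simp only [mem_filter, mem_powerset]
    exact ⟨fun h => h.2, fun h => ⟨h.trans sdiff_subset, h⟩⟩
  rw [h3]
  have h4 := sum_powerset_neg_one_pow_card (x := n.primeFactors \ e.primeFactors)
  have h5 : (∑ I ∈ (n.primeFactors \ e.primeFactors).powerset, (-1:ℝ)^(#I))
      = ((∑ I ∈ (n.primeFactors \ e.primeFactors).powerset, (-1:ℤ)^(#I) : ℤ) : ℝ) := by push_cast; rfl
  rw [h5, h4]
  simp only [sdiff_eq_empty_iff_subset]
  split_ifs <;> simp

/-- e / φ(e) -/
noncomputable def ww (e : ℕ) : ℝ := ∏ p ∈ e.primeFactors, (1 - (1:ℝ)/p)⁻¹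

lemma one_le_ww (e : ℕ) : 1 ≤ ww e := by
  unfold ww
  refine Finset.one_le_prod fun p hp => ?_
  have h2 : (2:ℝ) ≤ p := by exact_mod_cast (Nat.prime_of_mem_primeFactors hp).two_le
  have h3 : (1:ℝ)/p ≤ 1/2 := by gcongr
  have h4 : (0:ℝ) < 1/p := by positivity
  exact (one_le_inv₀ (by linarith)).2 (by linarith)

lemma totient_ww (e : ℕ) : (e.totient : ℝ) * ww e = e := by
  have h := Nat.totient_eq_mul_prod_factors e
  have h' : (e.totient : ℝ) = e * ∏ p ∈ e.primeFactors, (1 - (p:ℝ)⁻¹) := by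
    have h2 := congrArg (fun q : ℚ => (q:ℝ)) h
    push_cast at h2; exact h2
  rw [h', ww, mul_assoc, ← prod_mul_distrib, prod_eq_one, mul_one]
  intro p hp
  have h2 : (2:ℝ) ≤ p := by exact_mod_cast (Nat.prime_of_mem_primeFactors hp).two_le
  have h3 : (1:ℝ)/p ≤ 1/2 := by gcongr
  rw [one_div] at *
  exact mul_inv_cancel₀ (by linarith)

lemma sum_factored_le (e N : ℕ) :
    ∑ n ∈ Ioc 0 N, (if n.primeFactors ⊆ e.primeFactors then (1:ℝ)/n else 0) ≤ ww e := by
  let f : ℕ →* ℝ := ⟨⟨fun n => (1:ℝ)/n, by simp⟩, fun a b => by simp [mul_comm]⟩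
  have hf : ∀ n : ℕ, f n = 1 / (n:ℝ) := fun n => rfl
  obtain ⟨h1, h2⟩ := EulerProduct.summable_and_hasSum_factoredNumbers_prod_filter_prime_geometric (f := f)
    (by
      intro p hp
      rw [hf, Real.norm_of_nonneg (by positivity), div_lt_one (by exact_mod_cast hp.pos)]
      exact_mod_cast hp.one_lt) e.primeFactors
  have h3 : ∏ p ∈ e.primeFactors with p.Prime, (1 - f p)⁻¹ = ww e := by
    rw [filter_true_of_mem fun p hp => Nat.prime_of_mem_primeFactors hp]; rfl
  rw [h3] at h2
  rw [← sum_filter]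
  set s := (Ioc 0 N).filter fun n => n.primeFactors ⊆ e.primeFactors
  have h4 : ∀ n ∈ s, n ∈ Nat.factoredNumbers e.primeFactors := by
    intro n hn
    have hn' := mem_filter.1 hn
    rw [Nat.mem_factoredNumbers_iff_primeFactors_subset]
    exact ⟨(mem_Ioc.1 hn'.1).1.ne', hn'.2⟩
  have h5 := sum_le_hasSum (s.subtype (· ∈ Nat.factoredNumbers e.primeFactors)) (fun n _ => by rw [hf]; positivity) h2
  refine le_trans (le_of_eq ?_) h5
  rw [Finset.sum_subtype_of_mem (f := fun n => f n) h4]; rfl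

lemma sum_cm_div_le (e N : ℕ) (he : e ≠ 0) (hN : 0 < N) : |∑ k ∈ Ioc 0 N, cm e k / k| ≤ 2 := by
  have h1 : ∑ k ∈ Ioc 0 N, ∑ j ∈ Ioc 0 (N/k), cm e k = ∑ n ∈ Ioc 0 N, ∑ k ∈ n.divisors, cm e k := by
    rw [sum_hyper (fun k _ => cm e k)]
    exact sum_congr rfl fun n _ => Nat.sum_divisorsAntidiagonal (fun k _ => cm e k)
  have h2 : |∑ n ∈ Ioc 0 N, ∑ k ∈ n.divisors, cm e k| ≤ N := by
    refine (abs_sum_le_sum_abs _ _).trans ?_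
    calc _ ≤ ∑ n ∈ Ioc 0 N, (1:ℝ) := sum_le_sum fun n hn => by
          rw [sum_cm e n he (mem_Ioc.1 hn).1.ne']; split_ifs <;> simp
      _ = N := by simp
  rw [← h1] at h2
  have h3 : |(N:ℝ) * (∑ k ∈ Ioc 0 N, cm e k / k) - ∑ k ∈ Ioc 0 N, ∑ j ∈ Ioc 0 (N/k), cm e k| ≤ N := by
    rw [mul_sum, ← sum_sub_distrib]
    refine (abs_sum_le_sum_abs _ _).trans ?_
    calc _ ≤ ∑ n ∈ Ioc 0 N, (1:ℝ) := sum_le_sum fun k hk => by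
          have hk0 : 0 < k := (mem_Ioc.1 hk).1
          have hk0' : (0:ℝ) < k := by exact_mod_cast hk0
          rw [sum_const, Nat.card_Ioc, nsmul_eq_mul, Nat.sub_zero]
          have e1 : (N:ℝ) * (cm e k / k) - (N/k : ℕ) * cm e k = cm e k * ((N:ℝ)/k - (N/k:ℕ)) := by ring
          rw [e1, abs_mul]
          have a1 : ((N/k:ℕ):ℝ) ≤ (N:ℝ)/k := Nat.cast_div_le
          have a2 : (N:ℝ)/k < (N/k:ℕ) + 1 := by
            rw [div_lt_iff₀ hk0']
            exact_mod_cast Nat.lt_mul_of_div_lt (Nat.lt_succ_self _) hk0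
          have a3 : |(N:ℝ)/k - (N/k:ℕ)| ≤ 1 := by rw [abs_le]; constructor <;> linarith
          calc _ ≤ (1:ℝ) * 1 := mul_le_mul (cm_abs_le e k) a3 (abs_nonneg _) (by norm_num)
            _ = 1 := by norm_num
      _ = N := by simp
  have hN' : (0:ℝ) < N := by exact_mod_cast hN
  have h4 : |(N:ℝ) * (∑ k ∈ Ioc 0 N, cm e k / k)| ≤ N * 2 := by
    rw [abs_le] at *; constructor <;> linarith
  rw [abs_mul, abs_of_pos hN'] at h4
  exact le_of_mul_le_mul_left h4 hN'

lemma lemmaG (e : ℕ) (he : e ≠ 0) (z : ℝ) (hz : 0 < z) :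
    |∑ k ∈ Ioc 0 ⌊z⌋₊, cm e k / k * Real.log (z / k)| ≤ 6 * ww e := by
  have hw := one_le_ww e
  rcases Nat.eq_zero_or_pos ⌊z⌋₊ with h0 | h0
  · rw [h0]; simp; linarith
  set N := ⌊z⌋₊ with hN
  have hNz : (N:ℝ) ≤ z := Nat.floor_le hz.le
  set γ := Real.eulerMascheroniConstant with hγ
  have g1 := Real.one_half_lt_eulerMascheroniConstant
  have g2 := Real.eulerMascheroniConstant_lt_two_thirds
  have h1 : ∑ k ∈ Ioc 0 N, cm e k / k * ∑ j ∈ Ioc 0 (N/k), (1:ℝ)/j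
      = ∑ n ∈ Ioc 0 N, (if n.primeFactors ⊆ e.primeFactors then (1:ℝ)/n else 0) := by
    simp_rw [mul_sum]
    rw [sum_hyper (fun k j => cm e k / k * (1 / (j:ℝ)))]
    refine sum_congr rfl fun n hn => ?_
    have hn0 := (mem_Ioc.1 hn).1.ne'
    calc _ = ∑ p ∈ n.divisorsAntidiagonal, cm e p.1 / n := by
          refine sum_congr rfl fun p hp => ?_
          have := (Nat.mem_divisorsAntidiagonal.1 hp).1
          rw [← this]; push_cast
          rw [div_mul_div_comm, mul_one]
      _ = ∑ k ∈ n.divisors, cm e k / n := Nat.sum_divisorsAntidiagonal (fun k _ => cm e k / (n:ℝ))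
      _ = _ := by rw [← sum_div, sum_cm e n he hn0]; split_ifs <;> simp
  have h2 := sum_factored_le e N
  have h2' : 0 ≤ ∑ n ∈ Ioc 0 N, (if n.primeFactors ⊆ e.primeFactors then (1:ℝ)/n else 0) :=
    sum_nonneg fun n _ => by split_ifs <;> positivity
  rw [← h1] at h2 h2'
  have h3 := sum_cm_div_le e N he h0
  have h4 : |∑ k ∈ Ioc 0 N, cm e k / k * ((∑ j ∈ Ioc 0 (N/k), (1:ℝ)/j) - Real.log (z/k) - γ)| ≤ 2 := by
    refine (abs_sum_le_sum_abs _ _).trans ?_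
    calc _ ≤ ∑ k ∈ Ioc 0 N, 2 / z := sum_le_sum fun k hk => by
          have hk0 : (0:ℝ) < k := by exact_mod_cast (mem_Ioc.1 hk).1
          have a := harmonic_est (z/k) (by positivity)
          rw [Nat.floor_div_natCast] at a
          rw [abs_mul, abs_div, abs_of_pos hk0]
          calc _ ≤ 1 / k * (2 / (z/k)) := by
                gcongr
                exact cm_abs_le e k
            _ = 2 / z := by field_simp
      _ = N * (2/z) := by simp
      _ ≤ z * (2/z) := by gcongr
      _ = 2 := by field_simp
  have h5 : ∑ k ∈ Ioc 0 N, cm e k / k * ((∑ j ∈ Ioc 0 (N/k), (1:ℝ)/j) - Real.log (z/k) - γ)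
      = ∑ k ∈ Ioc 0 N, cm e k / k * (∑ j ∈ Ioc 0 (N/k), (1:ℝ)/j)
        - ∑ k ∈ Ioc 0 N, cm e k / k * Real.log (z / k) - γ * ∑ k ∈ Ioc 0 N, cm e k / k := by
    rw [mul_sum, ← sum_sub_distrib, ← sum_sub_distrib]
    exact sum_congr rfl fun k _ => by ring
  rw [h5] at h4
  have h6 : |γ * ∑ k ∈ Ioc 0 N, cm e k / k| ≤ 2 := by
    rw [abs_mul, abs_of_pos (by linarith)]; nlinarith [abs_nonneg (∑ k ∈ Ioc 0 N, cm e k / (k:ℝ))]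
  rw [abs_le] at *
  constructor <;> linarith
end HH

namespace HH
open Finset ArithmeticFunction
open scoped ArithmeticFunction.Moebius ArithmeticFunction.vonMangoldt

/-- sieve weights -/
def Sv (s : Finset ℕ) (ν : ℕ → ℝ) (Y R : ℝ) : Prop :=
  (∀ n ∈ s, 0 < n) ∧ (∀ n ∈ s, 0 ≤ ν n) ∧
    ∀ d : ℕ, 0 < d → |(∑ n ∈ s, if d ∣ n then ν n else 0) - Y / d| ≤ R

/-- truncated divisor sum -/
noncomputable def dv (a : ℕ → ℝ) (K n : ℕ) : ℝ := ∑ m ∈ Ioc 0 K, if m ∣ n then a m else 0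

lemma quad {s : Finset ℕ} {ν : ℕ → ℝ} {Y R : ℝ} (hS : Sv s ν Y R) (a b : ℕ → ℝ) (K K' : ℕ) :
    |∑ n ∈ s, ν n * (dv a K n * dv b K' n)
      - Y * ∑ m ∈ Ioc 0 K, ∑ k ∈ Ioc 0 K', a m * b k / (Nat.lcm m k : ℕ)|
      ≤ R * ((∑ m ∈ Ioc 0 K, |a m|) * ∑ k ∈ Ioc 0 K', |b k|) := by
  have e1 : ∑ n ∈ s, ν n * (dv a K n * dv b K' n)
      = ∑ m ∈ Ioc 0 K, ∑ k ∈ Ioc 0 K', a m * b k * ∑ n ∈ s, (if Nat.lcm m k ∣ n then ν n else 0) := by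
    simp_rw [dv, sum_mul_sum, mul_sum]
    rw [sum_comm]
    refine sum_congr rfl fun m _ => ?_
    rw [sum_comm]
    refine sum_congr rfl fun k _ => sum_congr rfl fun n _ => ?_
    by_cases h1 : m ∣ n <;> by_cases h2 : k ∣ n <;> simp [h1, h2, Nat.lcm_dvd_iff]; ring
  have e2 : ∑ n ∈ s, ν n * (dv a K n * dv b K' n)
      - Y * ∑ m ∈ Ioc 0 K, ∑ k ∈ Ioc 0 K', a m * b k / (Nat.lcm m k : ℕ)
      = ∑ m ∈ Ioc 0 K, ∑ k ∈ Ioc 0 K', a m * b k *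
        ((∑ n ∈ s, (if Nat.lcm m k ∣ n then ν n else 0)) - Y / (Nat.lcm m k : ℕ)) := by
    rw [e1, mul_sum, ← sum_sub_distrib]
    refine sum_congr rfl fun m _ => ?_
    rw [mul_sum, ← sum_sub_distrib]
    exact sum_congr rfl fun k _ => by ring
  rw [e2, sum_mul_sum, mul_sum]
  refine (abs_sum_le_sum_abs _ _).trans (sum_le_sum fun m hm => ?_)
  rw [mul_sum]
  refine (abs_sum_le_sum_abs _ _).trans (sum_le_sum fun k hk => ?_)
  rw [abs_mul, abs_mul, mul_comm R]
  gcongr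
  exact hS.2.2 _ (Nat.lcm_pos (mem_Ioc.1 hm).1 (mem_Ioc.1 hk).1)

lemma diag (a : ℕ → ℝ) (K : ℕ) :
    ∑ m ∈ Ioc 0 K, ∑ k ∈ Ioc 0 K, a m * a k / (Nat.lcm m k : ℕ)
      = ∑ e ∈ Ioc 0 K, (e.totient : ℝ) * (∑ m ∈ Ioc 0 K, if e ∣ m then a m / m else 0)^2 := by
  have h1 : ∀ m ∈ Ioc 0 K, ∀ k ∈ Ioc 0 K, a m * a k / (Nat.lcm m k : ℕ)
      = ∑ e ∈ Ioc 0 K, (e.totient : ℝ) * ((if e ∣ m then a m / m else 0) * (if e ∣ k then a k / k else 0)) := by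
    intro m hm k hk
    have hm0 := (mem_Ioc.1 hm).1
    have hk0 := (mem_Ioc.1 hk).1
    have hg : (Nat.gcd m k : ℝ) = ∑ e ∈ Ioc 0 K, if e ∣ m ∧ e ∣ k then (e.totient:ℝ) else 0 := by
      have : (Nat.gcd m k : ℝ) = ((∑ e ∈ (Nat.gcd m k).divisors, e.totient : ℕ) : ℝ) := by
        rw [Nat.sum_totient]
      rw [this]; push_cast
      rw [← sum_filter]
      refine sum_congr ?_ fun _ _ => rfl
      ext e
      simp only [Nat.mem_divisors, mem_filter, mem_Ioc, Nat.dvd_gcd_iff]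
      constructor
      · rintro ⟨⟨h1, h2⟩, _⟩
        exact ⟨⟨Nat.pos_of_dvd_of_pos h1 hm0, (Nat.le_of_dvd hm0 h1).trans (mem_Ioc.1 hm).2⟩, h1, h2⟩
      · rintro ⟨_, h1, h2⟩
        exact ⟨⟨h1, h2⟩, (Nat.gcd_pos_of_pos_left _ hm0).ne'⟩
    have hl : (Nat.gcd m k : ℝ) * (Nat.lcm m k : ℕ) = m * k := by exact_mod_cast Nat.gcd_mul_lcm m k
    have hl0 : (0:ℝ) < (Nat.lcm m k : ℕ) := by exact_mod_cast Nat.lcm_pos hm0 hk0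
    have hm0' : (0:ℝ) < m := by exact_mod_cast hm0
    have hk0' : (0:ℝ) < k := by exact_mod_cast hk0
    have : a m * a k / (Nat.lcm m k : ℕ) = (a m / m) * (a k / k) * (Nat.gcd m k : ℝ) := by
      rw [div_mul_div_comm, div_mul_eq_mul_div, div_eq_div_iff hl0.ne' (by positivity), ← hl]; ring
    rw [this, hg, mul_sum]
    refine sum_congr rfl fun e _ => ?_
    by_cases h1 : e ∣ m <;> by_cases h2 : e ∣ k <;> simp [h1, h2]; ring
  rw [sum_congr rfl fun m hm => sum_congr rfl fun k hk => h1 m hm k hk]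
  simp_rw [sq, sum_mul_sum, mul_sum]
  rw [sum_congr rfl fun m _ => sum_comm, sum_comm]

lemma prod_one_sub_sq (P : Finset ℕ) (hP : ∀ p ∈ P, 2 ≤ p) : 1/2 ≤ ∏ p ∈ P, (1 - 1/(p:ℝ)^2) := by
  have h1 : ∀ M : ℕ, ∏ j ∈ Ioc 1 (M+1), (1 - 1/(j:ℝ)^2) = ((M:ℝ)+2)/(2*(M+1)) := by
    intro M
    induction M with
    | zero => simp
    | succ M ih =>
      rw [← Finset.insert_Ioc_right_eq_Ioc_add_one (by omega), prod_insert (by simp), ih]; push_cast; field_simp; ring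
  set M := P.sup id
  have hsub : P ⊆ Ioc 1 (M+1) := fun p hp => by
    rw [mem_Ioc]; have := Finset.le_sup (f := id) hp; have h2 := hP p hp
    simp only [id] at this; constructor
    · omega
    · exact this.trans (by omega)
  have h2 : ∀ j ∈ Ioc 1 (M+1), 0 ≤ 1 - 1/(j:ℝ)^2 ∧ 1 - 1/(j:ℝ)^2 ≤ 1 := fun j hj => by
    have : (1:ℝ) < j := by exact_mod_cast (mem_Ioc.1 hj).1
    have h3 : 1/(j:ℝ)^2 ≤ 1 := by rw [div_le_one (by positivity)]; nlinarith
    have h4 : 0 ≤ 1/(j:ℝ)^2 := by positivity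
    constructor <;> linarith
  have h3 := prod_sdiff hsub (f := fun j : ℕ => 1 - 1/(j:ℝ)^2)
  have h4 : ∏ j ∈ Ioc 1 (M+1) \ P, (1 - 1/(j:ℝ)^2) ≤ 1 :=
    prod_le_one (fun j hj => (h2 j (mem_sdiff.1 hj).1).1) (fun j hj => (h2 j (mem_sdiff.1 hj).1).2)
  have h5 : 0 ≤ ∏ p ∈ P, (1 - 1/(p:ℝ)^2) := prod_nonneg fun p hp => (h2 p (hsub hp)).1
  have h6 : 1/2 ≤ ((M:ℝ)+2)/(2*(M+1)) := by
    rw [div_le_div_iff₀ (by norm_num) (by positivity)]; linarith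
  rw [h1] at h3
  calc (1:ℝ)/2 ≤ _ := h6
    _ = _ := h3.symm
    _ ≤ 1 * ∏ p ∈ P, (1 - 1/(p:ℝ)^2) := by gcongr
    _ = _ := one_mul _

lemma ww_le (e : ℕ) (he : e ≠ 0) : ww e ≤ 2 * ∑ d ∈ e.divisors, (1:ℝ)/d := by
  have hp2 : ∀ p ∈ e.primeFactors, 2 ≤ p := fun p hp => (Nat.prime_of_mem_primeFactors hp).two_le
  have h1 : ww e * ∏ p ∈ e.primeFactors, (1 - 1/(p:ℝ)^2) = ∏ p ∈ e.primeFactors, (1 + 1/(p:ℝ)) := by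
    rw [ww, ← prod_mul_distrib]
    refine prod_congr rfl fun p hp => ?_
    have h2 : (2:ℝ) ≤ p := by exact_mod_cast hp2 p hp
    have h3 : (1:ℝ)/p ≤ 1/2 := by gcongr
    have e1 : 1 - 1/(p:ℝ)^2 = (1 - 1/(p:ℝ)) * (1 + 1/(p:ℝ)) := by
      have : 1/(p:ℝ)^2 = (1/p)^2 := by rw [div_pow, one_pow]
      rw [this]; ring
    rw [e1, inv_mul_cancel_left₀ (by linarith)]
  have h2 : ∏ p ∈ e.primeFactors, (1 + 1/(p:ℝ)) ≤ ∑ d ∈ e.divisors, (1:ℝ)/d := by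
    rw [prod_one_add]
    have hinj : Set.InjOn (fun I : Finset ℕ => ∏ p ∈ I, p) (e.primeFactors.powerset : Set (Finset ℕ)) := by
      intro I hI J hJ h
      have hI' : ∀ p ∈ I, p.Prime := fun p hp => Nat.prime_of_mem_primeFactors (mem_powerset.1 hI hp)
      have hJ' : ∀ p ∈ J, p.Prime := fun p hp => Nat.prime_of_mem_primeFactors (mem_powerset.1 hJ hp)
      rw [← Nat.primeFactors_prod hI', ← Nat.primeFactors_prod hJ']
      exact congrArg _ h
    calc ∑ I ∈ e.primeFactors.powerset, ∏ p ∈ I, (1/(p:ℝ))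
        = ∑ I ∈ e.primeFactors.powerset, 1/((∏ p ∈ I, p : ℕ) : ℝ) := by
          refine sum_congr rfl fun I _ => ?_
          push_cast; simp
      _ = ∑ d ∈ e.primeFactors.powerset.image (fun I => ∏ p ∈ I, p), 1/(d:ℝ) := by
          rw [sum_image hinj]
      _ ≤ _ := by
          refine sum_le_sum_of_subset_of_nonneg ?_ fun _ _ _ => by positivity
          intro d hd
          obtain ⟨I, hI, rfl⟩ := mem_image.1 hd
          rw [Nat.mem_divisors]
          exact ⟨(prod_dvd_prod_of_subset _ _ _ (mem_powerset.1 hI)).trans (Nat.prod_primeFactors_dvd e), he⟩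
  have h3 := prod_one_sub_sq _ hp2
  have h4 := one_le_ww e
  nlinarith

lemma sum_inv_sq (K : ℕ) : ∑ d ∈ Ioc 0 K, 1/(d:ℝ)^2 ≤ 2 := by
  have h : ∀ K : ℕ, ∑ d ∈ Ioc 0 (K+1), 1/(d:ℝ)^2 ≤ 2 - 1/((K:ℝ)+1) := by
    intro K
    induction K with
    | zero => norm_num
    | succ K ih =>
      rw [← Finset.insert_Ioc_right_eq_Ioc_add_one (by omega), sum_insert (by simp)]
      have : 1/(((K+1+1 : ℕ):ℝ))^2 ≤ 1/((K:ℝ)+1) - 1/(((K+1:ℕ):ℝ)+1) := by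
        push_cast
        rw [div_sub_div _ _ (by positivity) (by positivity), div_le_div_iff₀ (by positivity) (by positivity)]
        ring_nf; nlinarith [(Nat.cast_nonneg K : (0:ℝ) ≤ K)]
      linarith
  rcases K with _ | K
  · simp
  · have := h K
    have h2 : (0:ℝ) ≤ 1/((K:ℝ)+1) := by positivity
    linarith

lemma harmonic_le (n : ℕ) (t : ℝ) (ht : 0 ≤ t) (hn : (n:ℝ) ≤ Real.exp t) : ∑ j ∈ Ioc 0 n, (1:ℝ)/j ≤ 1 + t := by
  rcases Nat.eq_zero_or_pos n with h | h
  · subst h; simp; linarith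
  have hh : (∑ j ∈ Ioc 0 n, (1:ℝ)/j) = (harmonic n : ℝ) := by
    rw [harmonic_eq_sum_Icc]; push_cast
    simp [← Finset.Icc_add_one_left_eq_Ioc]
  rw [hh]
  refine (harmonic_le_one_add_log n).trans ?_
  have := (Real.log_le_iff_le_exp (by exact_mod_cast h)).2 hn
  linarith

lemma sum_ww (K : ℕ) (t : ℝ) (ht : 0 ≤ t) (hK : (K:ℝ) ≤ Real.exp t) :
    ∑ e ∈ Ioc 0 K, ww e / e ≤ 4 * (1 + t) := by
  calc ∑ e ∈ Ioc 0 K, ww e / e ≤ ∑ e ∈ Ioc 0 K, 2 * ∑ p ∈ e.divisorsAntidiagonal, (1/(p.1:ℝ)^2 * (1/(p.2:ℝ))) := by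
        refine sum_le_sum fun e he => ?_
        have he0 : 0 < e := (mem_Ioc.1 he).1
        have he0' : (0:ℝ) < e := by exact_mod_cast he0
        have h1 := ww_le e he0.ne'
        have h2 : ∑ p ∈ e.divisorsAntidiagonal, (1/(p.1:ℝ)^2 * (1/(p.2:ℝ))) = (∑ d ∈ e.divisors, (1:ℝ)/d) / e := by
          rw [sum_div, ← Nat.sum_divisorsAntidiagonal (fun d _ => (1:ℝ)/d/e)]
          refine sum_congr rfl fun p hp => ?_
          have h3 := (Nat.mem_divisorsAntidiagonal.1 hp).1
          rw [← h3]; push_cast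
          rw [div_div, div_mul_div_comm]; ring
        rw [h2, div_le_iff₀ he0', mul_assoc, div_mul_cancel₀ _ he0'.ne']; exact h1
    _ = 2 * ∑ d ∈ Ioc 0 K, ∑ j ∈ Ioc 0 (K/d), (1/(d:ℝ)^2 * (1/(j:ℝ))) := by
        rw [← mul_sum, sum_hyper (fun d j => 1/(d:ℝ)^2 * (1/(j:ℝ)))]
    _ = 2 * ∑ d ∈ Ioc 0 K, 1/(d:ℝ)^2 * ∑ j ∈ Ioc 0 (K/d), (1/(j:ℝ)) := by simp_rw [mul_sum]
    _ ≤ 2 * ∑ d ∈ Ioc 0 K, 1/(d:ℝ)^2 * (1+t) := by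
        gcongr with d hd
        refine harmonic_le _ t ht (le_trans ?_ hK)
        exact_mod_cast Nat.div_le_self _ _
    _ = 2 * ((∑ d ∈ Ioc 0 K, 1/(d:ℝ)^2) * (1+t)) := by rw [sum_mul]
    _ ≤ 2 * (2 * (1+t)) := by gcongr; exact sum_inv_sq K
    _ = _ := by ring

/-- `T t n` -/
noncomputable def TT (t : ℝ) (n : ℕ) : ℝ := ∑ m ∈ n.divisors, (μ m : ℝ) * max (t - Real.log m) 0
/-- `Q v n` -/
noncomputable def QQ (v : ℝ) (n : ℕ) : ℝ := ∑ m ∈ n.divisors, (μ m : ℝ) * (max (v - Real.log m) 0)^2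

lemma dv_eq (f : ℝ → ℝ) (t : ℝ) (hf : ∀ u, t < u → f u = 0) (n : ℕ) (hn : 0 < n) :
    ∑ m ∈ n.divisors, (μ m : ℝ) * f (Real.log m) = dv (fun m => (μ m : ℝ) * f (Real.log m)) ⌊Real.exp t⌋₊ n := by
  rw [dv, ← sum_filter]
  symm
  refine sum_subset ?_ ?_
  · intro m hm
    rw [mem_filter] at hm
    exact Nat.mem_divisors.2 ⟨hm.2, hn.ne'⟩
  · intro m hm hm'
    have hmd := (Nat.mem_divisors.1 hm).1
    have hm0 : 0 < m := Nat.pos_of_dvd_of_pos hmd hn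
    rw [hf, mul_zero]
    by_contra hc
    push Not at hc
    apply hm'
    rw [mem_filter, mem_Ioc]
    refine ⟨⟨hm0, Nat.le_floor ?_⟩, hmd⟩
    exact (Real.log_le_iff_le_exp (by exact_mod_cast hm0)).1 hc

lemma TT_eq_dv (t : ℝ) (n : ℕ) (hn : 0 < n) :
    TT t n = dv (fun m => (μ m : ℝ) * max (t - Real.log m) 0) ⌊Real.exp t⌋₊ n :=
  dv_eq (fun u => max (t - u) 0) t (fun u hu => max_eq_right (by linarith)) n hn

lemma QQ_eq_dv (t : ℝ) (n : ℕ) (hn : 0 < n) :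
    QQ t n = dv (fun m => (μ m : ℝ) * (max (t - Real.log m) 0)^2) ⌊Real.exp t⌋₊ n :=
  dv_eq (fun u => (max (t - u) 0)^2) t (fun u hu => by rw [max_eq_right (by linarith)]; simp) n hn

lemma moebius_mul_cm (e k : ℕ) : (μ (e*k) : ℝ) = μ e * cm e k := by
  unfold cm
  split_ifs with h
  · have := isMultiplicative_moebius.map_mul_of_coprime h.symm
    exact_mod_cast this
  · rw [moebius_eq_zero_of_not_squarefree]
    · simp
    · intro hs; exact h ((Nat.squarefree_mul_iff.1 hs).1.symm)

lemma inner_le (t : ℝ) (e : ℕ) (he : 0 < e) :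
    |∑ m ∈ Ioc 0 ⌊Real.exp t⌋₊, if e ∣ m then (μ m : ℝ) * max (t - Real.log m) 0 / m else 0| ≤ 6 * ww e / e := by
  set K := ⌊Real.exp t⌋₊ with hK
  have he' : (0:ℝ) < e := by exact_mod_cast he
  have h1 : (∑ m ∈ Ioc 0 K, if e ∣ m then (μ m : ℝ) * max (t - Real.log m) 0 / m else 0)
      = ∑ k ∈ Ioc 0 (K/e), (μ (e*k) : ℝ) * max (t - Real.log ((e*k : ℕ):ℝ)) 0 / ((e*k : ℕ):ℝ) := by
    rw [← sum_filter]
    symm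
    refine sum_bij (fun k _ => e*k) ?_ ?_ ?_ ?_
    · intro k hk
      rw [mem_Ioc] at hk
      rw [mem_filter, mem_Ioc]
      have := (Nat.le_div_iff_mul_le he).1 hk.2
      exact ⟨⟨Nat.mul_pos he hk.1, by linarith [Nat.mul_comm e k]⟩, Dvd.intro _ rfl⟩
    · intro k _ k' _ h; exact Nat.eq_of_mul_eq_mul_left he h
    · intro m hm
      rw [mem_filter, mem_Ioc] at hm
      obtain ⟨⟨h0, h1⟩, k, rfl⟩ := hm
      refine ⟨k, ?_, rfl⟩
      rw [mem_Ioc, Nat.le_div_iff_mul_le he, mul_comm]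
      exact ⟨Nat.pos_of_mul_pos_left h0, h1⟩
    · intro k _; rfl
  have h2 : ∑ k ∈ Ioc 0 (K/e), (μ (e*k) : ℝ) * max (t - Real.log ((e*k : ℕ):ℝ)) 0 / ((e*k : ℕ):ℝ)
      = (μ e : ℝ) / e * ∑ k ∈ Ioc 0 (K/e), cm e k / k * Real.log ((Real.exp t / e) / k) := by
    rw [mul_sum]
    refine sum_congr rfl fun k hk => ?_
    rw [mem_Ioc] at hk
    have hk0 : (0:ℝ) < k := by exact_mod_cast hk.1
    have hle : e * k ≤ K := by
      have := (Nat.le_div_iff_mul_le he).1 hk.2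
      linarith [Nat.mul_comm e k]
    have hle' : ((e*k:ℕ):ℝ) ≤ Real.exp t := (Nat.le_floor_iff (Real.exp_pos t).le).1 hle
    have hpos : (0:ℝ) < ((e*k:ℕ):ℝ) := by push_cast; positivity
    have hlog := (Real.log_le_iff_le_exp hpos).2 hle'
    rw [max_eq_left (by linarith), moebius_mul_cm]
    have e1 : Real.log ((Real.exp t / e) / k) = t - Real.log ((e*k:ℕ):ℝ) := by
      rw [div_div, Real.log_div (Real.exp_pos t).ne' (by positivity), Real.log_exp]; push_cast; rfl
    rw [e1]; push_cast; field_simp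
  rw [h1, h2, abs_mul, abs_div, abs_of_pos he']
  have h3 := lemmaG e he.ne' (Real.exp t / e) (by positivity)
  rw [Nat.floor_div_natCast] at h3
  calc _ ≤ 1 / e * (6 * ww e) := by
        gcongr
        exact moebius_abs_le e
    _ = _ := by ring

lemma lemmaA {s : Finset ℕ} {ν : ℕ → ℝ} {Y R : ℝ} (hS : Sv s ν Y R) (hY : 0 ≤ Y) (hR : 0 ≤ R) (t : ℝ) (ht : 0 ≤ t) :
    ∑ n ∈ s, ν n * (TT t n)^2 ≤ 144 * (1 + t) * Y + R * (Real.exp t * t)^2 := by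
  set K := ⌊Real.exp t⌋₊ with hK
  have hKe : (K:ℝ) ≤ Real.exp t := Nat.floor_le (Real.exp_pos t).le
  set a : ℕ → ℝ := fun m => (μ m : ℝ) * max (t - Real.log m) 0 with ha
  have h1 := quad hS a a K K
  rw [diag] at h1
  have h2 : ∑ n ∈ s, ν n * (TT t n)^2 = ∑ n ∈ s, ν n * (dv a K n * dv a K n) :=
    sum_congr rfl fun n hn => by rw [TT_eq_dv t n (hS.1 n hn), sq]
  have h3 : ∑ e ∈ Ioc 0 K, (e.totient : ℝ) * (∑ m ∈ Ioc 0 K, if e ∣ m then a m / m else 0)^2 ≤ 144 * (1+t) := by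
    calc _ ≤ ∑ e ∈ Ioc 0 K, 36 * (ww e / e) := by
          refine sum_le_sum fun e he => ?_
          have he0 : 0 < e := (mem_Ioc.1 he).1
          have he0' : (0:ℝ) < e := by exact_mod_cast he0
          have a1 := inner_le t e he0
          have a2 := totient_ww e
          have hw := one_le_ww e
          calc (e.totient : ℝ) * (∑ m ∈ Ioc 0 K, if e ∣ m then a m / m else 0)^2
              ≤ (e.totient : ℝ) * (6 * ww e / e)^2 := by
                gcongr 1
                exact sq_le_sq' (abs_le.1 a1).1 (abs_le.1 a1).2
            _ = 36 * (e.totient * ww e) * ww e / e^2 := by ring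
            _ = _ := by rw [a2]; field_simp
      _ = 36 * ∑ e ∈ Ioc 0 K, ww e / e := by rw [mul_sum]
      _ ≤ 36 * (4 * (1+t)) := by gcongr; exact sum_ww K t ht hKe
      _ = _ := by ring
  have h4 : ∑ m ∈ Ioc 0 K, |a m| ≤ Real.exp t * t := by
    calc _ ≤ ∑ m ∈ Ioc 0 K, t := sum_le_sum fun m hm => by
          have hm1 : (1:ℝ) ≤ m := by exact_mod_cast (mem_Ioc.1 hm).1
          have := Real.log_nonneg hm1
          simp only [ha]
          rw [abs_mul, abs_of_nonneg (le_max_right (t - Real.log m) 0)]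
          calc _ ≤ 1 * max (t - Real.log m) 0 := by gcongr; exact moebius_abs_le m
            _ ≤ t := by rw [one_mul]; exact max_le (by linarith) ht
      _ = K * t := by simp
      _ ≤ _ := by gcongr
  have h5 : (∑ m ∈ Ioc 0 K, |a m|) * ∑ m ∈ Ioc 0 K, |a m| ≤ (Real.exp t * t)^2 := by
    rw [sq]; gcongr
  rw [h2]
  have h6 := (abs_le.1 h1).2
  have h7 := mul_le_mul_of_nonneg_left h3 hY
  have h8 := mul_le_mul_of_nonneg_left h5 hR
  linarith
end HH

namespace HH
open Finset ArithmeticFunction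
open scoped ArithmeticFunction.Moebius ArithmeticFunction.zeta

/-- `F v n` -/
noncomputable def FF (v : ℝ) (n : ℕ) : ℝ := ∑ m ∈ n.divisors, (μ m : ℝ) * (v - Real.log m)^2

/-- log radical -/
noncomputable def lr (n : ℕ) : ℝ := ∑ p ∈ n.primeFactors, Real.log p

lemma sum_moebius_log (n : ℕ) (hn : n ≠ 0) (f : ℝ → ℝ) :
    ∑ m ∈ n.divisors, (μ m : ℝ) * f (Real.log m) =
      ∑ I ∈ n.primeFactors.powerset, (-1:ℝ)^(#I) * f (∑ p ∈ I, Real.log p) := by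
  rw [sum_moebius_powerset n hn (fun m => f (Real.log m))]
  refine sum_congr rfl fun I hI => ?_
  congr 2
  push_cast
  rw [Real.log_prod]
  intro p hp
  have := (Nat.prime_of_mem_primeFactors (mem_powerset.1 hI hp)).pos
  positivity

lemma reflection (v : ℝ) (n : ℕ) (hn : n ≠ 0) :
    FF v n = QQ v n + (-1:ℝ)^(#n.primeFactors) * QQ (lr n - v) n := by
  rw [FF, QQ, QQ, sum_moebius_log n hn (fun u => (v-u)^2), sum_moebius_log n hn (fun u => (max (v-u) 0)^2),
    sum_moebius_log n hn (fun u => (max (lr n - v-u) 0)^2)]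
  set P := n.primeFactors with hP
  have h1 : ∑ I ∈ P.powerset, (-1:ℝ)^(#I) * (max (lr n - v - ∑ p ∈ I, Real.log p) 0)^2
      = ∑ I ∈ P.powerset, (-1:ℝ)^(#P) * (-1:ℝ)^(#I) * (max (∑ p ∈ I, Real.log p - v) 0)^2 := by
    refine sum_bij' (fun I _ => P \ I) (fun I _ => P \ I) ?_ ?_ ?_ ?_ ?_
    · intro I _; simp
    · intro I _; simp
    · intro I hI; exact Finset.sdiff_sdiff_eq_self (mem_powerset.1 hI)
    · intro I hI; exact Finset.sdiff_sdiff_eq_self (mem_powerset.1 hI)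
    · intro I hI
      rw [mem_powerset] at hI
      have e1 : #(P \ I) + #I = #P := card_sdiff_add_card_eq_card hI
      have e2 : ∑ p ∈ P \ I, Real.log p + ∑ p ∈ I, Real.log p = ∑ p ∈ P, Real.log p := sum_sdiff hI
      have e3 : (-1:ℝ)^(#P) * (-1:ℝ)^(#(P \ I)) = (-1:ℝ)^(#I) := by
        rw [← e1, pow_add, mul_right_comm, ← pow_add, ← two_mul, pow_mul]; simp
      rw [e3]
      congr 3
      rw [lr, ← hP]; linarith
  rw [h1, mul_sum, ← sum_add_distrib]
  refine sum_congr rfl fun I _ => ?_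
  have e4 : (-1:ℝ)^(#P) * (-1:ℝ)^(#P) = 1 := by rw [← pow_add, ← two_mul, pow_mul]; simp
  rw [← mul_assoc, ← mul_assoc, e4, one_mul, ← mul_add]
  congr 1
  rcases le_total (∑ p ∈ I, Real.log p) v with h | h
  · rw [max_eq_left (by linarith), max_eq_right (by linarith)]; ring
  · rw [max_eq_right (by linarith), max_eq_left (by linarith)]; ring

lemma lr_le (n : ℕ) (hn : n ≠ 0) : lr n ≤ Real.log n := by
  have h : lr n = Real.log ((∏ p ∈ n.primeFactors, p : ℕ) : ℝ) := by
    push_cast; rw [Real.log_prod]; · rfl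
    intro p hp
    have := (Nat.prime_of_mem_primeFactors hp).pos
    positivity
  rw [h]
  have h0 : 0 < ∏ p ∈ n.primeFactors, p := Finset.prod_pos fun p hp => (Nat.prime_of_mem_primeFactors hp).pos
  refine Real.log_le_log (by exact_mod_cast h0) ?_
  exact_mod_cast Nat.le_of_dvd (Nat.pos_of_ne_zero hn) (Nat.prod_primeFactors_dvd n)

lemma QQ_refl_le (v : ℝ) (n : ℕ) (hn : n ≠ 0) : |QQ v n - FF v n| = |QQ (lr n - v) n| := by
  rw [reflection v n hn]
  have : QQ v n - (QQ v n + (-1:ℝ)^(#n.primeFactors) * QQ (lr n - v) n)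
    = - ((-1:ℝ)^(#n.primeFactors) * QQ (lr n - v) n) := by ring
  rw [this, abs_neg, abs_mul, abs_pow]; simp

lemma int_max (a w : ℝ) (ha : 0 ≤ a) (hw : 0 ≤ w) :
    ∫ t in (0:ℝ)..w, max (t - a) 0 = (max (w - a) 0)^2 / 2 := by
  have hc : Continuous fun t : ℝ => max (t - a) 0 := by fun_prop
  have hz : ∀ b, 0 ≤ b → b ≤ a → ∫ t in (0:ℝ)..b, max (t - a) 0 = 0 := by
    intro b hb hba
    rw [intervalIntegral.integral_congr (g := fun _ => (0:ℝ))]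
    · simp
    · intro t ht
      rw [Set.uIcc_of_le hb] at ht
      exact max_eq_right (by linarith [ht.2])
  rcases le_total w a with h | h
  · rw [hz w hw h, max_eq_right (by linarith)]; simp
  · rw [← intervalIntegral.integral_add_adjacent_intervals (b := a) (hc.intervalIntegrable _ _)
      (hc.intervalIntegrable _ _), hz a ha le_rfl, zero_add]
    rw [intervalIntegral.integral_congr (g := fun t => t - a)]
    · rw [max_eq_left (by linarith), intervalIntegral.integral_sub (by simp) (by simp)]
      simp; ring
    · intro t ht
      rw [Set.uIcc_of_le h] at ht
      exact max_eq_left (by linarith [ht.1])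

lemma TT_cont (n : ℕ) : Continuous fun t => TT t n := by
  unfold TT; fun_prop

lemma QQ_eq_int (w : ℝ) (hw : 0 ≤ w) (n : ℕ) (hn : 0 < n) :
    QQ w n = 2 * ∫ t in (0:ℝ)..w, TT t n := by
  have : ∫ t in (0:ℝ)..w, TT t n = ∑ m ∈ n.divisors, (μ m : ℝ) * ((max (w - Real.log m) 0)^2/2) := by
    unfold TT
    rw [intervalIntegral.integral_finsetSum]
    · refine sum_congr rfl fun m hm => ?_
      have hm1 : (1:ℝ) ≤ m := by
        exact_mod_cast Nat.pos_of_mem_divisors hm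
      rw [intervalIntegral.integral_const_mul, int_max _ _ (Real.log_nonneg hm1) hw]
    · intro m _
      apply Continuous.intervalIntegrable; fun_prop
  rw [this, QQ, mul_sum]
  exact sum_congr rfl fun m _ => by ring

lemma QQ_abs_le (w V : ℝ) (hV : 0 ≤ V) (hw : w ≤ V) (n : ℕ) (hn : 0 < n) :
    |QQ w n| ≤ 2 * ∫ t in (0:ℝ)..V, |TT t n| := by
  have hc : Continuous fun t => |TT t n| := (TT_cont n).abs
  rcases le_total w 0 with h | h
  · have : QQ w n = 0 := by
      refine sum_eq_zero fun m hm => ?_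
      have hm1 : (1:ℝ) ≤ m := by
        exact_mod_cast Nat.pos_of_mem_divisors hm
      rw [max_eq_right (by linarith [Real.log_nonneg hm1])]; simp
    rw [this, abs_zero]
    have : 0 ≤ ∫ t in (0:ℝ)..V, |TT t n| := intervalIntegral.integral_nonneg hV (fun t _ => abs_nonneg _)
    linarith
  · rw [QQ_eq_int w h n hn, abs_mul, abs_two]
    gcongr
    refine (intervalIntegral.abs_integral_le_integral_abs h).trans ?_
    refine intervalIntegral.integral_mono_interval le_rfl h hw ?_ (hc.intervalIntegrable _ _)
    exact Filter.Eventually.of_forall fun t => abs_nonneg _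

lemma tail {s : Finset ℕ} {ν : ℕ → ℝ} {Y R : ℝ} (hS : Sv s ν Y R) (hY : 0 ≤ Y) (hR : 0 ≤ R)
    (v0 V : ℝ) (hv0 : 0 ≤ v0) (hV : v0 ≤ V) (w : ℕ → ℝ) (hw : ∀ n ∈ s, w n ≤ V) :
    ∑ n ∈ s, ν n * (|QQ (w n) n| * |TT v0 n|) ≤ 2 * V * (144 * (1 + V) * Y + R * (Real.exp V * V)^2) := by
  have hV0 : 0 ≤ V := hv0.trans hV
  set B := 144 * (1 + V) * Y + R * (Real.exp V * V)^2 with hB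
  have hA : ∀ t, 0 ≤ t → t ≤ V → ∑ n ∈ s, ν n * (TT t n)^2 ≤ B := fun t h0 h1 => by
    refine (lemmaA hS hY hR t h0).trans ?_
    rw [hB]; gcongr
  calc _ ≤ ∑ n ∈ s, ν n * ((2 * ∫ t in (0:ℝ)..V, |TT t n|) * |TT v0 n|) := by
        refine sum_le_sum fun n hn => ?_
        have := hS.2.1 n hn
        gcongr
        exact QQ_abs_le _ V hV0 (hw n hn) n (hS.1 n hn)
    _ = ∫ t in (0:ℝ)..V, ∑ n ∈ s, ν n * (2 * |TT t n| * |TT v0 n|) := by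
        rw [intervalIntegral.integral_finsetSum]
        · refine sum_congr rfl fun n _ => ?_
          rw [intervalIntegral.integral_const_mul, intervalIntegral.integral_mul_const,
            intervalIntegral.integral_const_mul]
        · intro n _
          apply Continuous.intervalIntegrable
          have := TT_cont n
          fun_prop
    _ ≤ ∫ t in (0:ℝ)..V, 2 * B := by
        refine intervalIntegral.integral_mono_on hV0 ?_ (by simp) ?_
        · apply Continuous.intervalIntegrable
          have := TT_cont
          fun_prop
        · intro t ht
          calc _ ≤ ∑ n ∈ s, (ν n * (TT t n)^2 + ν n * (TT v0 n)^2) := by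
                refine sum_le_sum fun n hn => ?_
                rw [← mul_add]
                refine mul_le_mul_of_nonneg_left ?_ (hS.2.1 n hn)
                rw [← sq_abs (TT t n), ← sq_abs (TT v0 n)]
                exact two_mul_le_add_sq _ _
            _ ≤ 2 * B := by
                rw [sum_add_distrib]
                linarith [hA t ht.1 ht.2, hA v0 hv0 hV]
    _ = _ := by simp; ring

lemma log_deriv (f g : ArithmeticFunction ℝ) :
    pmul log (f * g) = pmul log f * g + f * pmul log g := by
  ext n
  simp only [pmul_apply, ArithmeticFunction.mul_apply, ArithmeticFunction.add_apply, mul_sum]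
  rw [← sum_add_distrib]
  refine sum_congr rfl fun p hp => ?_
  obtain ⟨h1, h2⟩ := Nat.mem_divisorsAntidiagonal.1 hp
  have a : p.1 ≠ 0 := by rintro h; rw [h] at h1; simp at h1; exact h2 h1.symm
  have b : p.2 ≠ 0 := by rintro h; rw [h] at h1; simp at h1; exact h2 h1.symm
  have : log n = log p.1 + log p.2 := by
    rw [log_apply, log_apply, log_apply, ← h1]; push_cast
    exact Real.log_mul (by exact_mod_cast a) (by exact_mod_cast b)
  rw [this]; ring

lemma log_sq_eq : pmul log log = (pmul log Λ + Λ * Λ) * (ζ : ArithmeticFunction ℝ) := by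
  have h1 : pmul log (ζ : ArithmeticFunction ℝ) = log := by
    ext n; simp only [pmul_apply, natCoe_apply, zeta_apply]
    split_ifs with h
    · simp [h]
    · simp
  have h2 : Λ * (ζ : ArithmeticFunction ℝ) = log := vonMangoldt_mul_zeta
  calc pmul log log = pmul log (Λ * (ζ : ArithmeticFunction ℝ)) := by rw [h2]
    _ = pmul log Λ * ζ + Λ * log := by rw [log_deriv, h1]
    _ = _ := by
      have h3 : Λ * (log : ArithmeticFunction ℝ) = Λ * Λ * ζ := by rw [← h2]; ring
      rw [h3]; ring

lemma FF_eq (v : ℝ) (n : ℕ) (hn : 2 ≤ n) : FF v n = (Λ * Λ) n + Λ n * (2 * v - Real.log n) := by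
  have m0 : ∑ m ∈ n.divisors, (μ m : ℝ) = 0 := by
    have h : ((μ * ζ : ArithmeticFunction ℝ)) n = (1 : ArithmeticFunction ℝ) n := by
      rw [coe_moebius_mul_coe_zeta]
    rw [coe_mul_zeta_apply, ArithmeticFunction.one_apply_ne (by omega)] at h
    simpa using h
  have m1 : ∑ m ∈ n.divisors, (μ m : ℝ) * Real.log m = - Λ n := by
    have := sum_moebius_mul_log_eq (n := n)
    simpa using this
  have m2 : ∑ m ∈ n.divisors, (μ m : ℝ) * (Real.log n - Real.log m)^2 = Λ n * Real.log n + (Λ * Λ) n := by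
    have h : ((μ : ArithmeticFunction ℝ) * pmul log log) n = (pmul log Λ + Λ * Λ) n := by
      rw [log_sq_eq, mul_comm, mul_assoc, coe_zeta_mul_coe_moebius, mul_one]
    rw [ArithmeticFunction.add_apply, pmul_apply, log_apply, mul_comm (Real.log n), ArithmeticFunction.mul_apply] at h
    rw [← h, ← Nat.sum_divisorsAntidiagonal (fun m _ => (μ m : ℝ) * (Real.log n - Real.log m)^2)]
    refine sum_congr rfl fun p hp => ?_
    obtain ⟨h1, h2⟩ := Nat.mem_divisorsAntidiagonal.1 hp
    have a : p.1 ≠ 0 := by rintro h; rw [h] at h1; simp at h1; exact h2 h1.symm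
    have b : p.2 ≠ 0 := by rintro h; rw [h] at h1; simp at h1; exact h2 h1.symm
    have : Real.log n = Real.log p.1 + Real.log p.2 := by
      rw [← h1]; push_cast
      exact Real.log_mul (by exact_mod_cast a) (by exact_mod_cast b)
    rw [this, intCoe_apply, pmul_apply, log_apply]; ring
  have e : FF v n = ∑ m ∈ n.divisors, (μ m : ℝ) * (Real.log n - Real.log m)^2
      + (v^2 - (Real.log n)^2) * ∑ m ∈ n.divisors, (μ m : ℝ)
      + (2 * Real.log n - 2 * v) * ∑ m ∈ n.divisors, (μ m : ℝ) * Real.log m := by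
    rw [FF, mul_sum, mul_sum, ← sum_add_distrib, ← sum_add_distrib]
    exact sum_congr rfl fun m _ => by ring
  rw [e, m0, m1, m2]; ring

lemma TT_eq_self (t : ℝ) (ht : 0 ≤ t) (n : ℕ) (hn : n ≠ 0) (h : ∀ p ∈ n.primeFactors, t ≤ Real.log p) :
    TT t n = t := by
  rw [TT, sum_moebius_log n hn (fun u => max (t-u) 0)]
  rw [sum_eq_single ∅]
  · simp [ht]
  · intro I hI hne
    obtain ⟨p, hp⟩ := nonempty_iff_ne_empty.2 hne
    have h1 : Real.log p ≤ ∑ q ∈ I, Real.log q := by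
      refine single_le_sum (f := fun q : ℕ => Real.log q) (fun q hq => ?_) hp
      exact ht.trans (h q (mem_powerset.1 hI hq))
    rw [max_eq_right (by linarith [h p (mem_powerset.1 hI hp)])]; simp
  · simp

lemma TT_bounds (t : ℝ) (ht : 0 ≤ t) (n : ℕ) (hn : 2 ≤ n) (h : #n.primeFactors ≤ 2) :
    0 ≤ TT t n ∧ TT t n ≤ t := by
  rw [TT, sum_moebius_log n (by omega) (fun u => max (t-u) 0)]
  have hne : n.primeFactors.Nonempty := Nat.nonempty_primeFactors.2 (by omega)
  have hpos : ∀ p ∈ n.primeFactors, 0 ≤ Real.log p := fun p hp =>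
    Real.log_nonneg (by exact_mod_cast (Nat.prime_of_mem_primeFactors hp).one_lt.le)
  have hc : #n.primeFactors = 1 ∨ #n.primeFactors = 2 := by
    have := hne.card_pos; omega
  rcases hc with hc | hc
  · obtain ⟨p, hp⟩ := card_eq_one.1 hc
    rw [hp] at hpos ⊢
    have h1 := hpos p (by simp)
    rw [show ({p} : Finset ℕ) = insert p ∅ from rfl, sum_powerset_insert (by simp)]
    simp only [powerset_empty, sum_singleton, card_empty, sum_empty, insert_empty_eq, card_singleton]
    rcases max_cases (t - Real.log p) 0 with ⟨h2, h3⟩ | ⟨h2, h3⟩ <;> rw [h2] <;>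
      rw [sub_zero, max_eq_left ht] <;> constructor <;> linarith
  · obtain ⟨p, q, hpq, hp⟩ := card_eq_two.1 hc
    rw [hp] at hpos ⊢
    have h1 := hpos p (by simp)
    have h2 := hpos q (by simp)
    rw [sum_powerset_insert (by simpa using hpq), show ({q} : Finset ℕ) = insert q ∅ from rfl,
      sum_powerset_insert (by simp), sum_powerset_insert (by simp)]
    simp only [powerset_empty, sum_singleton, card_empty, sum_empty, insert_empty_eq, card_singleton]
    rw [sum_pair hpq, card_pair hpq, sub_zero, max_eq_left ht]
    rcases max_cases (t - Real.log p) 0 with ⟨h3, h4⟩ | ⟨h3, h4⟩ <;>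
    rcases max_cases (t - Real.log q) 0 with ⟨h5, h6⟩ | ⟨h5, h6⟩ <;>
    rcases max_cases (t - (Real.log p + Real.log q)) 0 with ⟨h7, h8⟩ | ⟨h7, h8⟩ <;>
    rw [h3, h5, h7] <;> constructor <;> linarith

lemma card_pf_of_vm (n : ℕ) (h : Λ n ≠ 0) : #n.primeFactors ≤ 2 := by
  have h1 : IsPrimePow n := by
    by_contra hc; exact h (vonMangoldt_eq_zero_iff.2 hc)
  obtain ⟨p, k, hp, hk, rfl⟩ := h1
  rw [Nat.primeFactors_prime_pow hk.ne' hp.nat_prime]; simp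

lemma card_pf_of_vm2 (n : ℕ) (h : (Λ * Λ) n ≠ 0) : #n.primeFactors ≤ 2 := by
  rw [ArithmeticFunction.mul_apply] at h
  obtain ⟨⟨a, b⟩, hm, h1⟩ := exists_ne_zero_of_sum_ne_zero h
  obtain ⟨h2, h3⟩ := Nat.mem_divisorsAntidiagonal.1 hm
  dsimp only at h1 h2
  have ha : IsPrimePow a := by
    by_contra hc; exact h1 (by rw [vonMangoldt_eq_zero_iff.2 hc]; simp)
  have hb : IsPrimePow b := by
    by_contra hc; exact h1 (by rw [vonMangoldt_eq_zero_iff.2 hc]; simp)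
  obtain ⟨p, k, hp, hk, rfl⟩ := ha
  obtain ⟨q, l, hq, hl, rfl⟩ := hb
  rw [← h2, Nat.primeFactors_mul (pow_ne_zero _ hp.ne_zero) (pow_ne_zero _ hq.ne_zero),
    Nat.primeFactors_prime_pow hk.ne' hp.nat_prime, Nat.primeFactors_prime_pow hl.ne' hq.nat_prime]
  exact (card_union_le _ _).trans (by simp)

lemma vm2_nonneg (n : ℕ) : 0 ≤ (Λ * Λ) n := by
  rw [ArithmeticFunction.mul_apply]; exact sum_nonneg fun p _ => mul_nonneg vonMangoldt_nonneg vonMangoldt_nonneg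

lemma FF_nonneg (v : ℝ) (n : ℕ) (hn : 2 ≤ n) (h : Real.log n ≤ 2 * v) : 0 ≤ FF v n := by
  rw [FF_eq v n hn]
  exact add_nonneg (vm2_nonneg n) (mul_nonneg vonMangoldt_nonneg (by linarith))

lemma FFTT_bounds (v t : ℝ) (ht : 0 ≤ t) (n : ℕ) (hn : 2 ≤ n) (h : Real.log n ≤ 2 * v) :
    0 ≤ FF v n * TT t n ∧ FF v n * TT t n ≤ FF v n * t := by
  have h0 := FF_nonneg v n hn h
  by_cases hF : FF v n = 0
  · simp [hF]
  · have : #n.primeFactors ≤ 2 := by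
      by_contra hc
      apply hF
      rw [FF_eq v n hn]
      have h1 : Λ n = 0 := by by_contra h1; exact hc (card_pf_of_vm n h1)
      have h2 : (Λ * Λ) n = 0 := by by_contra h1; exact hc (card_pf_of_vm2 n h1)
      rw [h1, h2]; simp
    obtain ⟨h1, h2⟩ := TT_bounds t ht n hn this
    exact ⟨mul_nonneg h0 h1, mul_le_mul_of_nonneg_left h2 h0⟩
end HH

namespace HH
open Finset ArithmeticFunction
open scoped ArithmeticFunction.Moebius ArithmeticFunction.zeta

/-- Mertens sum -/
noncomputable def mm (u : ℝ) : ℝ := ∑ n ∈ Ioc 0 ⌊u⌋₊, Λ n / n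

lemma sum_log_eq (N : ℕ) : ∑ n ∈ Ioc 0 N, Real.log n = ∑ d ∈ Ioc 0 N, Λ d * ((N / d : ℕ) : ℝ) := by
  have h := sum_hyper (fun k _ => Λ k) N
  simp only [sum_const, Nat.card_Ioc, nsmul_eq_mul, tsub_zero] at h
  rw [sum_congr rfl (fun d _ => mul_comm (Λ d) ((N / d : ℕ) : ℝ)), h]
  refine sum_congr rfl fun n _ => ?_
  rw [Nat.sum_divisorsAntidiagonal (fun k _ => Λ k), vonMangoldt_sum]

lemma sum_log_factorial (N : ℕ) : ∑ n ∈ Ioc 0 N, Real.log n = Real.log (N.factorial) := by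
  induction N with
  | zero => simp
  | succ N ih =>
    rw [sum_Ioc_succ_top (by omega), ih, Nat.factorial_succ]; push_cast
    rw [Real.log_mul (by positivity) (by positivity)]; ring

lemma mertens_nat (N : ℕ) (hN : 0 < N) : |(∑ n ∈ Ioc 0 N, Λ n / n) - Real.log N| ≤ 6 := by
  have hN' : (0:ℝ) < N := by exact_mod_cast hN
  have h1 := sum_log_eq N
  rw [sum_log_factorial] at h1
  have up : Real.log N.factorial ≤ N * Real.log N := by
    rw [← Real.log_pow]
    exact Real.log_le_log (by positivity) (by exact_mod_cast Nat.factorial_le_pow N)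
  have lo : N * Real.log N - N ≤ Real.log N.factorial := by
    have := Real.pow_div_factorial_le_exp (N:ℝ) hN'.le N
    have h2 := Real.log_le_log (by positivity) this
    rw [Real.log_exp, Real.log_div (by positivity) (by positivity), Real.log_pow] at h2
    linarith
  have hup : ∑ d ∈ Ioc 0 N, Λ d * ((N / d : ℕ) : ℝ) ≤ N * ∑ n ∈ Ioc 0 N, Λ n / n := by
    rw [mul_sum]
    refine sum_le_sum fun d hd => ?_
    have : ((N / d : ℕ) : ℝ) ≤ N / d := Nat.cast_div_le
    calc _ ≤ Λ d * (N / d : ℝ) := mul_le_mul_of_nonneg_left this vonMangoldt_nonneg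
      _ = _ := by ring
  have hlo : N * (∑ n ∈ Ioc 0 N, Λ n / n) - 5.5 * N ≤ ∑ d ∈ Ioc 0 N, Λ d * ((N / d : ℕ) : ℝ) := by
    have hpsi := Chebyshev.psi_le_const_mul_self hN'.le
    have h4 : Real.log 4 ≤ 1.4 := by
      rw [show (4:ℝ) = 2^2 by norm_num, Real.log_pow]; have := Real.log_two_lt_d9; norm_num; linarith
    have hps : Chebyshev.psi N = ∑ d ∈ Ioc 0 N, Λ d := by simp [Chebyshev.psi]
    have : N * (∑ n ∈ Ioc 0 N, Λ n / n) - ∑ d ∈ Ioc 0 N, Λ d ≤ ∑ d ∈ Ioc 0 N, Λ d * ((N / d : ℕ) : ℝ) := by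
      rw [mul_sum, ← sum_sub_distrib]
      refine sum_le_sum fun d hd => ?_
      have : (N:ℝ) / d - 1 ≤ ((N / d : ℕ) : ℝ) := by
        rw [← Nat.floor_div_eq_div (K := ℝ)]; exact (Nat.sub_one_lt_floor _).le
      calc _ = Λ d * (N / d - 1 : ℝ) := by ring
        _ ≤ _ := mul_le_mul_of_nonneg_left this vonMangoldt_nonneg
    nlinarith
  set S := ∑ n ∈ Ioc 0 N, Λ n / (n:ℝ)
  rw [abs_le]
  constructor
  · have : (N:ℝ) * (Real.log N - 1) ≤ N * S := by linarith
    have := le_of_mul_le_mul_left this hN'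
    linarith
  · have : (N:ℝ) * S ≤ N * (Real.log N + 5.5) := by linarith
    have := le_of_mul_le_mul_left this hN'
    linarith

lemma mertens (u : ℝ) (hu : 1 ≤ u) : |mm u - Real.log u| ≤ 7 := by
  have h0 : 0 < ⌊u⌋₊ := Nat.floor_pos.2 hu
  have h0' : (1:ℝ) ≤ ⌊u⌋₊ := by exact_mod_cast h0
  have h := mertens_nat ⌊u⌋₊ h0
  have h1 : Real.log ⌊u⌋₊ ≤ Real.log u := Real.log_le_log (by linarith) (Nat.floor_le (by linarith))
  have h2 : Real.log u ≤ Real.log ⌊u⌋₊ + 1 := by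
    have : Real.log u ≤ Real.log (2 * ⌊u⌋₊) := Real.log_le_log (by linarith) (by linarith [Nat.lt_floor_add_one u])
    rw [Real.log_mul (by norm_num) (by positivity)] at this
    linarith [Real.log_two_lt_d9]
  rw [mm, abs_le] at *
  constructor <;> linarith [h.1, h.2]

lemma mm_lt_one (u : ℝ) (hu : u < 1) : mm u = 0 := by
  have : ⌊u⌋₊ = 0 := Nat.floor_eq_zero.2 hu
  simp [mm, this]

lemma mm_nonneg (u : ℝ) : 0 ≤ mm u := sum_nonneg fun n _ => div_nonneg vonMangoldt_nonneg (by positivity)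

/-- difference for `a > 0` -/
lemma mm_diff_up (x X : ℝ) (hx : 0 < x) (hX : x ≤ X) : mm X - mm x ≤ Real.log (X / x) + 14 := by
  have hq : 0 ≤ Real.log (X/x) := Real.log_nonneg (by rw [le_div_iff₀ hx]; linarith)
  rcases lt_or_ge X 1 with h | h
  · rw [mm_lt_one X h, mm_lt_one x (by linarith)]; linarith
  · have h1 := (abs_le.1 (mertens X h)).2
    rw [Real.log_div (by linarith) hx.ne'] at *
    rcases lt_or_ge x 1 with h' | h'
    · rw [mm_lt_one x h']; have := Real.log_nonpos hx.le h'.le; linarith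
    · have h2 := (abs_le.1 (mertens x h')).1; linarith

lemma mm_diff_lo (x X : ℝ) (hx : 1 ≤ x) (hX : x ≤ X) : Real.log (X / x) - 14 ≤ mm X - mm x := by
  rw [Real.log_div (by linarith) (by linarith)]
  have h1 := (abs_le.1 (mertens X (by linarith))).1
  have h2 := (abs_le.1 (mertens x (by linarith))).2
  linarith

lemma mm_mono (x X : ℝ) (hX : x ≤ X) : mm x ≤ mm X :=
  sum_le_sum_of_subset_of_nonneg (Ioc_subset_Ioc_right (Nat.floor_le_floor hX))
    fun n _ _ => div_nonneg vonMangoldt_nonneg (by positivity)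

lemma np_bound : ∃ C : ℝ, 0 ≤ C ∧ ∀ s : Finset ℕ, ∑ n ∈ s, (if n.Prime then 0 else Λ n / n) ≤ C := by
  have h := ArithmeticFunction.vonMangoldt.summable_residueClass_non_primes_div (q := 1) 0
  refine ⟨∑' n : ℕ, (if n.Prime then 0 else vonMangoldt.residueClass (0 : ZMod 1) n) / n, tsum_nonneg ?_, fun s => ?_⟩
  · intro n; split_ifs
    · simp
    · exact div_nonneg (vonMangoldt.residueClass_nonneg _ _) (by positivity)
  · refine le_trans (le_of_eq ?_) (h.sum_le_tsum s ?_)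
    · refine sum_congr rfl fun n _ => ?_
      have : vonMangoldt.residueClass (0 : ZMod 1) n = Λ n := by
        simp [vonMangoldt.residueClass, Set.indicator, Subsingleton.elim _ (0 : ZMod 1)]
      rw [this]; split_ifs <;> simp
    · intro n _; split_ifs
      · simp
      · exact div_nonneg (vonMangoldt.residueClass_nonneg _ _) (by positivity)

lemma Sv_interval (x H : ℝ) (hx : 1 ≤ x) (hH : 0 ≤ H) : Sv (Ioc ⌊x⌋₊ ⌊x+H⌋₊) (fun _ => 1) H 1 := by
  refine ⟨fun n hn => by have := (mem_Ioc.1 hn).1; omega, fun _ _ => by norm_num, fun d hd => ?_⟩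
  have hd' : (0:ℝ) < d := by exact_mod_cast hd
  have hc : ∀ M : ℕ, ∑ n ∈ Ioc 0 M, (if d ∣ n then (1:ℝ) else 0) = ((M / d : ℕ) : ℝ) := by
    intro M
    rw [← sum_filter, sum_const, Nat.Ioc_filter_dvd_card_eq_div]; simp
  have hle : ⌊x⌋₊ ≤ ⌊x+H⌋₊ := Nat.floor_le_floor (by linarith)
  have hs := sum_Ioc_consecutive (fun n => if d ∣ n then (1:ℝ) else 0) (Nat.zero_le _) hle
  rw [hc, hc, ← Nat.floor_div_natCast, ← Nat.floor_div_natCast] at hs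
  have e1 := Nat.floor_le (show 0 ≤ x / d by positivity)
  have e2 := Nat.lt_floor_add_one (x/d)
  have e3 := Nat.floor_le (show 0 ≤ (x+H) / d by positivity)
  have e4 := Nat.lt_floor_add_one ((x+H)/d)
  have e5 : (x+H)/d = x/d + H/d := by ring
  rw [abs_le]; constructor <;> linarith

lemma sum_Ioc_dvd (M d : ℕ) (hd : 0 < d) : ∑ n ∈ Ioc 0 M, (if d ∣ n then (1:ℝ)/n else 0)
    = 1/d * ∑ j ∈ Ioc 0 (M/d), (1:ℝ)/j := by
  rw [← sum_filter, mul_sum]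
  refine sum_bij' (fun n _ => n / d) (fun j _ => d * j) ?_ ?_ ?_ ?_ ?_
  · intro n hn
    obtain ⟨h1, k, rfl⟩ := mem_filter.1 hn
    rw [mem_Ioc] at h1 ⊢
    rw [Nat.mul_div_cancel_left _ hd]
    exact ⟨Nat.pos_of_mul_pos_left h1.1, (Nat.le_div_iff_mul_le hd).2 (by linarith [h1.2])⟩
  · intro j hj
    rw [mem_Ioc] at hj
    rw [mem_filter, mem_Ioc]
    refine ⟨⟨Nat.mul_pos hd hj.1, ?_⟩, dvd_mul_right _ _⟩
    have := (Nat.le_div_iff_mul_le hd).1 hj.2; linarith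
  · intro n hn
    exact Nat.mul_div_cancel' (mem_filter.1 hn).2
  · intro j hj; exact Nat.mul_div_cancel_left _ hd
  · intro n hn
    obtain ⟨h1, k, rfl⟩ := mem_filter.1 hn
    rw [Nat.mul_div_cancel_left _ hd]; push_cast
    rw [one_div_mul_one_div]

lemma Sv_long (x X : ℝ) (hx : 1 ≤ x) (hX : x ≤ X) :
    Sv (Ioc ⌊x⌋₊ ⌊X⌋₊) (fun n => 1/(n:ℝ)) (Real.log (X/x)) (4/x) := by
  refine ⟨fun n hn => by have := (mem_Ioc.1 hn).1; omega, fun _ _ => by positivity, fun d hd => ?_⟩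
  have hd' : (0:ℝ) < d := by exact_mod_cast hd
  have hle : ⌊x⌋₊ ≤ ⌊X⌋₊ := Nat.floor_le_floor hX
  have hs := sum_Ioc_consecutive (fun n => if d ∣ n then (1:ℝ)/n else 0) (Nat.zero_le _) hle
  rw [sum_Ioc_dvd _ _ hd, sum_Ioc_dvd _ _ hd, ← Nat.floor_div_natCast, ← Nat.floor_div_natCast] at hs
  have e1 := abs_le.1 (harmonic_est (x/d) (by positivity))
  have e2 := abs_le.1 (harmonic_est (X/d) (div_pos (by linarith) hd'))
  have hX0 : 0 < X := by linarith
  have hx0 : 0 < x := by linarith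
  rw [Real.log_div hx0.ne' hd'.ne'] at e1
  rw [Real.log_div hX0.ne' hd'.ne'] at e2
  have e3 : 1/(d:ℝ) * (2/(x/d)) = 2/x := by field_simp
  have e4 : 1/(d:ℝ) * (2/(X/d)) ≤ 2/x := by
    have : 1/(d:ℝ) * (2/(X/d)) = 2/X := by field_simp
    rw [this]; gcongr
  rw [Real.log_div hX0.ne' hx0.ne']
  set Sx := ∑ j ∈ Ioc 0 ⌊x/d⌋₊, (1:ℝ)/j
  set SX := ∑ j ∈ Ioc 0 ⌊X/d⌋₊, (1:ℝ)/j
  set γ := Real.eulerMascheroniConstant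
  have hd1 : 0 ≤ 1/(d:ℝ) := by positivity
  have f1 := mul_le_mul_of_nonneg_left e1.1 hd1
  have f2 := mul_le_mul_of_nonneg_left e1.2 hd1
  have f3 := mul_le_mul_of_nonneg_left e2.1 hd1
  have f4 := mul_le_mul_of_nonneg_left e2.2 hd1
  have e5 : (Real.log X - Real.log x)/d = 1/d * Real.log X - 1/d * Real.log x := by ring
  have e6 : 4/x = 2/x+2/x := by ring
  rw [e5, e6, abs_le]
  constructor <;> nlinarith
end HH

namespace HH
open Finset ArithmeticFunction
open scoped ArithmeticFunction.Moebius ArithmeticFunction.zeta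

/-- main-term constant -/
noncomputable def MM (v v0 : ℝ) : ℝ :=
  ∑ m ∈ Ioc 0 ⌊Real.exp v⌋₊, ∑ k ∈ Ioc 0 ⌊Real.exp v0⌋₊,
    ((μ m : ℝ) * (max (v - Real.log m) 0)^2) * ((μ k : ℝ) * max (v0 - Real.log k) 0) / (Nat.lcm m k : ℕ)

lemma max_sub_log_le (v : ℝ) (hv : 0 ≤ v) (m : ℕ) (hm : 0 < m) : max (v - Real.log m) 0 ≤ v := by
  have : 0 ≤ Real.log m := Real.log_nonneg (by exact_mod_cast hm)
  exact max_le (by linarith) hv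

lemma sum_abs_Q (v : ℝ) (hv : 0 ≤ v) :
    ∑ m ∈ Ioc 0 ⌊Real.exp v⌋₊, |(μ m : ℝ) * (max (v - Real.log m) 0)^2| ≤ Real.exp v * v^2 := by
  calc _ ≤ ∑ m ∈ Ioc 0 ⌊Real.exp v⌋₊, v^2 := by
        refine sum_le_sum fun m hm => ?_
        rw [abs_mul, abs_of_nonneg (sq_nonneg (max (v - Real.log m) 0))]
        have h1 := max_sub_log_le v hv m (mem_Ioc.1 hm).1
        have h2 : 0 ≤ max (v - Real.log m) 0 := le_max_right _ _
        calc _ ≤ 1 * v^2 := by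
              gcongr
              exact moebius_abs_le m
          _ = _ := one_mul _
    _ = ⌊Real.exp v⌋₊ * v^2 := by simp
    _ ≤ _ := by
        gcongr
        exact Nat.floor_le (Real.exp_pos v).le

lemma sum_abs_T (v : ℝ) (hv : 0 ≤ v) :
    ∑ m ∈ Ioc 0 ⌊Real.exp v⌋₊, |(μ m : ℝ) * max (v - Real.log m) 0| ≤ Real.exp v * v := by
  calc _ ≤ ∑ m ∈ Ioc 0 ⌊Real.exp v⌋₊, v := by
        refine sum_le_sum fun m hm => ?_
        have h1 := max_sub_log_le v hv m (mem_Ioc.1 hm).1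
        have h2 : 0 ≤ max (v - Real.log m) 0 := le_max_right _ _
        rw [abs_mul, abs_of_nonneg h2]
        calc _ ≤ 1 * v := by
              gcongr
              exact moebius_abs_le m
          _ = _ := one_mul _
    _ = ⌊Real.exp v⌋₊ * v := by simp
    _ ≤ _ := by
        gcongr
        exact Nat.floor_le (Real.exp_pos v).le

lemma compare {s : Finset ℕ} {ν : ℕ → ℝ} {Y R : ℝ} (hS : Sv s ν Y R) (hY : 0 ≤ Y) (hR : 0 ≤ R)
    (v v0 V : ℝ) (hv : 0 ≤ v) (hv0 : 0 ≤ v0) (hV : v0 ≤ V) (hw : ∀ n ∈ s, Real.log n - v ≤ V) :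
    |∑ n ∈ s, ν n * (FF v n * TT v0 n) - Y * MM v v0| ≤
      R * ((Real.exp v * v^2) * (Real.exp v0 * v0)) + 2 * V * (144 * (1 + V) * Y + R * (Real.exp V * V)^2) := by
  have h1 := quad hS (fun m => (μ m : ℝ) * (max (v - Real.log m) 0)^2) (fun m => (μ m : ℝ) * max (v0 - Real.log m) 0)
    ⌊Real.exp v⌋₊ ⌊Real.exp v0⌋₊
  rw [sum_congr rfl (fun n hn => by rw [← QQ_eq_dv v n (hS.1 n hn), ← TT_eq_dv v0 n (hS.1 n hn)])] at h1
  have h2 : R * ((∑ m ∈ Ioc 0 ⌊Real.exp v⌋₊, |(μ m : ℝ) * (max (v - Real.log m) 0)^2|) *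
      ∑ m ∈ Ioc 0 ⌊Real.exp v0⌋₊, |(μ m : ℝ) * max (v0 - Real.log m) 0|)
      ≤ R * ((Real.exp v * v^2) * (Real.exp v0 * v0)) := by
    gcongr
    · exact sum_abs_Q v hv
    · exact sum_abs_T v0 hv0
  have h3 := tail hS hY hR v0 V hv0 hV (fun n => lr n - v) (fun n hn => by
    have := lr_le n (hS.1 n hn).ne'
    have := hw n hn
    linarith)
  have h4 : |∑ n ∈ s, ν n * (FF v n * TT v0 n) - ∑ n ∈ s, ν n * (QQ v n * TT v0 n)|
      ≤ ∑ n ∈ s, ν n * (|QQ (lr n - v) n| * |TT v0 n|) := by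
    rw [← sum_sub_distrib]
    refine (abs_sum_le_sum_abs _ _).trans (sum_le_sum fun n hn => ?_)
    rw [← QQ_refl_le v n (hS.1 n hn).ne', ← mul_sub, abs_mul, abs_of_nonneg (hS.2.1 n hn), ← sub_mul, abs_mul,
      abs_sub_comm]
  have h5 := h1.trans h2
  calc _ ≤ |∑ n ∈ s, ν n * (FF v n * TT v0 n) - ∑ n ∈ s, ν n * (QQ v n * TT v0 n)|
        + |∑ n ∈ s, ν n * (QQ v n * TT v0 n) - Y * MM v v0| := abs_sub_le _ _ _
    _ ≤ _ := by
      have h6 : |∑ n ∈ s, ν n * (QQ v n * TT v0 n) - Y * MM v v0| ≤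
        R * ((Real.exp v * v^2) * (Real.exp v0 * v0)) := h5
      linarith [h4.trans h3]

/-- rough von Mangoldt -/
noncomputable def gg (v0 : ℝ) (n : ℕ) : ℝ := by
  classical exact if ∀ p ∈ n.primeFactors, v0 ≤ Real.log p then 1 else 0

lemma gg_nonneg (v0 : ℝ) (n : ℕ) : 0 ≤ gg v0 n := by
  unfold gg; split_ifs <;> norm_num
lemma gg_le (v0 : ℝ) (n : ℕ) : gg v0 n ≤ 1 := by
  unfold gg; split_ifs <;> norm_num

lemma FFTT_lower (v v0 : ℝ) (hv0 : 0 ≤ v0) (n : ℕ) (hn : 2 ≤ n) (h : Real.log n ≤ 2 * v) :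
    v0 * (∑ p ∈ n.divisorsAntidiagonal, (Λ p.1 * gg v0 p.1) * (Λ p.2 * gg v0 p.2) + Λ n * gg v0 n * (2 * v - Real.log n))
      ≤ FF v n * TT v0 n := by
  by_cases hg : ∀ p ∈ n.primeFactors, v0 ≤ Real.log p
  · rw [TT_eq_self v0 hv0 n (by omega) hg, mul_comm (FF v n)]
    refine mul_le_mul_of_nonneg_left ?_ hv0
    rw [FF_eq v n hn, ArithmeticFunction.mul_apply]
    have hL := fun k => vonMangoldt_nonneg (n := k)
    refine add_le_add (sum_le_sum fun p _ => ?_) ?_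
    · exact mul_le_mul (mul_le_of_le_one_right (hL _) (gg_le _ _)) (mul_le_of_le_one_right (hL _) (gg_le _ _))
        (mul_nonneg (hL _) (gg_nonneg _ _)) (hL _)
    · exact mul_le_mul_of_nonneg_right (mul_le_of_le_one_right (hL _) (gg_le _ _)) (by linarith)
  · have h0 := (FFTT_bounds v v0 hv0 n hn h).1
    have e1 : gg v0 n = 0 := by unfold gg; rw [if_neg hg]
    have e2 : ∑ p ∈ n.divisorsAntidiagonal, (Λ p.1 * gg v0 p.1) * (Λ p.2 * gg v0 p.2) = 0 := by
      refine sum_eq_zero fun p hp => ?_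
      obtain ⟨h1, h2⟩ := Nat.mem_divisorsAntidiagonal.1 hp
      push Not at hg
      obtain ⟨q, hq, hq2⟩ := hg
      rw [← h1] at hq h2
      rw [Nat.primeFactors_mul (by rintro h; simp [h] at h2) (by rintro h; simp [h] at h2), mem_union] at hq
      rcases hq with hq | hq
      · have : gg v0 p.1 = 0 := by
          unfold gg; rw [if_neg]; push Not; exact ⟨q, hq, hq2⟩
        rw [this]; ring
      · have : gg v0 p.2 = 0 := by
          unfold gg; rw [if_neg]; push Not; exact ⟨q, hq, hq2⟩
        rw [this]; ring
    rw [e1, e2]; simpa using h0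

lemma conv_sum (α β : ℕ → ℝ) (x X : ℝ) (hX : x ≤ X) :
    ∑ n ∈ Ioc ⌊x⌋₊ ⌊X⌋₊, 1/(n:ℝ) * ∑ p ∈ n.divisorsAntidiagonal, α p.1 * β p.2
      = ∑ a ∈ Ioc 0 ⌊X⌋₊, α a / a * (∑ b ∈ Ioc 0 ⌊X/a⌋₊, β b / b - ∑ b ∈ Ioc 0 ⌊x/a⌋₊, β b / b) := by
  have hle : ⌊x⌋₊ ≤ ⌊X⌋₊ := Nat.floor_le_floor hX
  have e1 : ∀ n : ℕ, 1/(n:ℝ) * ∑ p ∈ n.divisorsAntidiagonal, α p.1 * β p.2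
      = ∑ p ∈ n.divisorsAntidiagonal, (α p.1 / p.1) * (β p.2 / p.2) := by
    intro n
    rw [mul_sum]
    refine sum_congr rfl fun p hp => ?_
    have := (Nat.mem_divisorsAntidiagonal.1 hp).1
    rw [← this]; push_cast
    rw [div_mul_div_comm]; ring
  simp_rw [e1]
  have hs := sum_Ioc_consecutive (fun n : ℕ => ∑ p ∈ n.divisorsAntidiagonal, (α p.1 / p.1) * (β p.2 / p.2)) (Nat.zero_le _) hle
  rw [← sum_hyper (fun a b => (α a / a) * (β b / b)), ← sum_hyper (fun a b => (α a / a) * (β b / b))] at hs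
  have e2 : ∑ k ∈ Ioc 0 ⌊x⌋₊, ∑ j ∈ Ioc 0 (⌊x⌋₊ / k), (α k / k) * (β j / j)
      = ∑ k ∈ Ioc 0 ⌊X⌋₊, ∑ j ∈ Ioc 0 (⌊x⌋₊ / k), (α k / k) * (β j / j) := by
    refine sum_subset (Ioc_subset_Ioc_right hle) fun k h1 h2 => ?_
    have : ⌊x⌋₊ / k = 0 := by
      rw [mem_Ioc] at h1 h2
      exact Nat.div_eq_of_lt (by omega)
    rw [this]; simp
  rw [e2] at hs
  have e3 := eq_sub_of_add_eq' hs
  rw [e3, ← sum_sub_distrib]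
  refine sum_congr rfl fun a _ => ?_
  rw [Nat.floor_div_natCast, Nat.floor_div_natCast, mul_sub, mul_sum, mul_sum]
end HH

namespace HH
open Finset ArithmeticFunction
open scoped ArithmeticFunction.Moebius ArithmeticFunction.zeta

lemma mem_exp_Ioc (L Z : ℝ) (hL : 0 ≤ L) (n : ℕ) (hn : n ∈ Ioc ⌊Real.exp L⌋₊ ⌊Real.exp Z⌋₊) :
    2 ≤ n ∧ L < Real.log n ∧ Real.log n ≤ Z := by
  rw [mem_Ioc] at hn
  have h1 : 1 ≤ ⌊Real.exp L⌋₊ := Nat.floor_pos.2 (Real.one_le_exp hL)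
  have hn0 : (0:ℝ) < n := by exact_mod_cast (by omega : 0 < n)
  refine ⟨by omega, ?_, ?_⟩
  · rw [Real.lt_log_iff_exp_lt hn0]; exact Nat.lt_of_floor_lt hn.1
  · rw [Real.log_le_iff_le_exp hn0]; exact (Nat.le_floor_iff (Real.exp_pos _).le).1 hn.2

lemma brk_up (L Y : ℝ) (hY : 0 ≤ Y) (a : ℕ) (ha : 0 < a) :
    mm (Real.exp (L+Y) / a) - mm (Real.exp L / a) ≤ Y + 14 := by
  have ha' : (0:ℝ) < a := by exact_mod_cast ha
  have h := mm_diff_up (Real.exp L / a) (Real.exp (L+Y) / a) (by positivity) (by gcongr; linarith)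
  rwa [div_div_div_cancel_right₀ ha'.ne', ← Real.exp_sub, Real.log_exp, add_sub_cancel_left] at h

lemma brk_nonneg (L Y : ℝ) (hY : 0 ≤ Y) (a : ℕ) :
    0 ≤ mm (Real.exp (L+Y) / a) - mm (Real.exp L / a) := by
  have := mm_mono (Real.exp L / a) (Real.exp (L+Y) / a) (by gcongr; linarith)
  linarith

lemma sum_lam_long (L Y : ℝ) (hY : 0 ≤ Y) :
    ∑ n ∈ Ioc ⌊Real.exp L⌋₊ ⌊Real.exp (L+Y)⌋₊, Λ n / n = mm (Real.exp (L+Y)) - mm (Real.exp L) := by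
  have hle : ⌊Real.exp L⌋₊ ≤ ⌊Real.exp (L+Y)⌋₊ := Nat.floor_le_floor (Real.exp_le_exp.2 (by linarith))
  have hs := sum_Ioc_consecutive (fun n : ℕ => Λ n / (n:ℝ)) (Nat.zero_le _) hle
  rw [mm, mm, ← hs]; ring

lemma mm_exp_up (Z : ℝ) (hZ : 0 ≤ Z) : mm (Real.exp Z) ≤ Z + 7 := by
  have := (abs_le.1 (mertens (Real.exp Z) (Real.one_le_exp hZ))).2
  rw [Real.log_exp] at this; linarith

lemma mm_exp_lo (Z : ℝ) (hZ : 0 ≤ Z) : Z - 7 ≤ mm (Real.exp Z) := by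
  have := (abs_le.1 (mertens (Real.exp Z) (Real.one_le_exp hZ))).1
  rw [Real.log_exp] at this; linarith

lemma long_upper (L Y v v0 : ℝ) (hL : 0 ≤ L) (hY : 0 ≤ Y) (hv0 : 0 ≤ v0) (hv : L + Y ≤ 2 * v) :
    ∑ n ∈ Ioc ⌊Real.exp L⌋₊ ⌊Real.exp (L+Y)⌋₊, 1/(n:ℝ) * (FF v n * TT v0 n) ≤
      v0 * ((Y + 14) * (L + Y + 7) + (2 * v - L) * (Y + 14)) := by
  have hLam := fun k => vonMangoldt_nonneg (n := k)
  have h1 : ∑ n ∈ Ioc ⌊Real.exp L⌋₊ ⌊Real.exp (L+Y)⌋₊, 1/(n:ℝ) * ∑ p ∈ n.divisorsAntidiagonal, Λ p.1 * Λ p.2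
      ≤ (Y + 14) * (L + Y + 7) := by
    rw [conv_sum (fun a => Λ a) (fun a => Λ a) _ _ (Real.exp_le_exp.2 (by linarith))]
    calc _ ≤ ∑ a ∈ Ioc 0 ⌊Real.exp (L+Y)⌋₊, Λ a / a * (Y + 14) := by
          refine sum_le_sum fun a ha => ?_
          exact mul_le_mul_of_nonneg_left (brk_up L Y hY a (mem_Ioc.1 ha).1) (div_nonneg (hLam a) (by positivity))
      _ = (Y+14) * mm (Real.exp (L+Y)) := by rw [← sum_mul, mm, mul_comm]
      _ ≤ _ := by
          gcongr
          exact mm_exp_up (L+Y) (by linarith)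
  have h2 : ∑ n ∈ Ioc ⌊Real.exp L⌋₊ ⌊Real.exp (L+Y)⌋₊, Λ n / n ≤ Y + 14 := by
    rw [sum_lam_long L Y hY]
    simpa using brk_up L Y hY 1 one_pos
  calc _ ≤ ∑ n ∈ Ioc ⌊Real.exp L⌋₊ ⌊Real.exp (L+Y)⌋₊,
        v0 * (1/(n:ℝ) * (∑ p ∈ n.divisorsAntidiagonal, Λ p.1 * Λ p.2) + (2*v - L) * (Λ n / n)) := by
        refine sum_le_sum fun n hn => ?_
        obtain ⟨a1, a2, a3⟩ := mem_exp_Ioc L (L+Y) hL n hn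
        have h3 := (FFTT_bounds v v0 hv0 n a1 (by linarith)).2
        rw [FF_eq v n a1, ArithmeticFunction.mul_apply] at h3
        have hn0 : 0 ≤ 1/(n:ℝ) := by positivity
        rw [FF_eq v n a1, ArithmeticFunction.mul_apply]
        refine (mul_le_mul_of_nonneg_left h3 hn0).trans ?_
        have h4 : Λ n * (2 * v - Real.log n) ≤ Λ n * (2*v - L) := mul_le_mul_of_nonneg_left (by linarith) (hLam n)
        calc 1/(n:ℝ) * ((∑ p ∈ n.divisorsAntidiagonal, Λ p.1 * Λ p.2 + Λ n * (2 * v - Real.log n)) * v0)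
            ≤ 1/(n:ℝ) * ((∑ p ∈ n.divisorsAntidiagonal, Λ p.1 * Λ p.2 + Λ n * (2 * v - L)) * v0) := by gcongr
          _ = _ := by ring
    _ = v0 * (∑ n ∈ Ioc ⌊Real.exp L⌋₊ ⌊Real.exp (L+Y)⌋₊, 1/(n:ℝ) * (∑ p ∈ n.divisorsAntidiagonal, Λ p.1 * Λ p.2)
        + (2*v-L) * ∑ n ∈ Ioc ⌊Real.exp L⌋₊ ⌊Real.exp (L+Y)⌋₊, Λ n / n) := by
        rw [← mul_sum, sum_add_distrib, ← mul_sum]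
    _ ≤ _ := by
        have : 0 ≤ 2 * v - L := by linarith
        gcongr

lemma hh_np (v0 : ℝ) (a : ℕ) (ha : 0 < a) (hlog : v0 ≤ Real.log a) :
    Λ a / a - Λ a * gg v0 a / a ≤ if a.Prime then 0 else Λ a / a := by
  have hLam := vonMangoldt_nonneg (n := a)
  have hg := gg_nonneg v0 a
  split_ifs with hp
  · have : gg v0 a = 1 := by
      unfold gg; rw [if_pos]; intro p hp'
      rw [Nat.Prime.primeFactors hp, mem_singleton] at hp'
      rw [hp']; exact hlog
    rw [this]; simp
  · have : 0 ≤ Λ a * gg v0 a / a := by positivity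
    linarith

lemma long_lower (C : ℝ) (hC : 0 ≤ C) (hnp : ∀ s : Finset ℕ, ∑ n ∈ s, (if n.Prime then 0 else Λ n / n) ≤ C)
    (L Y v v0 : ℝ) (hL : 0 ≤ L) (hY : 14 ≤ Y) (hv0 : 0 ≤ v0) (hv0L : v0 ≤ L) (hv : L + Y ≤ 2 * v) :
      v0 * ((Y - 14) * (L - 7) - 2 * ((Y + 14) * (v0 + 7 + C)) + (2 * v - L - Y) * (Y - 14 - C)) ≤
    ∑ n ∈ Ioc ⌊Real.exp L⌋₊ ⌊Real.exp (L+Y)⌋₊, 1/(n:ℝ) * (FF v n * TT v0 n) := by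
  have hY0 : 0 ≤ Y := by linarith
  have hLam := fun k => vonMangoldt_nonneg (n := k)
  set s := Ioc ⌊Real.exp L⌋₊ ⌊Real.exp (L+Y)⌋₊ with hs
  have hle : ⌊Real.exp L⌋₊ ≤ ⌊Real.exp (L+Y)⌋₊ := Nat.floor_le_floor (Real.exp_le_exp.2 (by linarith))
  -- full sum
  have h1 : (Y - 14) * (L - 7) ≤ ∑ n ∈ s, 1/(n:ℝ) * ∑ p ∈ n.divisorsAntidiagonal, Λ p.1 * Λ p.2 := by
    rw [hs, conv_sum (fun a => Λ a) (fun a => Λ a) _ _ (Real.exp_le_exp.2 (by linarith))]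
    calc (Y-14) * (L-7) ≤ (Y-14) * mm (Real.exp L) :=
          mul_le_mul_of_nonneg_left (mm_exp_lo L hL) (by linarith)
      _ = ∑ a ∈ Ioc 0 ⌊Real.exp L⌋₊, Λ a / a * (Y - 14) := by rw [← sum_mul, mm, mul_comm]
      _ ≤ ∑ a ∈ Ioc 0 ⌊Real.exp L⌋₊, Λ a / a * (mm (Real.exp (L+Y) / a) - mm (Real.exp L / a)) := by
          refine sum_le_sum fun a ha => ?_
          rw [mem_Ioc] at ha
          have ha' : (0:ℝ) < a := by exact_mod_cast ha.1
          refine mul_le_mul_of_nonneg_left ?_ (div_nonneg (hLam a) (by positivity))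
          have h := mm_diff_lo (Real.exp L / a) (Real.exp (L+Y) / a)
            (by rw [le_div_iff₀ ha', one_mul]; exact (Nat.le_floor_iff (Real.exp_pos _).le).1 ha.2) (by gcongr; linarith)
          rwa [div_div_div_cancel_right₀ ha'.ne', ← Real.exp_sub, Real.log_exp, add_sub_cancel_left] at h
      _ ≤ _ := by
          refine sum_le_sum_of_subset_of_nonneg (Ioc_subset_Ioc_right hle) fun a _ _ => ?_
          exact mul_nonneg (div_nonneg (hLam a) (by positivity)) (brk_nonneg L Y hY0 a)
  -- the bad sum
  have h2 : ∑ a ∈ Ioc 0 ⌊Real.exp (L+Y)⌋₊, (Λ a - Λ a * gg v0 a) / a ≤ v0 + 7 + C := by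
    have hle2 : ⌊Real.exp v0⌋₊ ≤ ⌊Real.exp (L+Y)⌋₊ := Nat.floor_le_floor (Real.exp_le_exp.2 (by linarith))
    rw [← sum_Ioc_consecutive _ (Nat.zero_le _) hle2]
    refine add_le_add ((sum_le_sum fun a _ => ?_).trans (mm_exp_up v0 hv0)) ((sum_le_sum fun a ha => ?_).trans (hnp _))
    · have : 0 ≤ Λ a * gg v0 a := mul_nonneg (hLam a) (gg_nonneg _ _)
      gcongr; linarith
    · obtain ⟨b1, b2, b3⟩ := mem_exp_Ioc v0 (L+Y) hv0 a ha
      rw [sub_div]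
      exact hh_np v0 a (by omega) b2.le
  have h3 : ∑ n ∈ s, 1/(n:ℝ) * ∑ p ∈ n.divisorsAntidiagonal, (Λ p.1 - Λ p.1 * gg v0 p.1) * Λ p.2
      ≤ (Y + 14) * (v0 + 7 + C) := by
    rw [hs, conv_sum (fun a => Λ a - Λ a * gg v0 a) (fun a => Λ a) _ _ (Real.exp_le_exp.2 (by linarith))]
    calc _ ≤ ∑ a ∈ Ioc 0 ⌊Real.exp (L+Y)⌋₊, (Λ a - Λ a * gg v0 a) / a * (Y + 14) := by
          refine sum_le_sum fun a ha => ?_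
          refine mul_le_mul_of_nonneg_left (brk_up L Y hY0 a (mem_Ioc.1 ha).1) (div_nonneg ?_ (by positivity))
          have := mul_le_of_le_one_right (hLam a) (gg_le v0 a)
          linarith
      _ = (Y+14) * ∑ a ∈ Ioc 0 ⌊Real.exp (L+Y)⌋₊, (Λ a - Λ a * gg v0 a) / a := by rw [← sum_mul, mul_comm]
      _ ≤ _ := by gcongr
  have h4 : ∑ n ∈ s, 1/(n:ℝ) * ∑ p ∈ n.divisorsAntidiagonal, Λ p.1 * (Λ p.2 - Λ p.2 * gg v0 p.2)
      ≤ (Y + 14) * (v0 + 7 + C) := by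
    refine le_trans (le_of_eq ?_) h3
    refine sum_congr rfl fun n _ => ?_
    congr 1
    conv_lhs => rw [← Nat.map_swap_divisorsAntidiagonal, sum_map]
    exact sum_congr rfl fun p _ => by simp [mul_comm]
  have h5 : Y - 14 - C ≤ ∑ n ∈ s, Λ n * gg v0 n / n := by
    have e1 : ∑ n ∈ s, (Λ n / n - Λ n * gg v0 n / n) ≤ C := by
      refine (sum_le_sum fun a ha => ?_).trans (hnp s)
      obtain ⟨b1, b2, b3⟩ := mem_exp_Ioc L (L+Y) hL a ha
      exact hh_np v0 a (by omega) (by linarith)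
    have e2 : Y - 14 ≤ ∑ n ∈ s, Λ n / n := by
      rw [hs, sum_lam_long L Y hY0]
      have := mm_diff_lo (Real.exp L) (Real.exp (L+Y)) (Real.one_le_exp hL) (Real.exp_le_exp.2 (by linarith))
      rwa [← Real.exp_sub, Real.log_exp, add_sub_cancel_left] at this
    rw [sum_sub_distrib] at e1
    linarith
  have key : ∀ n ∈ s, v0 * (1/(n:ℝ) * (∑ p ∈ n.divisorsAntidiagonal, Λ p.1 * Λ p.2)
      - 1/(n:ℝ) * (∑ p ∈ n.divisorsAntidiagonal, (Λ p.1 - Λ p.1 * gg v0 p.1) * Λ p.2)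
      - 1/(n:ℝ) * (∑ p ∈ n.divisorsAntidiagonal, Λ p.1 * (Λ p.2 - Λ p.2 * gg v0 p.2))
      + (2*v - L - Y) * (Λ n * gg v0 n / n)) ≤ 1/(n:ℝ) * (FF v n * TT v0 n) := by
    intro n hn
    obtain ⟨a1, a2, a3⟩ := mem_exp_Ioc L (L+Y) hL n hn
    have g1 := FFTT_lower v v0 hv0 n a1 (by linarith)
    have hn0 : 0 ≤ 1/(n:ℝ) := by positivity
    refine le_trans ?_ (mul_le_mul_of_nonneg_left g1 hn0)
    have g2 : (∑ p ∈ n.divisorsAntidiagonal, Λ p.1 * Λ p.2)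
      - (∑ p ∈ n.divisorsAntidiagonal, (Λ p.1 - Λ p.1 * gg v0 p.1) * Λ p.2)
      - (∑ p ∈ n.divisorsAntidiagonal, Λ p.1 * (Λ p.2 - Λ p.2 * gg v0 p.2))
      ≤ ∑ p ∈ n.divisorsAntidiagonal, (Λ p.1 * gg v0 p.1) * (Λ p.2 * gg v0 p.2) := by
      rw [← sum_sub_distrib, ← sum_sub_distrib]
      refine sum_le_sum fun p _ => ?_
      have q1 : 0 ≤ Λ p.1 - Λ p.1 * gg v0 p.1 := by
        have := mul_le_of_le_one_right (hLam p.1) (gg_le v0 p.1); linarith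
      have q2 : 0 ≤ Λ p.2 - Λ p.2 * gg v0 p.2 := by
        have := mul_le_of_le_one_right (hLam p.2) (gg_le v0 p.2); linarith
      nlinarith [mul_nonneg q1 q2]
    have g3 : Λ n * gg v0 n * (2 * v - L - Y) ≤ Λ n * gg v0 n * (2 * v - Real.log n) :=
      mul_le_mul_of_nonneg_left (by linarith) (mul_nonneg (hLam n) (gg_nonneg _ _))
    have g4 := mul_le_mul_of_nonneg_left (mul_le_mul_of_nonneg_left (add_le_add g2 g3) hv0) hn0
    refine le_trans (le_of_eq ?_) g4
    ring
  refine le_trans ?_ (sum_le_sum key)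
  rw [← mul_sum, sum_add_distrib, sum_sub_distrib, sum_sub_distrib, ← mul_sum]
  have : 0 ≤ 2*v - L - Y := by linarith
  have h6 := mul_le_mul_of_nonneg_left h5 this
  refine mul_le_mul_of_nonneg_left ?_ hv0
  linarith
end HH

namespace HH
open Finset ArithmeticFunction
open scoped ArithmeticFunction.Moebius ArithmeticFunction.zeta

lemma exp_small (δ L : ℝ) (hδ : 0 < δ) (hL : 14/δ^3 ≤ L) : L * Real.exp (-(δ*L)) ≤ δ := by
  have h3 : 0 < δ^3 := by positivity
  have hL0 : 0 < L := lt_of_lt_of_le (by positivity) hL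
  have h1 : 14 ≤ L * δ^3 := by rwa [div_le_iff₀ h3] at hL
  have h2 := Real.quadratic_le_exp_of_nonneg (show 0 ≤ δ * L by positivity)
  have h4 : L ≤ δ * Real.exp (δ*L) := by
    have : L ≤ δ * ((δ*L)^2/2) := by nlinarith
    have h5 : δ * ((δ*L)^2/2) ≤ δ * Real.exp (δ*L) := by
      gcongr; nlinarith [mul_pos hδ hL0]
    linarith
  rw [Real.exp_neg, ← div_eq_mul_inv, div_le_iff₀ (Real.exp_pos _)]
  exact h4

set_option maxHeartbeats 1600000 in
theorem selberg_short : ∃ C0 : ℝ, 0 < C0 ∧ ∀ δ : ℝ, 0 < δ → δ ≤ 1/20 → ∀ L : ℝ, 14/δ^3 ≤ L →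
    ∀ H : ℝ, Real.exp ((1-δ)*L) ≤ H → H ≤ Real.exp L →
    |∑ n ∈ Ioc ⌊Real.exp L⌋₊ ⌊Real.exp L + H⌋₊, FF ((1-3*δ)*L) n * TT (δ*L) n - 2 * L * (δ * L) * H|
      ≤ C0 * δ * L * (δ * L) * H := by
  obtain ⟨C, hC, hnp⟩ := np_bound
  refine ⟨20000 + 100 * C, by positivity, fun δ hδ hδ1 L hL H hH1 hH2 => ?_⟩
  have h3 : 0 < δ^3 := by positivity
  have hL0 : 0 < L := lt_of_lt_of_le (by positivity) hL
  have h14 : 14 ≤ L * δ^3 := by rwa [div_le_iff₀ h3] at hL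
  have hsm := exp_small δ L hδ hL
  set E := Real.exp (-(δ*L)) with hE
  have hE0 : 0 < E := Real.exp_pos _
  set Z := Real.exp L with hZ
  have hZ0 : 0 < Z := Real.exp_pos _
  set v := (1-3*δ)*L with hv
  set Y := δ * L with hY
  have hYL : Y ≤ L := by nlinarith
  have hδ2 : δ^2 ≤ 1 := by nlinarith
  have hY14 : 14 ≤ Y := by nlinarith
  have hδY : 14 ≤ δ * Y := by nlinarith
  have hHE : Z * E ≤ H := by
    refine le_trans (le_of_eq ?_) hH1
    rw [hZ, hE, ← Real.exp_add]; congr 1; rw [hY]; ring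
  have hH0 : 0 < H := lt_of_lt_of_le (by positivity) hHE
  have hvv : Real.exp v * Real.exp Y = Z * E^2 := by
    rw [hZ, hE, sq, ← Real.exp_add, ← Real.exp_add, ← Real.exp_add]; congr 1; rw [hY, hv]; ring
  have hV : Real.exp (4*Y)^2 ≤ Z * E^2 := by
    rw [hZ, hE, sq, sq, ← Real.exp_add, ← Real.exp_add, ← Real.exp_add]
    refine Real.exp_le_exp.2 ?_
    rw [hY]; nlinarith
  have hv0 : 0 ≤ v := by rw [hv]; apply mul_nonneg <;> linarith
  have hvL : v ≤ L := by rw [hv]; nlinarith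
  -- long
  have hlongS := Sv_long Z (Real.exp (L+Y)) (Real.one_le_exp hL0.le) (Real.exp_le_exp.2 (by linarith))
  have eY : Real.log (Real.exp (L+Y) / Z) = Y := by rw [hZ, ← Real.exp_sub, Real.log_exp]; ring
  rw [eY] at hlongS
  have hlong := compare hlongS (by linarith) (by positivity) v Y (4*Y) hv0 (by linarith) (by linarith) (fun n hn => by
    obtain ⟨a1, a2, a3⟩ := mem_exp_Ioc L (L+Y) hL0.le n hn
    rw [hv]; linarith)
  have hup := long_upper L Y v Y hL0.le (by linarith) (by linarith) (by rw [hv]; nlinarith)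
  have hlo := long_lower C hC hnp L Y v Y hL0.le (by linarith) (by linarith) hYL (by rw [hv]; nlinarith)
  -- interval
  have hintS := Sv_interval Z H (Real.one_le_exp hL0.le) hH0.le
  have hIntg := compare hintS hH0.le (by norm_num) v Y (4*Y) hv0 (by linarith) (by linarith) (fun n hn => by
    have hn1 := (hintS.1 n hn)
    have hn2 : (n:ℝ) ≤ Z + H := (Nat.le_floor_iff (by positivity)).1 (mem_Ioc.1 hn).2
    have : Real.log n ≤ Real.log (2 * Z) := Real.log_le_log (by exact_mod_cast hn1) (by linarith)
    rw [Real.log_mul (by norm_num) hZ0.ne', hZ, Real.log_exp] at this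
    have := Real.log_two_lt_d9
    rw [hv]; linarith)
  simp only [one_mul] at hIntg
  set D := Y * Y with hD
  have hD0 : 0 < D := by positivity
  -- error bounds
  have hDE : ∀ e : ℝ, 0 ≤ e → e ≤ E → L^2 * e ≤ Y := fun e he1 he2 => by
    have : L * e ≤ δ := le_trans (mul_le_mul_of_nonneg_left he2 hL0.le) hsm
    have h := mul_le_mul_of_nonneg_left this hL0.le
    rw [hY]; linarith
  have herr_int : Real.exp v * v^2 * (Real.exp Y * Y) + 2 * (4*Y) * (144 * (1 + 4*Y) * H + (Real.exp (4*Y) * (4*Y))^2)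
      ≤ 6000 * D * H := by
    have a1 : Real.exp v * v^2 * (Real.exp Y * Y) ≤ D * H := by
      calc _ = (Real.exp v * Real.exp Y) * (v^2 * Y) := by ring
        _ = Z * E^2 * (v^2 * Y) := by rw [hvv]
        _ ≤ Z * E^2 * (L^2 * Y) := by gcongr
        _ = (Z * E) * ((L^2 * E) * Y) := by ring
        _ ≤ H * (Y * Y) := by
          gcongr
          exact hDE E hE0.le le_rfl
        _ = _ := by rw [hD]; ring
    have a2 : 2 * (4*Y) * (144 * (1 + 4*Y) * H) ≤ 5760 * D * H := by
      have : Y * (1+4*Y) ≤ 5 * D := by rw [hD]; nlinarith only [hY14]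
      calc _ = 1152 * (Y * (1+4*Y)) * H := by ring
        _ ≤ 1152 * (5 * D) * H := by gcongr
        _ = _ := by ring
    have a3 : 2 * (4*Y) * (Real.exp (4*Y) * (4*Y))^2 ≤ 128 * D * H := by
      calc _ = 128 * (Real.exp (4*Y)^2 * (Y * Y * Y)) := by ring
        _ ≤ 128 * (Z * E^2 * (L * L * Y)) := by gcongr
        _ = 128 * ((Z * E) * ((L^2 * E) * Y)) := by ring
        _ ≤ 128 * (H * (Y * Y)) := by
          gcongr
          exact hDE E hE0.le le_rfl
        _ = _ := by rw [hD]; ring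
    have : 0 < D * H := by positivity
    linarith
  have hE1 : E ≤ 1 := Real.exp_le_one_iff.2 (by linarith)
  have herr_long : 4/Z * (Real.exp v * v^2 * (Real.exp Y * Y)) + 2 * (4*Y) * (144 * (1 + 4*Y) * Y + 4/Z * (Real.exp (4*Y) * (4*Y))^2)
      ≤ 7000 * D * Y := by
    have a1 : 4/Z * (Real.exp v * v^2 * (Real.exp Y * Y)) ≤ 4 * D := by
      calc _ = 4/Z * (Real.exp v * Real.exp Y) * (v^2 * Y) := by ring
        _ = 4/Z * (Z * E^2) * (v^2 * Y) := by rw [hvv]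
        _ = 4 * E^2 * (v^2 * Y) := by field_simp
        _ ≤ 4 * E^2 * (L^2 * Y) := by gcongr
        _ = 4 * ((L^2 * (E*E)) * Y) := by ring
        _ ≤ 4 * (Y * Y) := by
          gcongr
          exact hDE _ (by positivity) (by nlinarith)
        _ = _ := by rw [hD]
    have a2 : 2 * (4*Y) * (144 * (1 + 4*Y) * Y) ≤ 5760 * D * Y := by
      have : Y * (1+4*Y) ≤ 5 * D := by rw [hD]; nlinarith only [hY14]
      have hY0 : 0 ≤ Y := by linarith
      calc _ = 1152 * (Y * (1+4*Y)) * Y := by ring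
        _ ≤ 1152 * (5 * D) * Y := by gcongr
        _ = _ := by ring
    have a3 : 2 * (4*Y) * (4/Z * (Real.exp (4*Y) * (4*Y))^2) ≤ 512 * D := by
      calc _ = 512/Z * (Real.exp (4*Y)^2 * (Y * Y * Y)) := by ring
        _ ≤ 512/Z * (Z * E^2 * (L * L * Y)) := by gcongr
        _ = 512 * ((L^2 * (E * E)) * Y) := by field_simp
        _ ≤ 512 * (Y * Y) := by
          gcongr
          exact hDE _ (by positivity) (by nlinarith)
        _ = _ := by rw [hD]
    have : D * 14 ≤ D * Y := by gcongr
    linarith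
  have hlong' := hlong.trans herr_long
  have hIntg' := hIntg.trans herr_int
  -- evaluation of long sum
  set SL := ∑ n ∈ Ioc ⌊Z⌋₊ ⌊Real.exp (L+Y)⌋₊, 1/(n:ℝ) * (FF v n * TT Y n) with hSL
  have b1 : 1 ≤ D := by rw [hD]; nlinarith only [hY14]
  have b2 : L ≤ D := by
    have : D = L * (δ * Y) := by rw [hD, hY]; ring
    rw [this]; nlinarith only [hδY, hL0]
  have b3 : Y ≤ D := by rw [hD]; nlinarith only [hY14]
  have b4 : Y * Y = D := by rw [hD]
  have b5 : C * L ≤ C * D := by gcongr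
  have b6 : C * Y ≤ C * D := by gcongr
  have b7 : C ≤ C * D := by nlinarith only [b1, hC]
  have hev : |SL - 2 * L * Y * Y| ≤ (400 + 40 * C) * D * Y := by
    have u1 : (Y + 14) * (L + Y + 7) + (2 * v - L) * (Y + 14) ≤ 2 * L * Y + (400 + 40 * C) * D := by
      have : (2 * v - L) * (Y + 14) ≤ L * (Y + 14) := by
        gcongr; linarith
      have : 0 ≤ C * D := by positivity
      linarith
    have u2 : 2 * L * Y - (400 + 40 * C) * D ≤ (Y - 14) * (L - 7) - 2 * ((Y + 14) * (Y + 7 + C)) + (2 * v - L - Y) * (Y - 14 - C) := by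
      have e1 : (2 * v - L - Y) * (Y - 14 - C) = L * Y - 7 * (Y * Y) - (2 * v - L - Y) * (14 + C) := by
        rw [hv, hY]; ring
      have e2 : (2 * v - L - Y) * (14 + C) ≤ L * (14 + C) := by
        gcongr; linarith
      rw [e1]
      have : 0 ≤ C * D := by positivity
      linarith
    rw [abs_le]
    constructor
    · have := (mul_le_mul_of_nonneg_left u2 (show 0 ≤ Y by linarith)).trans hlo
      linarith
    · have := hup.trans (mul_le_mul_of_nonneg_left u1 (show 0 ≤ Y by linarith))
      linarith
  have hM : |MM v Y - 2 * L * Y| ≤ (7400 + 40 * C) * D := by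
    have hY0 : 0 < Y := by linarith
    have : |Y * (MM v Y - 2 * L * Y)| ≤ Y * ((7400 + 40 * C) * D) := by
      have e : Y * (MM v Y - 2 * L * Y) = -(SL - Y * MM v Y) + (SL - 2 * L * Y * Y) := by ring
      rw [e]
      refine (abs_add_le _ _).trans ?_
      rw [abs_neg]; linarith
    rw [abs_mul, abs_of_pos hY0] at this
    exact le_of_mul_le_mul_left this hY0
  set SI := ∑ n ∈ Ioc ⌊Z⌋₊ ⌊Z+H⌋₊, FF v n * TT Y n with hSI
  have e : SI - 2 * L * Y * H = (SI - H * MM v Y) + H * (MM v Y - 2 * L * Y) := by ring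
  rw [e]
  refine (abs_add_le _ _).trans ?_
  rw [abs_mul, abs_of_pos hH0]
  have f1 := mul_le_mul_of_nonneg_left hM hH0.le
  have f2 : 0 ≤ C * D * H := by positivity
  have f3 : 0 ≤ D * H := by positivity
  have f4 : (20000 + 100 * C) * δ * L * Y * H = (20000 + 100 * C) * D * H := by rw [hD]; ring
  rw [f4]
  linarith
end HH

namespace HH
open Finset ArithmeticFunction
open scoped ArithmeticFunction.Moebius ArithmeticFunction.zeta

lemma np_short (δ : ℝ) (hδ : 0 < δ) (hδ1 : δ ≤ 1/20) (L : ℝ) (hL : 14/δ^3 ≤ L)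
    (H : ℝ) (hH1 : Real.exp ((1-δ)*L) ≤ H) (hH2 : H ≤ Real.exp L) :
    ∑ n ∈ Ioc ⌊Real.exp L⌋₊ ⌊Real.exp L + H⌋₊, (if n.Prime then 0 else Λ n) ≤ δ * H := by
  have h3 : 0 < δ^3 := by positivity
  have hL0 : 0 < L := lt_of_lt_of_le (by positivity) hL
  have h14 : 14 ≤ L * δ^3 := by rwa [div_le_iff₀ h3] at hL
  have hsm := exp_small δ L hδ hL
  set E := Real.exp (-(δ*L)) with hE
  have hE0 : 0 < E := Real.exp_pos _
  have hLbig : 14 ≤ L := by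
    have : δ^3 ≤ 1 := pow_le_one₀ hδ.le (by linarith)
    nlinarith
  have hEs : E ≤ 1/14 := by
    have : 14 * E ≤ L * E := by gcongr
    linarith
  set Z := Real.exp L with hZ
  have hZ0 : 0 < Z := Real.exp_pos _
  have hZ1 : 1 ≤ Z := Real.one_le_exp hL0.le
  have hHE : Z * E ≤ H := by
    refine le_trans (le_of_eq ?_) hH1
    rw [hZ, hE, ← Real.exp_add]; congr 1; ring
  have hH0 : 0 < H := lt_of_lt_of_le (by positivity) hHE
  have h1 : ∑ n ∈ Ioc ⌊Z⌋₊ ⌊Z + H⌋₊, (if n.Prime then 0 else Λ n) ≤ Chebyshev.psi (Z+H) - Chebyshev.theta (Z+H) := by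
    rw [Chebyshev.psi_sub_theta_eq_sum_not_prime, sum_filter]
    refine (sum_le_sum_of_subset_of_nonneg (Ioc_subset_Ioc_left (Nat.zero_le _)) ?_).trans (le_of_eq ?_)
    · intro n _ _; split_ifs
      · exact le_rfl
      · exact vonMangoldt_nonneg
    · exact sum_congr rfl fun n _ => by split_ifs <;> rfl
  have h2 := Chebyshev.psi_sub_theta_le (show 1 ≤ Z + H by linarith)
  have h4 : Real.sqrt (Z+H) ≤ 2 * Real.exp (L/2) := by
    rw [Real.sqrt_le_left (by positivity)]
    rw [mul_pow, ← Real.exp_nat_mul]; push_cast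
    rw [mul_div_cancel₀ L two_ne_zero]; linarith
  have h5 : Real.log (Z+H) ≤ 2 * L := by
    have : Real.log (Z+H) ≤ Real.log (2 * Z) := Real.log_le_log (by positivity) (by linarith)
    rw [Real.log_mul (by norm_num) hZ0.ne', hZ, Real.log_exp] at this
    have := Real.log_two_lt_d9
    linarith
  have h6 : Real.exp (L/2) ≤ Z * E^3 := by
    rw [hZ, hE, ← Real.exp_nat_mul, ← Real.exp_add]
    refine Real.exp_le_exp.2 ?_
    push_cast; nlinarith
  have h7 : 0 ≤ Real.log (Z+H) := Real.log_nonneg (by linarith)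
  calc _ ≤ 2 * Real.sqrt (Z+H) * Real.log (Z+H) := h1.trans h2
    _ ≤ 2 * (2 * (Z * E^3)) * (2 * L) := by
      gcongr
      exact h4.trans (by linarith)
    _ = (Z * E) * ((L * E) * (8 * E)) := by ring
    _ ≤ H * (δ * 1) := by
      gcongr
      linarith
    _ = _ := by ring

theorem short_ab : ∃ C1 : ℝ, 0 < C1 ∧ ∀ δ : ℝ, 0 < δ → δ ≤ 1/20 → ∀ L : ℝ, 14/δ^3 ≤ L →
    ∀ H : ℝ, Real.exp ((1-δ)*L) ≤ H → H ≤ Real.exp L →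
    ∑ n ∈ Ioc ⌊Real.exp L⌋₊ ⌊Real.exp L + H⌋₊, Λ n ≤ (2 + C1 * δ) * H ∧
    (2 - C1 * δ) * L * H ≤ ∑ n ∈ Ioc ⌊Real.exp L⌋₊ ⌊Real.exp L + H⌋₊, (Λ n * Real.log n + (Λ * Λ) n) := by
  obtain ⟨C0, hC0, hmain⟩ := selberg_short
  refine ⟨2 * C0 + 29, by positivity, fun δ hδ hδ1 L hL H hH1 hH2 => ?_⟩
  have hnp := np_short δ hδ hδ1 L hL H hH1 hH2
  have hm := abs_le.1 (hmain δ hδ hδ1 L hL H hH1 hH2)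
  have h3 : 0 < δ^3 := by positivity
  have hL0 : 0 < L := lt_of_lt_of_le (by positivity) hL
  have h14 : 14 ≤ L * δ^3 := by rwa [div_le_iff₀ h3] at hL
  have hY14 : 14 ≤ δ * L := by
    have : δ^2 ≤ 1 := by nlinarith
    nlinarith [mul_pos hδ hL0]
  have hH0 : 0 < H := lt_of_lt_of_le (Real.exp_pos _) hH1
  set s := Ioc ⌊Real.exp L⌋₊ ⌊Real.exp L + H⌋₊ with hs
  have hmem : ∀ n ∈ s, 2 ≤ n ∧ L ≤ Real.log n ∧ Real.log n ≤ (1+δ)*L := by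
    intro n hn
    rw [hs, mem_Ioc] at hn
    have h1 : 1 ≤ ⌊Real.exp L⌋₊ := Nat.floor_pos.2 (Real.one_le_exp hL0.le)
    have hn0 : (0:ℝ) < n := by exact_mod_cast (by omega : 0 < n)
    refine ⟨by omega, ?_, ?_⟩
    · rw [Real.le_log_iff_exp_le hn0]; exact (Nat.lt_of_floor_lt hn.1).le
    · have h2 : (n:ℝ) ≤ Real.exp L + H := (Nat.le_floor_iff (by positivity)).1 hn.2
      have : Real.log n ≤ Real.log (2 * Real.exp L) := Real.log_le_log hn0 (by linarith)
      rw [Real.log_mul (by norm_num) (Real.exp_pos L).ne', Real.log_exp] at this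
      have := Real.log_two_lt_d9
      linarith
  have hLam := fun k => vonMangoldt_nonneg (n := k)
  set v := (1-3*δ)*L with hv
  set Y := δ * L with hY
  have hY0 : 0 < Y := by linarith
  have hv2 : ∀ n ∈ s, Real.log n ≤ 2 * v := fun n hn => by
    have := (hmem n hn).2.2
    rw [hv]; nlinarith
  constructor
  · have hp : ∑ n ∈ s, (if n.Prime then Λ n else 0) * ((1 - 7*δ) * L * Y) ≤ ∑ n ∈ s, FF v n * TT Y n := by
      refine sum_le_sum fun n hn => ?_
      obtain ⟨a1, a2, a3⟩ := hmem n hn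
      split_ifs with hpr
      · rw [TT_eq_self Y hY0.le n (by omega) (fun p hp => ?_), FF_eq v n a1, ← mul_assoc]
        · refine mul_le_mul_of_nonneg_right ?_ hY0.le
          have := vm2_nonneg n
          have h1 : Λ n * ((1 - 7*δ) * L) ≤ Λ n * (2 * v - Real.log n) :=
            mul_le_mul_of_nonneg_left (by rw [hv]; linarith) (hLam n)
          linarith
        · rw [Nat.Prime.primeFactors hpr, mem_singleton] at hp
          rw [hp]; rw [hY]; nlinarith
      · rw [zero_mul]; exact (FFTT_bounds v Y hY0.le n a1 (hv2 n hn)).1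
    rw [← sum_mul] at hp
    have hsplit : ∑ n ∈ s, Λ n = ∑ n ∈ s, (if n.Prime then Λ n else 0) + ∑ n ∈ s, (if n.Prime then 0 else Λ n) := by
      rw [← sum_add_distrib]; exact sum_congr rfl fun n _ => by split_ifs <;> simp
    set P := ∑ n ∈ s, (if n.Prime then Λ n else 0) with hP
    have hP0 : 0 ≤ P := sum_nonneg fun n _ => by split_ifs <;> simp [hLam]
    have h1 : P * (1 - 7*δ) ≤ (2 + C0 * δ) * H := by
      have : (P * (1 - 7*δ)) * (L * Y) ≤ ((2 + C0 * δ) * H) * (L * Y) := by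
        calc _ = P * ((1 - 7*δ) * L * Y) := by ring
          _ ≤ _ := hp
          _ ≤ 2 * L * Y * H + C0 * δ * L * Y * H := by linarith [hm.2]
          _ = _ := by ring
      exact le_of_mul_le_mul_right this (by positivity)
    have h2 : P ≤ P * (1 - 7*δ) * (1 + 14 * δ) := by
      have : 1 ≤ (1 - 7*δ) * (1+14*δ) := by nlinarith
      calc P = P * 1 := (mul_one P).symm
        _ ≤ P * ((1 - 7*δ) * (1+14*δ)) := by gcongr
        _ = _ := by ring
    have h4 : P ≤ (2 + C0 * δ) * H * (1 + 14 * δ) := h2.trans (by gcongr)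
    have h5 : (2 + C0 * δ) * (1 + 14 * δ) ≤ 2 + (2 * C0 + 28) * δ := by nlinarith [mul_pos hC0 hδ]
    have h6 := mul_le_mul_of_nonneg_right h5 hH0.le
    rw [hsplit]; linarith
  · have hp : ∑ n ∈ s, FF v n * TT Y n ≤ ∑ n ∈ s, (Λ n * Real.log n + (Λ * Λ) n) * Y := by
      refine sum_le_sum fun n hn => ?_
      obtain ⟨a1, a2, a3⟩ := hmem n hn
      refine (FFTT_bounds v Y hY0.le n a1 (hv2 n hn)).2.trans ?_
      refine mul_le_mul_of_nonneg_right ?_ hY0.le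
      rw [FF_eq v n a1]
      have h1 : Λ n * (2 * v - Real.log n) ≤ Λ n * Real.log n :=
        mul_le_mul_of_nonneg_left (by rw [hv]; nlinarith) (hLam n)
      linarith
    rw [← sum_mul] at hp
    have h1 : ((2 - C0 * δ) * L * H) * Y ≤ (∑ n ∈ s, (Λ n * Real.log n + (Λ * Λ) n)) * Y := by
      refine le_trans ?_ hp
      have := hm.1
      linarith
    have h2 := le_of_mul_le_mul_right h1 hY0
    refine le_trans ?_ h2
    gcongr
    linarith
end HH

namespace HH
open Finset ArithmeticFunction
open scoped ArithmeticFunction.Moebius ArithmeticFunction.zeta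

/-- Mertens at grid points -/
noncomputable def Pm (η : ℝ) (k : ℕ) : ℝ := mm (Real.exp (k * η))
/-- normalised bin sums -/
noncomputable def aa (η : ℝ) (j : ℕ) : ℝ := (Pm η (j+1) - Pm η j) / η

lemma mm_one : mm 1 = 0 := by simp [mm]

lemma Pm_zero (η : ℝ) : Pm η 0 = 0 := by simp [Pm, mm_one]

lemma Pm_mono (η : ℝ) (hη : 0 < η) (k l : ℕ) (h : k ≤ l) : Pm η k ≤ Pm η l := by
  refine mm_mono _ _ (Real.exp_le_exp.2 ?_)
  have : (k:ℝ) ≤ l := by exact_mod_cast h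
  gcongr

lemma aa_nonneg (η : ℝ) (hη : 0 < η) (j : ℕ) : 0 ≤ aa η j :=
  div_nonneg (by linarith [Pm_mono η hη j (j+1) (by omega)]) hη.le

lemma eta_aa (η : ℝ) (hη : 0 < η) (j : ℕ) : η * aa η j = Pm η (j+1) - Pm η j := by
  unfold aa; field_simp

lemma sum_aa (η : ℝ) (hη : 0 < η) (k m : ℕ) : η * ∑ i ∈ range m, aa η (k+i) = Pm η (k+m) - Pm η k := by
  rw [mul_sum]
  induction m with
  | zero => simp
  | succ m ih => rw [sum_range_succ, ih, eta_aa η hη]; ring_nf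

lemma sum_aa0 (η : ℝ) (hη : 0 < η) (m : ℕ) : η * ∑ i ∈ range m, aa η i = Pm η m := by
  have := sum_aa η hη 0 m
  simpa [Pm_zero] using this

lemma Pm_up (η : ℝ) (hη : 0 < η) (k : ℕ) : Pm η k ≤ k * η + 7 := mm_exp_up _ (by positivity)
lemma Pm_lo (η : ℝ) (hη : 0 < η) (k : ℕ) : k * η - 7 ≤ Pm η k := mm_exp_lo _ (by positivity)

lemma bin_sum (η : ℝ) (hη : 0 < η) (j : ℕ) :
    ∑ n ∈ Ioc ⌊Real.exp (j*η)⌋₊ ⌊Real.exp ((j+1 : ℕ)*η)⌋₊, Λ n / n = η * aa η j := by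
  rw [eta_aa η hη]
  have := sum_lam_long (j*η) η hη.le
  rw [show (j:ℝ)*η + η = ((j+1:ℕ):ℝ)*η by push_cast; ring] at this
  exact this

lemma floor_grid_mono (η : ℝ) (hη : 0 < η) (k l : ℕ) (h : k ≤ l) : ⌊Real.exp (k*η)⌋₊ ≤ ⌊Real.exp (l*η)⌋₊ := by
  have : (k:ℝ) ≤ l := by exact_mod_cast h
  exact Nat.floor_le_floor (Real.exp_le_exp.2 (by gcongr))

lemma bins_decomp (η : ℝ) (hη : 0 < η) (f : ℕ → ℝ) (K : ℕ) :
    ∑ n ∈ Ioc 1 ⌊Real.exp (K*η)⌋₊, f n = ∑ j ∈ range K, ∑ n ∈ Ioc ⌊Real.exp (j*η)⌋₊ ⌊Real.exp ((j+1 : ℕ)*η)⌋₊, f n := by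
  induction K with
  | zero => simp
  | succ K ih =>
    rw [sum_range_succ, ← ih]
    refine (sum_Ioc_consecutive f ?_ (floor_grid_mono η hη K (K+1) (by omega))).symm
    exact Nat.floor_pos.2 (Real.one_le_exp (by positivity))

lemma conv_bins1 (η : ℝ) (hη : 0 < η) (J B : ℕ) :
    ∑ n ∈ Ioc ⌊Real.exp (J*η)⌋₊ ⌊Real.exp ((J+B : ℕ)*η)⌋₊, 1/(n:ℝ) * (Λ * Λ) n ≤
      ∑ j ∈ range (J+B), η * aa η j * (Pm η (J+B-j) - Pm η (J-1-j)) := by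
  simp_rw [ArithmeticFunction.mul_apply]
  have hle : Real.exp (J*η) ≤ Real.exp ((J+B : ℕ)*η) := Real.exp_le_exp.2 (by
    push_cast; have : 0 ≤ (B:ℝ)*η := by positivity
    linarith)
  rw [conv_sum (fun a => Λ a) (fun a => Λ a) _ _ hle]
  have h1 : 1 ≤ ⌊Real.exp ((J+B : ℕ)*η)⌋₊ := Nat.floor_pos.2 (Real.one_le_exp (by positivity))
  rw [← sum_Ioc_consecutive _ (Nat.zero_le 1) h1]
  have h2 : ∑ a ∈ Ioc 0 1, Λ a / a * (∑ b ∈ Ioc 0 ⌊Real.exp ((J+B : ℕ)*η)/a⌋₊, Λ b / b - ∑ b ∈ Ioc 0 ⌊Real.exp (J*η)/a⌋₊, Λ b / b) = 0 := by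
    simp
  rw [h2, zero_add, bins_decomp η hη]
  refine sum_le_sum fun j hj => ?_
  rw [mem_range] at hj
  rw [← bin_sum η hη, sum_mul]
  refine sum_le_sum fun a ha => ?_
  refine mul_le_mul_of_nonneg_left ?_ (div_nonneg vonMangoldt_nonneg (by positivity))
  obtain ⟨a1, a2, a3⟩ := mem_exp_Ioc (j*η) ((j+1:ℕ)*η) (by positivity) a ha
  have ha0 : (0:ℝ) < a := by exact_mod_cast (by omega : 0 < a)
  have ea : (a:ℝ) = Real.exp (Real.log a) := (Real.exp_log ha0).symm
  have u1 : mm (Real.exp ((J+B : ℕ)*η)/a) ≤ Pm η (J+B-j) := by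
    refine mm_mono _ _ ?_
    rw [ea, ← Real.exp_sub]
    refine Real.exp_le_exp.2 ?_
    rw [Nat.cast_sub hj.le]; linarith
  have u2 : Pm η (J-1-j) ≤ mm (Real.exp (J*η)/a) := by
    rcases Nat.lt_or_ge j (J-1) with h | h
    · refine mm_mono _ _ ?_
      rw [ea, ← Real.exp_sub]
      refine Real.exp_le_exp.2 ?_
      rw [Nat.sub_sub, Nat.cast_sub (by omega)]; push_cast at a3 ⊢; linarith
    · rw [show J-1-j = 0 by omega, Pm_zero]; exact mm_nonneg _
  change mm (Real.exp ((J+B : ℕ)*η)/a) - mm (Real.exp (J*η)/a) ≤ _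
  linarith

/-- truncated bins -/
noncomputable def att (η : ℝ) (j0 j : ℕ) : ℝ := if j < j0 then 1 else aa η j
/-- bins below `j0` -/
noncomputable def ab (η : ℝ) (j0 j : ℕ) : ℝ := if j < j0 then aa η j else 0

lemma at_nonneg (η : ℝ) (hη : 0 < η) (j0 j : ℕ) : 0 ≤ att η j0 j := by
  unfold att; split_ifs
  · norm_num
  · exact aa_nonneg η hη j
lemma ab_nonneg (η : ℝ) (hη : 0 < η) (j0 j : ℕ) : 0 ≤ ab η j0 j := by
  unfold ab; split_ifs
  · exact aa_nonneg η hη j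
  · norm_num
lemma aa_le (η : ℝ) (j0 j : ℕ) : aa η j ≤ att η j0 j + ab η j0 j := by
  unfold att ab; split_ifs <;> linarith

lemma sum_ab (η : ℝ) (hη : 0 < η) (j0 : ℕ) (s : Finset ℕ) : η * ∑ l ∈ s, ab η j0 l ≤ j0 * η + 7 := by
  refine le_trans ?_ (Pm_up η hη j0)
  rw [← sum_aa0 η hη]
  refine mul_le_mul_of_nonneg_left ?_ hη.le
  unfold ab
  rw [← sum_filter]
  refine sum_le_sum_of_subset_of_nonneg ?_ fun i _ _ => aa_nonneg η hη i
  intro i hi; rw [mem_filter] at hi; exact mem_range.2 hi.2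

set_option maxHeartbeats 1000000 in
lemma conv_bins (η : ℝ) (hη : 0 < η) (j0 J B : ℕ) (h3 : ∀ l, j0 ≤ l → aa η l ≤ 3) (hJ : 2 * j0 + 1 ≤ J) (hB : 1 ≤ B) :
    ∑ n ∈ Ioc ⌊Real.exp (J*η)⌋₊ ⌊Real.exp ((J+B : ℕ)*η)⌋₊, 1/(n:ℝ) * (Λ * Λ) n ≤
      η^2 * B * ∑ j ∈ range J, att η j0 j * avg B (att η j0) (J-j)
      + 9 * B * η * (j0 * η + 7) + 3 * η * (J * η + 7) + 3 * B * η * (B * η + 7) := by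
  have hB0 : (0:ℝ) < B := by exact_mod_cast hB
  have hB1 : (1:ℝ) ≤ B := by exact_mod_cast hB
  refine (conv_bins1 η hη J B).trans ?_
  have hJ0 : j0 ≤ J := by omega
  rw [sum_range_add]
  have ha := aa_nonneg η hη
  -- last part
  have p3 : ∑ x ∈ range B, η * aa η (J+x) * (Pm η (J+B-(J+x)) - Pm η (J-1-(J+x))) ≤ 3 * B * η * (B * η + 7) := by
    calc _ ≤ ∑ x ∈ range B, η * 3 * (B * η + 7) := by
          refine sum_le_sum fun x hx => ?_
          have e1 := h3 (J+x) (by omega)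
          have e2 : Pm η (J+B-(J+x)) - Pm η (J-1-(J+x)) ≤ B * η + 7 := by
            rw [show J-1-(J+x) = 0 by omega, Pm_zero, sub_zero]
            exact (Pm_mono η hη _ B (by omega)).trans (Pm_up η hη B)
          have e3 := ha (J+x)
          calc _ ≤ η * aa η (J+x) * (B * η + 7) := mul_le_mul_of_nonneg_left e2 (by positivity)
            _ ≤ _ := by gcongr
      _ = _ := by simp; ring
  -- split first part
  have hsp : ∑ j ∈ range J, η * aa η j * (Pm η (J+B-j) - Pm η (J-1-j)) =
      ∑ j ∈ range J, (if j < j0 then η * aa η j * (Pm η (J+B-j) - Pm η (J-1-j)) else 0)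
      + ∑ j ∈ range J, (if j < j0 then 0 else η * aa η j * (Pm η (J+B-j) - Pm η (J-1-j))) := by
    rw [← sum_add_distrib]; exact sum_congr rfl fun j _ => by split_ifs <;> simp
  have hdiff : ∀ j ∈ range J, Pm η (J+B-j) - Pm η (J-1-j) = η * (aa η (J-1-j) + ∑ i ∈ range B, aa η (J-j+i)) := by
    intro j hj
    rw [mem_range] at hj
    rw [mul_add, sum_aa η hη, eta_aa η hη, show J-1-j+1 = J-j by omega, show J-j+B = J+B-j by omega]; ring
  have p1 : ∑ j ∈ range J, (if j < j0 then η * aa η j * (Pm η (J+B-j) - Pm η (J-1-j)) else 0)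
      ≤ 6 * B * η * (j0 * η + 7) := by
    calc _ ≤ ∑ j ∈ range J, 6 * B * η * (η * ab η j0 j) := by
          refine sum_le_sum fun j hj => ?_
          unfold ab
          split_ifs with h
          · rw [hdiff j hj]
            have e1 : aa η (J-1-j) + ∑ i ∈ range B, aa η (J-j+i) ≤ 6 * B := by
              have := h3 (J-1-j) (by omega)
              have : ∑ i ∈ range B, aa η (J-j+i) ≤ ∑ i ∈ range B, (3:ℝ) := sum_le_sum fun i _ => h3 _ (by omega)
              simp at this; linarith
            calc _ ≤ η * aa η j * (η * (6 * B)) := by have := ha j; gcongr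
              _ = _ := by ring
          · simp
      _ = 6 * B * η * (η * ∑ j ∈ range J, ab η j0 j) := by rw [mul_sum, mul_sum]
      _ ≤ _ := by gcongr; exact sum_ab η hη j0 _
  have p2 : ∑ j ∈ range J, (if j < j0 then 0 else η * aa η j * (Pm η (J+B-j) - Pm η (J-1-j)))
      ≤ η^2 * B * ∑ j ∈ range J, att η j0 j * avg B (att η j0) (J-j) + 3 * η * (J * η + 7) + 3 * B * η * (j0 * η + 7) := by
    calc _ ≤ ∑ j ∈ range J, (η^2 * B * (att η j0 j * avg B (att η j0) (J-j)) + 3 * η * (η * aa η (J-1-j))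
            + 3 * η * (η * ∑ i ∈ range B, ab η j0 (J-j+i))) := by
          refine sum_le_sum fun j hj => ?_
          have hav : (B:ℝ) * avg B (att η j0) (J-j) = ∑ i ∈ range B, att η j0 (J-j+i) := by
            unfold avg; field_simp
          have e2 : 0 ≤ aa η (J-1-j) := ha _
          have e3 : 0 ≤ ∑ i ∈ range B, ab η j0 (J-j+i) := sum_nonneg fun i _ => ab_nonneg η hη _ _
          have e4 : 0 ≤ ∑ i ∈ range B, att η j0 (J-j+i) := sum_nonneg fun i _ => at_nonneg η hη _ _
          have e0 : η^2 * B * (att η j0 j * avg B (att η j0) (J-j)) = η^2 * att η j0 j * ∑ i ∈ range B, att η j0 (J-j+i) := by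
            rw [← hav]; ring
          rw [e0]
          split_ifs with h
          · have := at_nonneg η hη j0 j
            positivity
          · have e5 : att η j0 j = aa η j := by unfold att; rw [if_neg h]
            rw [hdiff j hj, e5]
            have e6 : ∑ i ∈ range B, aa η (J-j+i) ≤ ∑ i ∈ range B, att η j0 (J-j+i) + ∑ i ∈ range B, ab η j0 (J-j+i) := by
              rw [← sum_add_distrib]; exact sum_le_sum fun i _ => aa_le _ _ _
            have e7 : aa η j ≤ 3 := h3 j (by omega)
            have e8 := ha j
            calc _ ≤ η * aa η j * (η * (aa η (J-1-j) + (∑ i ∈ range B, att η j0 (J-j+i) + ∑ i ∈ range B, ab η j0 (J-j+i)))) := by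
                  gcongr
              _ = η^2 * aa η j * ∑ i ∈ range B, att η j0 (J-j+i) + aa η j * (η * (η * aa η (J-1-j)))
                  + aa η j * (η * (η * ∑ i ∈ range B, ab η j0 (J-j+i))) := by ring
              _ ≤ η^2 * aa η j * ∑ i ∈ range B, att η j0 (J-j+i) + 3 * (η * (η * aa η (J-1-j)))
                  + 3 * (η * (η * ∑ i ∈ range B, ab η j0 (J-j+i))) := by gcongr
              _ = _ := by ring
      _ = η^2 * B * ∑ j ∈ range J, att η j0 j * avg B (att η j0) (J-j) + 3 * η * (η * ∑ j ∈ range J, aa η (J-1-j))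
            + 3 * η * ∑ i ∈ range B, (η * ∑ j ∈ range J, ab η j0 (J-j+i)) := by
          rw [sum_add_distrib, sum_add_distrib, mul_sum, mul_sum, mul_sum, ← mul_sum, ← mul_sum, ← mul_sum]
          congr 1
          simp only [mul_sum]
          rw [sum_comm]
      _ ≤ _ := by
          have q1 : η * ∑ j ∈ range J, aa η (J-1-j) ≤ J * η + 7 := by
            rw [sum_range_reflect, sum_aa0 η hη]; exact Pm_up η hη J
          have q2 : ∑ i ∈ range B, (η * ∑ j ∈ range J, ab η j0 (J-j+i)) ≤ B * (j0 * η + 7) := by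
            calc _ ≤ ∑ i ∈ range B, (j0 * η + 7) := by
                  refine sum_le_sum fun i _ => ?_
                  have : ∑ j ∈ range J, ab η j0 (J-j+i) = ∑ l ∈ (range J).image (fun j => J-j+i), ab η j0 l := by
                    rw [sum_image]
                    intro x hx y hy hxy
                    simp at hx hy hxy; omega
                  rw [this]; exact sum_ab η hη j0 _
              _ = _ := by simp; ring
          have q3 : 0 ≤ 3 * η := by positivity
          have := mul_le_mul_of_nonneg_left q1 q3
          have := mul_le_mul_of_nonneg_left q2 q3
          linarith
  rw [hsp]
  linarith
end HH

namespace HH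
open Finset ArithmeticFunction
open scoped ArithmeticFunction.Moebius ArithmeticFunction.zeta

lemma win_up (L Y : ℝ) (hL : 0 ≤ L) (f : ℕ → ℝ) (hf : ∀ n, 0 ≤ f n) :
    ∑ n ∈ Ioc ⌊Real.exp L⌋₊ ⌊Real.exp (L+Y)⌋₊, f n / n ≤ Real.exp (-L) * ∑ n ∈ Ioc ⌊Real.exp L⌋₊ ⌊Real.exp (L+Y)⌋₊, f n := by
  rw [mul_sum]
  refine sum_le_sum fun n hn => ?_
  obtain ⟨a1, a2, a3⟩ := mem_exp_Ioc L (L+Y) hL n hn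
  have ha0 : (0:ℝ) < n := by exact_mod_cast (by omega : 0 < n)
  have h : Real.exp L ≤ n := by rw [← Real.exp_log ha0]; exact Real.exp_le_exp.2 a2.le
  have : (n:ℝ)⁻¹ ≤ Real.exp (-L) := by rw [Real.exp_neg]; exact inv_anti₀ (Real.exp_pos _) h
  rw [div_eq_mul_inv, mul_comm]
  exact mul_le_mul_of_nonneg_right this (hf n)

lemma win_lo (L Y : ℝ) (hL : 0 ≤ L) (f : ℕ → ℝ) (hf : ∀ n, 0 ≤ f n) :
    Real.exp (-(L+Y)) * ∑ n ∈ Ioc ⌊Real.exp L⌋₊ ⌊Real.exp (L+Y)⌋₊, f n ≤ ∑ n ∈ Ioc ⌊Real.exp L⌋₊ ⌊Real.exp (L+Y)⌋₊, f n / n := by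
  rw [mul_sum]
  refine sum_le_sum fun n hn => ?_
  obtain ⟨a1, a2, a3⟩ := mem_exp_Ioc L (L+Y) hL n hn
  have ha0 : (0:ℝ) < n := by exact_mod_cast (by omega : 0 < n)
  have h : (n:ℝ) ≤ Real.exp (L+Y) := by rw [← Real.exp_log ha0]; exact Real.exp_le_exp.2 a3
  have : Real.exp (-(L+Y)) ≤ (n:ℝ)⁻¹ := by rw [Real.exp_neg]; exact inv_anti₀ ha0 h
  rw [div_eq_mul_inv, mul_comm (f n)]
  exact mul_le_mul_of_nonneg_right this (hf n)

lemma exp_sub_one_bounds (Y : ℝ) (h0 : 0 < Y) (h1 : Y ≤ 1/2) :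
    Y ≤ Real.exp Y - 1 ∧ Real.exp Y - 1 ≤ Y * (1 + Y) ∧ Real.exp Y - 1 ≤ 1 := by
  have a := Real.add_one_le_exp Y
  have b := Real.abs_exp_sub_one_sub_id_le (x := Y) (by rw [abs_of_pos h0]; linarith)
  have c := (abs_le.1 b).2
  refine ⟨by linarith, by nlinarith, by nlinarith⟩

/-- the two-sided Selberg type property, as a predicate -/
def ShortAB (C1 : ℝ) : Prop := ∀ δ : ℝ, 0 < δ → δ ≤ 1/20 → ∀ L : ℝ, 14/δ^3 ≤ L → ∀ H : ℝ,
  Real.exp ((1-δ)*L) ≤ H → H ≤ Real.exp L →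
   (∑ n ∈ Ioc ⌊Real.exp L⌋₊ ⌊Real.exp L + H⌋₊, Λ n ≤ (2+C1*δ)*H) ∧
   ((2-C1*δ)*L*H ≤ ∑ n ∈ Ioc ⌊Real.exp L⌋₊ ⌊Real.exp L + H⌋₊, (Λ n * Real.log n + (Λ*Λ) n))

lemma exists_shortAB : ∃ C1 : ℝ, 0 < C1 ∧ ShortAB C1 := by
  obtain ⟨C1, h1, h2⟩ := short_ab
  exact ⟨C1, h1, h2⟩

lemma H_ok (δ L Y : ℝ) (hY0 : 0 < Y) (hY : Y ≤ 1/2) (he : Real.exp (-(δ*L)) ≤ Y) :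
    Real.exp ((1-δ)*L) ≤ Real.exp L * (Real.exp Y - 1) ∧ Real.exp L * (Real.exp Y - 1) ≤ Real.exp L ∧
    Real.exp L + Real.exp L * (Real.exp Y - 1) = Real.exp (L+Y) := by
  obtain ⟨a, b, c⟩ := exp_sub_one_bounds Y hY0 hY
  have hp := Real.exp_pos L
  refine ⟨?_, by nlinarith, by rw [Real.exp_add]; ring⟩
  rw [show (1-δ)*L = L + (-(δ*L)) by ring, Real.exp_add]
  gcongr; linarith

lemma bin_up (C1 : ℝ) (hC : ShortAB C1) (δ : ℝ) (h0 : 0 < δ) (h1 : δ ≤ 1/20) (hCd : 0 ≤ C1*δ) (η : ℝ) (hη : 0 < η) (hη1 : η ≤ 1/2)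
    (j : ℕ) (hj : 14/δ^3 ≤ j*η) (he : Real.exp (-(δ*(j*η))) ≤ η) : aa η j ≤ (2+C1*δ)*(1+η) := by
  obtain ⟨a1, a2, a3⟩ := H_ok δ (j*η) η hη hη1 he
  have hA := (hC δ h0 h1 (j*η) hj _ a1 a2).1
  rw [a3] at hA
  have hb := bin_sum η hη j
  rw [show ((j+1:ℕ):ℝ)*η = (j:ℝ)*η + η by push_cast; ring] at hb
  have hw := win_up (j*η) η (by positivity) (fun n => Λ n) (fun n => vonMangoldt_nonneg)
  rw [hb] at hw
  have h2 := mul_le_mul_of_nonneg_left hA (Real.exp_pos (-(j*η))).le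
  have h3 : Real.exp (-(j*η)) * ((2+C1*δ)*(Real.exp (j*η) * (Real.exp η - 1))) = (2+C1*δ)*(Real.exp η - 1) := by
    rw [Real.exp_neg]; field_simp
  obtain ⟨b1, b2, b3⟩ := exp_sub_one_bounds η hη hη1
  have h4 : (2+C1*δ)*(Real.exp η - 1) ≤ (2+C1*δ)*(η*(1+η)) := by gcongr
  have : η * aa η j ≤ η * ((2+C1*δ)*(1+η)) := by
    calc _ ≤ _ := hw
      _ ≤ _ := h2
      _ = _ := h3
      _ ≤ _ := h4
      _ = _ := by ring
  exact le_of_mul_le_mul_left this hη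

lemma bin_np (δ : ℝ) (h0 : 0 < δ) (h1 : δ ≤ 1/20) (η : ℝ) (hη : 0 < η) (hη1 : η ≤ 1/2)
    (j : ℕ) (hj : 14/δ^3 ≤ j*η) (he : Real.exp (-(δ*(j*η))) ≤ η)
    (hnp : ∀ n ∈ Ioc ⌊Real.exp (j*η)⌋₊ ⌊Real.exp ((j+1 : ℕ)*η)⌋₊, ¬ n.Prime) : aa η j ≤ 2*δ := by
  obtain ⟨a1, a2, a3⟩ := H_ok δ (j*η) η hη hη1 he
  have hA := np_short δ h0 h1 (j*η) hj _ a1 a2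
  rw [a3] at hA
  have hb := bin_sum η hη j
  rw [show ((j+1:ℕ):ℝ)*η = (j:ℝ)*η + η by push_cast; ring] at hb hnp
  rw [sum_congr rfl fun n hn => if_neg (hnp n hn)] at hA
  have hw := win_up (j*η) η (by positivity) (fun n => Λ n) (fun n => vonMangoldt_nonneg)
  rw [hb] at hw
  have h2 := mul_le_mul_of_nonneg_left hA (Real.exp_pos (-(j*η))).le
  have h3 : Real.exp (-(j*η)) * (δ*(Real.exp (j*η) * (Real.exp η - 1))) = δ*(Real.exp η - 1) := by
    rw [Real.exp_neg]; field_simp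
  obtain ⟨b1, b2, b3⟩ := exp_sub_one_bounds η hη hη1
  have h4 : δ*(Real.exp η - 1) ≤ δ*(η*2) := by gcongr; nlinarith
  have : η * aa η j ≤ η * (2*δ) := by
    calc _ ≤ _ := hw
      _ ≤ _ := h2
      _ = _ := h3
      _ ≤ _ := h4
      _ = _ := by ring
  exact le_of_mul_le_mul_left this hη

lemma win_ineq (C1 : ℝ) (hC : ShortAB C1) (δ : ℝ) (h0 : 0 < δ) (h1 : δ ≤ 1/20) (hCd : 0 ≤ C1*δ) (hCd1 : C1*δ ≤ 1) (η : ℝ) (hη : 0 < η)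
    (J B : ℕ) (hB : 1 ≤ B) (hBη : B*η ≤ 1/2)
    (hj : 14/δ^3 ≤ J*η) (he : Real.exp (-(δ*(J*η))) ≤ η) :
    (2-C1*δ)*(J*η)*(B*η)*(1-B*η) ≤ (J+B)*η*(η*∑ i ∈ range B, aa η (J+i)) +
      ∑ n ∈ Ioc ⌊Real.exp (J*η)⌋₊ ⌊Real.exp ((J+B : ℕ)*η)⌋₊, 1/(n:ℝ) * (Λ * Λ) n := by
  have hB1 : (1:ℝ) ≤ B := by exact_mod_cast hB
  have hB0 : 0 < (B:ℝ)*η := by positivity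
  obtain ⟨a1, a2, a3⟩ := H_ok δ (J*η) (B*η) hB0 hBη (he.trans (by nlinarith))
  have hA := (hC δ h0 h1 (J*η) hj _ a1 a2).2
  rw [a3] at hA
  obtain ⟨b1, b2, b3⟩ := exp_sub_one_bounds (B*η) hB0 hBη
  have hlamlam : ∀ n, 0 ≤ (Λ*Λ) n := fun n => by
    rw [ArithmeticFunction.mul_apply]
    exact sum_nonneg fun x _ => mul_nonneg vonMangoldt_nonneg vonMangoldt_nonneg
  have hnn : ∀ n : ℕ, 0 ≤ Λ n * Real.log n + (Λ*Λ) n := fun n =>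
    add_nonneg (mul_nonneg vonMangoldt_nonneg (Real.log_natCast_nonneg n)) (hlamlam n)
  have hw := win_lo (J*η) (B*η) (by positivity) (fun n => Λ n * Real.log n + (Λ*Λ) n) hnn
  have h2 := mul_le_mul_of_nonneg_left hA (Real.exp_pos (-(J*η+B*η))).le
  have h3 : Real.exp (-(J*η+B*η)) * ((2-C1*δ)*(J*η)*(Real.exp (J*η) * (Real.exp (B*η) - 1))) =
      (2-C1*δ)*(J*η)*(Real.exp (-(B*η)) * (Real.exp (B*η) - 1)) := by
    rw [neg_add, Real.exp_add, Real.exp_neg (J*η)]; field_simp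
  have h4 : (B*η)*(1-B*η) ≤ Real.exp (-(B*η)) * (Real.exp (B*η) - 1) := by
    have := Real.add_one_le_exp (-(B*η))
    rw [mul_comm]
    exact mul_le_mul (by linarith) b1 hB0.le (Real.exp_pos _).le
  have h5 : (2-C1*δ)*(J*η)*((B*η)*(1-B*η)) ≤ (2-C1*δ)*(J*η)*(Real.exp (-(B*η)) * (Real.exp (B*η) - 1)) :=
    mul_le_mul_of_nonneg_left h4 (mul_nonneg (by linarith) (by positivity))
  have h6 : ∑ n ∈ Ioc ⌊Real.exp (J*η)⌋₊ ⌊Real.exp (J*η+B*η)⌋₊, (Λ n * Real.log n + (Λ*Λ) n) / n ≤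
      (J+B)*η*(η*∑ i ∈ range B, aa η (J+i)) +
      ∑ n ∈ Ioc ⌊Real.exp (J*η)⌋₊ ⌊Real.exp (J*η+B*η)⌋₊, 1/(n:ℝ) * (Λ * Λ) n := by
    rw [sum_aa η hη]
    have : Pm η (J+B) - Pm η J = ∑ n ∈ Ioc ⌊Real.exp (J*η)⌋₊ ⌊Real.exp (J*η+B*η)⌋₊, Λ n / n := by
      rw [sum_lam_long _ _ hB0.le]; unfold Pm; rw [show ((J+B:ℕ):ℝ)*η = J*η+B*η by push_cast; ring]
    rw [this, mul_sum, ← sum_add_distrib]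
    refine sum_le_sum fun n hn => ?_
    obtain ⟨a1, a2, a3⟩ := mem_exp_Ioc _ _ (by positivity) n hn
    rw [add_div, show (Λ*Λ) n / (n:ℝ) = 1/(n:ℝ)*(Λ*Λ) n by ring]
    refine add_le_add ?_ le_rfl
    have : 0 ≤ Λ n / (n:ℝ) := div_nonneg vonMangoldt_nonneg (by positivity)
    calc _ = Real.log n * (Λ n / n) := by ring
      _ ≤ _ := mul_le_mul_of_nonneg_right (by linarith) this
  rw [show ((J+B:ℕ):ℝ)*η = J*η+B*η by push_cast; ring]
  calc _ = (2-C1*δ)*(J*η)*((B*η)*(1-B*η)) := by ring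
    _ ≤ _ := h5
    _ = _ := h3.symm
    _ ≤ _ := h2
    _ ≤ _ := hw
    _ ≤ _ := h6
end HH

namespace HH
open Finset ArithmeticFunction
open scoped ArithmeticFunction.Moebius ArithmeticFunction.zeta

lemma avg_one_sub (B : ℕ) (hB : 1 ≤ B) (f : ℕ → ℝ) (k : ℕ) : avg B (fun j => 1 - f j) k = 1 - avg B f k := by
  have hB0 : (B:ℝ) ≠ 0 := by positivity
  unfold avg
  rw [sum_sub_distrib]; simp; field_simp

lemma sum_at (η : ℝ) (hη : 0 < η) (j0 J : ℕ) : |∑ j ∈ range J, (1 - att η j0 j)| ≤ 14/η := by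
  rcases Nat.lt_or_ge J j0 with h | h
  · rw [sum_eq_zero]
    · simp; positivity
    · intro j hj; rw [mem_range] at hj; unfold att; rw [if_pos (by omega)]; ring
  · obtain ⟨m, rfl⟩ := Nat.exists_eq_add_of_le h
    rw [sum_range_add, sum_eq_zero (s := range j0)]
    · have : ∑ x ∈ range m, (1 - att η j0 (j0+x)) = m - ∑ x ∈ range m, aa η (j0+x) := by
        rw [sum_sub_distrib]; simp
        exact sum_congr rfl fun x _ => by unfold att; rw [if_neg (by omega)]
      rw [zero_add, this]
      have e := sum_aa η hη j0 m
      have u1 := Pm_up η hη j0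
      have u2 := Pm_lo η hη j0
      have u3 := Pm_up η hη (j0+m)
      have u4 := Pm_lo η hη (j0+m)
      push_cast at u3 u4
      rw [le_div_iff₀ hη, ← abs_of_pos hη, ← abs_mul, abs_of_pos hη, abs_le]
      constructor <;> nlinarith
    · intro j hj; rw [mem_range] at hj; unfold att; rw [if_pos (by omega)]; ring

lemma sum_avg_le (B : ℕ) (hB : 1 ≤ B) (f : ℕ → ℝ) (E : ℝ) (hE : ∀ J, |∑ j ∈ range J, (1 - f j)| ≤ E) (J : ℕ) :
    ∑ j ∈ range J, avg B f (J-j) ≤ J + 2*E := by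
  have hB0 : (0:ℝ) < B := by exact_mod_cast hB
  unfold avg
  rw [← mul_sum, sum_comm]
  have : ∀ i ∈ range B, ∑ j ∈ range J, f (J-j+i) ≤ J + 2*E := by
    intro i _
    have e1 : ∑ j ∈ range J, f (J-j+i) = ∑ j ∈ range J, f (i+1+j) := by
      rw [← sum_range_reflect]
      refine sum_congr rfl fun j hj => ?_
      rw [mem_range] at hj
      congr 1; omega
    have e2 := sum_range_add (fun j => 1 - f j) (i+1) J
    have e3 : ∑ x ∈ range J, (1 - f (i+1+x)) = J - ∑ x ∈ range J, f (i+1+x) := by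
      rw [sum_sub_distrib]; simp
    have e4 := abs_le.1 (hE (i+1+J))
    have e5 := abs_le.1 (hE (i+1))
    rw [e1]; linarith [e4.1, e5.2]
  have := sum_le_sum this
  rw [one_div, inv_mul_le_iff₀ hB0]
  simpa [mul_add] using this

set_option maxHeartbeats 1000000 in
lemma core_false (C1 : ℝ) (hC1 : 0 < C1) (hC : ShortAB C1) (δ ε η T : ℝ) (N B j0 : ℕ) (hε : ε = (1/100000)^4)
    (h0 : 0 < δ) (h1 : δ ≤ 1/20) (hCd : C1*δ ≤ ε/100) (hδε : 2*δ ≤ ε) (hη : 0 < η) (hT : N*η = T)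
    (hexp : Real.exp (-(δ*(j0*η))) ≤ η) (hj0 : 14/δ^3 ≤ j0*η) (hB : 100/ε ≤ B) (hBη : B*η ≤ ε/100)
    (hBN : B ≤ ε/100*N) (hj0N : j0 ≤ ε/100*N) (hT1 : 10000/ε ≤ T)
    (hnp : ∀ n ∈ Ioc ⌊Real.exp (N*η)⌋₊ ⌊Real.exp ((N+2*B : ℕ)*η)⌋₊, ¬ n.Prime) : False := by
  have hε0 : 0 < ε := by rw [hε]; norm_num
  have hε1 : ε ≤ 1/1000 := by rw [hε]; norm_num
  have hB100 : 100 ≤ ε * B := by rwa [div_le_iff₀ hε0, mul_comm] at hB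
  have hBbig : (1000:ℝ) ≤ B := by
    have := mul_le_mul_of_nonneg_right hε1 (Nat.cast_nonneg (α := ℝ) B)
    linarith
  have hB1 : 1 ≤ B := by have : (1:ℝ) ≤ B := by linarith
                         exact_mod_cast this
  have hT2 : 10000 ≤ ε * T := by rwa [div_le_iff₀ hε0, mul_comm] at hT1
  have hTpos : 0 < T := by nlinarith
  have hN0 : (0:ℝ) < N := by nlinarith
  have hη1 : η ≤ ε/100 := by nlinarith
  have hη2 : η ≤ 1/2 := by linarith
  -- 1/η = N/T
  have hinv : 1/η ≤ ε/10000*N := by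
    rw [div_le_iff₀ hη, mul_assoc, hT]; linarith
  have hCd0 : 0 ≤ C1*δ := by positivity
  have jj : ∀ j, j0 ≤ j → 14/δ^3 ≤ j*η ∧ Real.exp (-(δ*(j*η))) ≤ η := by
    intro j hj
    have : (j0:ℝ) ≤ j := by exact_mod_cast hj
    have h' : (j0:ℝ)*η ≤ j*η := by gcongr
    refine ⟨hj0.trans h', le_trans (Real.exp_le_exp.2 ?_) hexp⟩
    have := mul_le_mul_of_nonneg_left h' h0.le
    linarith
  have hup : ∀ j, j0 ≤ j → aa η j ≤ 2+ε/10 := by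
    intro j hj
    have := bin_up C1 hC δ h0 h1 hCd0 η hη hη2 j (jj j hj).1 (jj j hj).2
    nlinarith
  have hatup : ∀ j, att η j0 j ≤ 2+ε/10 := by
    intro j; unfold att; split_ifs with h
    · linarith
    · exact hup j (by omega)
  have hat0 := at_nonneg η hη j0
  have hsum := sum_at η hη j0
  have h14 : 14/η ≤ ε/100*N := by
    rw [show 14/η = 14*(1/η) by ring]; nlinarith
  have hB0 : (0:ℝ) < B := by linarith
  have havg0 : ∀ k, 0 ≤ avg B (att η j0) k := fun k => by
    unfold avg; exact mul_nonneg (by positivity) (sum_nonneg fun i _ => hat0 _)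
  refine comb_core (fun j => 1 - att η j0 j) N B ε (1/100000) (by norm_num) (by norm_num) hε hB1 ?_ (by nlinarith) ?_ ?_ ?_ ?_
  · rw [div_le_iff₀ hB0]; linarith
  · intro j; rw [abs_le]; have := hat0 j; have := hatup j
    constructor <;> linarith
  · intro J _
    exact (hsum J).trans (h14.trans (by nlinarith))
  · intro J hJ
    have hJR : (J:ℝ) ≤ N + B := by exact_mod_cast hJ.le
    have hJ2 : (J:ℝ) ≤ 2*N := by nlinarith
    simp only [avg_one_sub B hB1]
    set S := ∑ j ∈ range J, att η j0 j * avg B (att η j0) (J-j) with hS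
    have hS0 : 0 ≤ S := sum_nonneg fun j _ => mul_nonneg (hat0 _) (havg0 _)
    have hexpand : ∑ j ∈ range J, (1 - att η j0 j) * (1 - avg B (att η j0) (J-j)) =
        ∑ j ∈ range J, (1 - att η j0 j) - ∑ j ∈ range J, avg B (att η j0) (J-j) + S := by
      rw [hS, ← sum_sub_distrib, ← sum_add_distrib]
      exact sum_congr rfl fun j _ => by ring
    rw [hexpand]
    have s1 := sum_avg_le B hB1 (att η j0) (14/η) hsum J
    have s2 := (abs_le.1 (hsum J)).1
    suffices hh : 2*J - ε/2*N ≤ J * avg B (att η j0) J + S by linarith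
    have hJa : 0 ≤ J * avg B (att η j0) J := mul_nonneg (by positivity) (havg0 J)
    rcases Nat.lt_or_ge J (2*j0+1) with hlt | hge
    · have : (J:ℝ) ≤ 2*j0 := by exact_mod_cast (by omega : J ≤ 2*j0)
      nlinarith
    · have w1 := win_ineq C1 hC δ h0 h1 hCd0 (by linarith) η hη J B hB1 (by linarith) (jj J (by omega)).1 (jj J (by omega)).2
      have w2 := conv_bins η hη j0 J B (fun l hl => (hup l hl).trans (by linarith)) hge hB1
      have w3 : ∑ i ∈ range B, aa η (J+i) = B * avg B (att η j0) J := by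
        unfold avg
        rw [← mul_assoc, mul_one_div_cancel hB0.ne', one_mul]
        exact sum_congr rfl fun x _ => by unfold att; rw [if_neg (by omega)]
      rw [w3] at w1
      rw [← hS] at w2
      have hav3 : avg B (att η j0) J ≤ 3 := by
        unfold avg; rw [one_div, inv_mul_le_iff₀ hB0]
        have : ∑ i ∈ range B, att η j0 (J+i) ≤ ∑ i ∈ range B, (3:ℝ) := sum_le_sum fun i _ => (hatup _).trans (by linarith)
        simpa using this
      set a := avg B (att η j0) J with ha
      have ha0 : 0 ≤ a := havg0 J
      -- divide
      have w4 : (2-C1*δ)*J*(1-B*η) ≤ (J+B)*a + S + 9*(j0+7*(1/η)) + 3*(J+7*(1/η))*(1/B) + 3*(B+7*(1/η)) := by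
        have hpos : 0 < B*η^2 := by positivity
        refine le_of_mul_le_mul_left ?_ hpos
        have e1 : η * (1/η) = 1 := by field_simp
        have e2 : (B:ℝ) * (1/B) = 1 := by field_simp
        generalize (1/η) = iη at *
        generalize (1/(B:ℝ)) = iB at *
        have := w1.trans (add_le_add le_rfl w2)
        refine le_of_eq_of_le ?_ (this.trans (le_of_eq ?_))
        · ring
        · linear_combination (-(63*B*η) - 21*η*(B*iB) - 21*B*η) * e1 - (3*η^2*J + 21*η) * e2
      have hiB : 1/(B:ℝ) ≤ ε/100 := by rw [div_le_iff₀ hB0]; linarith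
      have hiB0 : 0 < 1/(B:ℝ) := by positivity
      have hiη0 : 0 < 1/η := by positivity
      generalize (1/η) = iη at *
      generalize (1/(B:ℝ)) = iB at *
      have v1 : (J:ℝ)*(C1*δ) ≤ 2*N*(ε/100) := by gcongr
      have v2 : (J:ℝ)*(B*η) ≤ 2*N*(ε/100) := by gcongr
      have v3 : 0 ≤ (C1*δ)*((J:ℝ)*(B*η)) := by positivity
      have v4 : (B:ℝ)*a ≤ B*3 := by gcongr
      have v5 : (J+7*iη)*iB ≤ (2*N+7*(ε/10000*N))*(ε/100) := by gcongr
      have v6 : (2*N+7*(ε/10000*N))*(ε/100) ≤ 3*N*(ε/100) := by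
        gcongr; nlinarith
      have v7 : 0 ≤ ε * N := by positivity
      have v8 : 0 ≤ C1*δ*J := by positivity
      linarith
  · intro i hi
    have hk : ∀ i' < B, att η j0 (N+i+i') ≤ ε := by
      intro i' hi'
      have hjn : j0 ≤ N := by
        have : (j0:ℝ) ≤ N := by nlinarith
        exact_mod_cast this
      unfold att; rw [if_neg (by omega)]
      have hge : j0 ≤ N+i+i' := by omega
      refine (bin_np δ h0 h1 η hη hη2 (N+i+i') (jj _ hge).1 (jj _ hge).2 ?_).trans hδε
      intro n hn
      rw [mem_Ioc] at hn
      refine hnp n (mem_Ioc.2 ⟨lt_of_le_of_lt (floor_grid_mono η hη N (N+i+i') (by omega)) hn.1, 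
        hn.2.trans (floor_grid_mono η hη _ (N+2*B) (by omega))⟩)
    rw [avg_one_sub B hB1]
    have : avg B (att η j0) (N+i) ≤ ε := by
      unfold avg; rw [one_div, inv_mul_le_iff₀ hB0]
      have : ∑ i' ∈ range B, att η j0 (N+i+i') ≤ ∑ i' ∈ range B, ε := sum_le_sum fun i' hi' => hk i' (mem_range.1 hi')
      simpa using this
    linarith
end HH

namespace HH
open Finset ArithmeticFunction Filter

set_option maxHeartbeats 1000000 in
lemma hoheisel_exp : ∃ θ : ℝ, 0 < θ ∧ θ < 1 ∧ ∃ T0 : ℝ, ∀ T ≥ T0, ∃ p : ℕ, p.Prime ∧ Real.exp T < p ∧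
    (p:ℝ) ≤ Real.exp T + Real.exp T * Real.exp (-(θ*T)) := by
  obtain ⟨C1, hC1, hC⟩ := exists_shortAB
  obtain ⟨ε, hε⟩ : ∃ ε : ℝ, ε = (1/100000)^4 := ⟨_, rfl⟩
  have hε0 : 0 < ε := by rw [hε]; norm_num
  have hε1 : ε ≤ 1/1000 := by rw [hε]; norm_num
  obtain ⟨δ, h0, h1, hCd, hδε⟩ : ∃ δ : ℝ, 0 < δ ∧ δ ≤ 1/20 ∧ C1*δ ≤ ε/100 ∧ 2*δ ≤ ε := by
    refine ⟨min (ε/2) (ε/100/C1), by positivity, (min_le_left _ _).trans (by linarith), ?_, ?_⟩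
    · calc _ ≤ C1*(ε/100/C1) := by gcongr; exact min_le_right _ _
        _ = _ := by field_simp
    · have := min_le_left (ε/2) (ε/100/C1); linarith
  set κ : ℝ := ε/200 with hκ
  have hκ0 : 0 < κ := by positivity
  set δ1 : ℝ := κ*δ/2 with hδ1
  have hδ10 : 0 < δ1 := by positivity
  have hδ11 : δ1 < 1 := by rw [hδ1, hκ]; nlinarith
  obtain ⟨B, hB⟩ := exists_nat_ge (100/ε)
  have ev1 : ∀ᶠ T : ℝ in atTop, B * Real.exp (-(δ1*T)) ≤ ε/100 := by
    have : Tendsto (fun T : ℝ => B * Real.exp (-(δ1*T))) atTop (nhds (B*0)) :=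
      (Real.tendsto_exp_neg_atTop_nhds_zero.comp (tendsto_id.const_mul_atTop hδ10)).const_mul _
    rw [mul_zero] at this
    exact this.eventually_le_const (by positivity)
  have ev2 : ∀ᶠ T : ℝ in atTop, 4 * B * Real.exp (-(δ1/2*T)) ≤ 1 := by
    have : Tendsto (fun T : ℝ => 4 * B * Real.exp (-(δ1/2*T))) atTop (nhds (4*B*0)) :=
      (Real.tendsto_exp_neg_atTop_nhds_zero.comp (tendsto_id.const_mul_atTop (by positivity : 0 < δ1/2))).const_mul _
    rw [mul_zero] at this
    exact this.eventually_le_const (by positivity)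
  have ev3 : ∀ M : ℝ, ∀ᶠ T : ℝ in atTop, M ≤ T := fun M => eventually_ge_atTop M
  obtain ⟨T0, hT0⟩ := eventually_atTop.1 (ev1.and (ev2.and ((ev3 (10000/ε)).and ((ev3 (1/δ1)).and ((ev3 (14/δ^3/κ)).and ((ev3 (B/(ε/100))).and (ev3 (1/κ))))))))
  refine ⟨δ1/2, by positivity, by linarith, T0, fun T hT => ?_⟩
  obtain ⟨t1, t2, t3, t4, t5, t6, t7⟩ := hT0 T hT
  have hB100 : 100 ≤ ε * B := by rwa [div_le_iff₀ hε0, mul_comm] at hB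
  have hBbig : (1000:ℝ) ≤ B := by
    have := mul_le_mul_of_nonneg_right hε1 (Nat.cast_nonneg (α := ℝ) B)
    linarith
  have hT1 : 1 ≤ T := by
    refine le_trans ?_ t3
    rw [le_div_iff₀ hε0]; linarith
  rw [div_le_iff₀ hδ10] at t4
  rw [div_le_iff₀ hκ0] at t5 t7
  rw [div_le_iff₀ (by positivity)] at t6
  by_contra hcon
  push Not at hcon
  set E := Real.exp (δ1*T) with hE
  have hE1 : 1 ≤ E := Real.one_le_exp (by positivity)
  set N := ⌈T * E⌉₊ with hN
  have hNge : T * E ≤ N := Nat.le_ceil _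
  have hNle : (N:ℝ) ≤ T*E + 1 := (Nat.ceil_lt_add_one (by positivity)).le
  have hTE : T ≤ T * E := le_mul_of_one_le_right (by linarith) hE1
  have hN0 : (0:ℝ) < N := by linarith
  have hEinv : Real.exp (-(δ1*T)) = 1/E := by rw [Real.exp_neg, hE, one_div]
  have hηup : T/N ≤ 1/E := by
    rw [div_le_div_iff₀ hN0 (by positivity)]; linarith
  have hηlo : Real.exp (-(2*δ1*T)) ≤ T/N := by
    have e1 : Real.exp (-(2*δ1*T)) = 1/(E*E) := by
      rw [hE, ← Real.exp_add, Real.exp_neg, one_div]; ring_nf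
    rw [e1, div_le_div_iff₀ (by positivity) hN0]
    have : 2 ≤ E := by
      have := Real.add_one_le_exp (δ1*T)
      linarith
    have h9 := mul_le_mul_of_nonneg_left this (by positivity : 0 ≤ T*E)
    linarith
  have hη0 : 0 < T/N := by positivity
  have hNη : (N:ℝ) * (T/N) = T := by field_simp
  set j0 := ⌈κ*N⌉₊ with hj0
  have hj0ge : κ*N ≤ j0 := Nat.le_ceil _
  have hj0le : (j0:ℝ) ≤ κ*N + 1 := (Nat.ceil_lt_add_one (by positivity)).le
  have hj0η : κ*T ≤ j0*(T/N) := by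
    calc κ*T = κ*N*(T/N) := by field_simp
      _ ≤ _ := by gcongr
  have hBη : B*(T/N) ≤ ε/100 := by
    calc _ ≤ B*(1/E) := by gcongr
      _ ≤ _ := by rw [← hEinv]; exact t1
  refine core_false C1 hC1 hC δ ε (T/N) T N B j0 hε h0 h1 hCd hδε hη0 hNη ?_ ?_ hB hBη ?_ ?_ t3 ?_
  · refine le_trans (Real.exp_le_exp.2 ?_) hηlo
    have := mul_le_mul_of_nonneg_left hj0η h0.le
    rw [hδ1]; linarith
  · linarith
  · have := mul_le_mul_of_nonneg_right (hTE.trans hNge) (by positivity : 0 ≤ ε/100)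
    linarith
  · have : 1 ≤ κ*N := by
      have := mul_le_mul_of_nonneg_right (hTE.trans hNge) hκ0.le
      linarith
    rw [hκ] at hj0le this; linarith
  · intro n hn hp
    rw [mem_Ioc, hNη] at hn
    have n1 : Real.exp T < n := (Nat.floor_lt (Real.exp_pos _).le).1 hn.1
    have n2 : (n:ℝ) ≤ Real.exp ((N+2*B : ℕ)*(T/N)) := (Nat.le_floor_iff (Real.exp_pos _).le).1 hn.2
    have n3 := hcon n hp n1
    have e1 : ((N+2*B : ℕ):ℝ)*(T/N) = T + 2*B*(T/N) := by push_cast; rw [add_mul, hNη]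
    rw [e1, Real.exp_add] at n2
    have hy0 : 0 < 2*B*(T/N) := by positivity
    obtain ⟨b1, b2, b3⟩ := exp_sub_one_bounds (2*B*(T/N)) hy0 (by linarith)
    have b4 : Real.exp (2*B*(T/N)) ≤ 1 + 4*B*(1/E) := by
      have : (B:ℝ)*(T/N) ≤ B*(1/E) := by gcongr
      have h9 : 2*B*(T/N) * (1 + 2*B*(T/N)) ≤ 2*B*(T/N) * 2 := by
        refine mul_le_mul_of_nonneg_left ?_ hy0.le
        linarith
      linarith
    have b5 : 4*B*(1/E) ≤ Real.exp (-(δ1/2*T)) := by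
      rw [← hEinv, show -(δ1*T) = -(δ1/2*T) + -(δ1/2*T) by ring, Real.exp_add, ← mul_assoc]
      have := mul_le_mul_of_nonneg_right t2 (Real.exp_pos (-(δ1/2*T))).le
      linarith
    have := mul_le_mul_of_nonneg_left (b4.trans (add_le_add le_rfl b5)) (Real.exp_pos T).le
    linarith

/-- Hoheisel's theorem. -/
theorem hoheisel : ∃ θ : ℝ, 0 < θ ∧ θ < 1 ∧ ∃ x0 : ℝ, 1 ≤ x0 ∧ ∀ x ≥ x0, ∃ p : ℕ, p.Prime ∧ x < p ∧
    (p:ℝ) ≤ x + x ^ (1 - θ) := by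
  obtain ⟨θ, h0, h1, T0, h⟩ := hoheisel_exp
  refine ⟨θ, h0, h1, max 1 (Real.exp T0), le_max_left _ _, fun x hx => ?_⟩
  have hx0 : 0 < x := lt_of_lt_of_le one_pos ((le_max_left _ _).trans hx)
  obtain ⟨p, hp, p1, p2⟩ := h (Real.log x) ((Real.le_log_iff_exp_le hx0).2 ((le_max_right _ _).trans hx))
  rw [Real.exp_log hx0] at p1 p2
  refine ⟨p, hp, p1, p2.trans (le_of_eq ?_)⟩
  rw [sub_eq_add_neg, Real.rpow_add hx0, Real.rpow_one, Real.rpow_def_of_pos hx0]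
  ring_nf
end HH

namespace HH

open IntermediateField in
lemma liouville_pow (A : ℝ) (hA : IsAlgebraic ℚ A) (h1 : 1 < A) : ∃ K : ℝ, 1 ≤ K ∧ ∀ n : ℕ, 1 ≤ n → ∀ p : ℤ,
    |(p:ℝ)| ≤ 2 * A^n → A^n ≠ p → 1 ≤ K^n * |A^n - p| := by
  classical
  have : FiniteDimensional ℚ ℚ⟮A⟯ := adjoin.finiteDimensional hA.isIntegral
  set F := ℚ⟮A⟯ with hF
  set a : F := AdjoinSimple.gen ℚ A with ha
  have haA : algebraMap F ℝ a = A := AdjoinSimple.algebraMap_gen ℚ A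
  have halg : IsAlgebraic ℤ a := (IsFractionRing.isAlgebraic_iff ℤ ℚ F).2 (Algebra.IsAlgebraic.isAlgebraic a)
  obtain ⟨c, hc0, hc⟩ := halg.exists_integral_multiple
  let σ0 : F →ₐ[ℚ] ℂ := (Complex.ofRealAm.restrictScalars ℚ).comp (IsScalarTower.toAlgHom ℚ F ℝ)
  have hσ0 : ∀ x : F, σ0 x = ((algebraMap F ℝ x : ℝ) : ℂ) := fun x => rfl
  set M : ℝ := A + ∑ σ : F →ₐ[ℚ] ℂ, ‖σ a‖ with hM
  have hMA : A ≤ M := by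
    have : 0 ≤ ∑ σ : F →ₐ[ℚ] ℂ, ‖σ a‖ := Finset.sum_nonneg fun _ _ => norm_nonneg _
    linarith
  have hMσ : ∀ σ : F →ₐ[ℚ] ℂ, ‖σ a‖ ≤ M := fun σ => by
    have := Finset.single_le_sum (f := fun σ : F →ₐ[ℚ] ℂ => ‖σ a‖) (fun _ _ => norm_nonneg _) (Finset.mem_univ σ)
    linarith
  have hc1 : (1:ℝ) ≤ |(c:ℝ)| := by exact_mod_cast Int.one_le_abs hc0
  set Q : ℝ := 3 * |(c:ℝ)| * M with hQ
  have hQ1 : 1 ≤ Q := by rw [hQ]; nlinarith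
  refine ⟨Q ^ (Finset.card (Finset.univ.erase σ0)) * |(c:ℝ)|, one_le_mul_of_one_le_of_one_le (one_le_pow₀ hQ1) hc1, ?_⟩
  intro n hn p hp hne
  set β : F := (c:F)^n * (a^n - (p:F)) with hβ
  have hIntg : IsIntegral ℤ β := by
    have : β = (c • a)^n - ((c^n*p : ℤ) : F) := by
      rw [hβ, zsmul_eq_mul]; push_cast; ring
    rw [this]
    exact (hc.pow n).sub (isIntegral_algebraMap (R := ℤ) (A := F) (x := c^n*p))
  have hcF : (c:F) ≠ 0 := by exact_mod_cast hc0
  have hβ0 : β ≠ 0 := by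
    refine mul_ne_zero (pow_ne_zero _ hcF) ?_
    intro h
    apply hne
    have := congrArg (algebraMap F ℝ) h
    rw [map_sub, map_pow, haA, map_intCast, map_zero] at this
    linarith
  have hnorm0 : Algebra.norm ℚ β ≠ 0 := Algebra.norm_ne_zero_iff.2 hβ0
  have hnint : IsIntegral ℤ (Algebra.norm ℚ β) := Algebra.isIntegral_norm ℚ hIntg
  obtain ⟨z, hz⟩ := IsIntegrallyClosed.isIntegral_iff.1 hnint
  have hprod := Algebra.norm_eq_prod_embeddings ℚ ℂ β
  rw [← hz] at hprod hnorm0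
  have hz0 : z ≠ 0 := by rintro rfl; simp at hnorm0
  have hn1 := congrArg norm hprod
  rw [norm_prod] at hn1
  have hl : (1:ℝ) ≤ ‖(algebraMap ℚ ℂ) ((algebraMap ℤ ℚ) z)‖ := by
    simp
    exact_mod_cast Int.one_le_abs hz0
  rw [hn1, ← Finset.mul_prod_erase _ _ (Finset.mem_univ σ0)] at hl
  have hbd : ∀ σ : F →ₐ[ℚ] ℂ, ‖σ β‖ ≤ Q^n := by
    intro σ
    rw [hβ, map_mul, map_pow, map_sub, map_pow, map_intCast, map_intCast, norm_mul, norm_pow, Complex.norm_intCast]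
    have e1 : ‖(σ a)^n - (p:ℂ)‖ ≤ 3 * M^n := by
      refine (norm_sub_le _ _).trans ?_
      rw [norm_pow, Complex.norm_intCast]
      have : ‖σ a‖^n ≤ M^n := pow_le_pow_left₀ (norm_nonneg _) (hMσ σ) n
      have : A^n ≤ M^n := pow_le_pow_left₀ (by linarith) hMA n
      linarith
    have e2 : (3:ℝ) ≤ 3^n := le_self_pow₀ (by norm_num) (by omega)
    have e3 : 0 ≤ M^n := pow_nonneg (by linarith) n
    calc _ ≤ |(c:ℝ)|^n * (3 * M^n) := by gcongr
      _ ≤ |(c:ℝ)|^n * (3^n * M^n) := by gcongr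
      _ = _ := by rw [hQ, mul_pow, mul_pow]; ring
  have hpr : ∏ σ ∈ Finset.univ.erase σ0, ‖σ β‖ ≤ (Q^n)^(Finset.card (Finset.univ.erase σ0)) := by
    rw [← Finset.prod_const]
    exact Finset.prod_le_prod (fun σ _ => norm_nonneg _) fun σ _ => hbd σ
  have hσβ : ‖σ0 β‖ = |(c:ℝ)|^n * |A^n - p| := by
    rw [hσ0, hβ, map_mul, map_pow, map_sub, map_pow, haA, map_intCast, map_intCast, Complex.norm_real, norm_mul, norm_pow]
    rfl
  rw [hσβ] at hl
  calc (1:ℝ) ≤ _ := hl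
    _ ≤ |(c:ℝ)|^n * |A^n - p| * (Q^n)^(Finset.card (Finset.univ.erase σ0)) := by gcongr
    _ = _ := by generalize Q = Q'; rw [mul_pow, ← pow_mul, ← pow_mul, mul_comm n]; ring
end HH

namespace HH

lemma pow_tangent (z w : ℝ) (hz : 0 ≤ z) (hzw : z ≤ w) (k : ℕ) : z^(k+1) + z^k*(w-z) ≤ w^(k+1) := by
  have : z^k ≤ w^k := pow_le_pow_left₀ hz hzw k
  calc z^(k+1) + z^k*(w-z) = z^k*w := by ring
    _ ≤ w^k*w := by gcongr; linarith
    _ = _ := by ring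

lemma pow_lin (z w : ℝ) (hz : 1 ≤ z) (hzw : z ≤ w) (k : ℕ) : z^k + k*(w-z) ≤ w^k := by
  induction k with
  | zero => simp
  | succ k ih =>
    have h1 : 1 ≤ z^k := one_le_pow₀ hz
    have h2 := pow_tangent z w (by linarith) hzw k
    have h3 : z^k ≤ w^k := pow_le_pow_left₀ (by linarith) hzw k
    push_cast
    have h4 : w^(k+1) = w^k*w := by ring
    have h5 : z^(k+1) = z^k*z := by ring
    have h6 : 0 ≤ (w^k-z^k)*(z-1) := mul_nonneg (by linarith) (by linarith)
    have h7 : 0 ≤ (w^k-1)*(w-z) := mul_nonneg (by linarith) (by linarith)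
    nlinarith

lemma prime_between (t : ℕ) : ∃ k0 : ℕ, ∀ k ≥ k0, ∀ z w : ℝ, 2 ≤ z → 1 ≤ z^t*(w-z) →
    ∃ q : ℕ, q.Prime ∧ z^k < q ∧ (q:ℝ) + 1 < w^k := by
  obtain ⟨θ, h0, h1, x0, hx0, h⟩ := hoheisel
  obtain ⟨k1, hk1⟩ := exists_nat_ge x0
  obtain ⟨k2, hk2⟩ := exists_nat_ge ((t+3)/θ)
  refine ⟨max (max k1 k2) (t+3), fun k hk z w hz hw => ?_⟩
  have e1 : k1 ≤ k := by have := le_max_left (max k1 k2) (t+3); have := le_max_left k1 k2; omega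
  have e2 : k2 ≤ k := by have := le_max_left (max k1 k2) (t+3); have := le_max_right k1 k2; omega
  have e3 : t+3 ≤ k := (le_max_right _ _).trans hk
  have hz0 : 0 < z := by linarith
  have hzk : x0 ≤ z^k := by
    calc x0 ≤ k1 := hk1
      _ ≤ k := by exact_mod_cast e1
      _ ≤ (2:ℝ)^k := by exact_mod_cast (Nat.lt_two_pow_self).le
      _ ≤ z^k := pow_le_pow_left₀ (by norm_num) hz k
  obtain ⟨q, hq, q1, q2⟩ := h _ hzk
  refine ⟨q, hq, q1, ?_⟩
  obtain ⟨m, rfl⟩ := Nat.exists_eq_add_of_le e3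
  have hp : (z^(t+3+m))^(1-θ) ≤ z^m := by
    rw [← Real.rpow_natCast z (t+3+m), ← Real.rpow_mul hz0.le, ← Real.rpow_natCast z m]
    refine Real.rpow_le_rpow_of_exponent_le (by linarith) ?_
    have : ((k2:ℕ):ℝ) ≤ ((t+3+m:ℕ):ℝ) := by exact_mod_cast e2
    have := hk2.trans this
    rw [div_le_iff₀ h0] at this
    push_cast at this ⊢
    linarith
  have hzw : z ≤ w := by
    by_contra hcon
    push Not at hcon
    have : z^t*(w-z) ≤ 0 := mul_nonpos_of_nonneg_of_nonpos (by positivity) (by linarith)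
    linarith
  have ht := pow_tangent z w hz0.le hzw (t+2+m)
  have h4 : z^(t+2+m)*(w-z) = z^m*z^2*(z^t*(w-z)) := by ring
  have h5 : z^m*z^2 ≤ z^m*z^2*(z^t*(w-z)) := le_mul_of_one_le_right (by positivity) hw
  have h6 : 1 ≤ z^m := one_le_pow₀ (by linarith)
  have h7 : z^m*4 ≤ z^m*z^2 := by gcongr; nlinarith
  have h8 : t+2+m+1 = t+3+m := by omega
  rw [h8] at ht
  linarith

/-- Limit of a nested Mills chain. -/
lemma mills_limit (k : ℕ) (q : ℕ → ℕ)
    (h1 : ∀ i, (q i)^(k+i+1) < q (i+1)) (h2 : ∀ i, q (i+1) + 1 < (q i + 1)^(k+i+1)) :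
    ∃ B : ℝ, 0 ≤ B ∧ ∀ i, (q i : ℝ) ≤ B^(Nat.factorial (k+i)) ∧ B^(Nat.factorial (k+i)) < q i + 1 := by
  have hf : ∀ i, ((Nat.factorial (k+i) : ℕ) : ℝ) ≠ 0 := fun i => by exact_mod_cast Nat.factorial_ne_zero _
  set lo : ℕ → ℝ := fun i => (q i : ℝ) ^ ((1:ℝ)/Nat.factorial (k+i)) with hlo
  set up : ℕ → ℝ := fun i => ((q i : ℝ)+1) ^ ((1:ℝ)/Nat.factorial (k+i)) with hup
  have hlo0 : ∀ i, 0 ≤ lo i := fun i => by positivity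
  have hup0 : ∀ i, 0 ≤ up i := fun i => by positivity
  have hlop : ∀ i, lo i ^ Nat.factorial (k+i) = q i := fun i => by
    rw [hlo]; simp only
    rw [← Real.rpow_natCast, ← Real.rpow_mul (by positivity), one_div_mul_cancel (hf i), Real.rpow_one]
  have hupp : ∀ i, up i ^ Nat.factorial (k+i) = q i + 1 := fun i => by
    rw [hup]; simp only
    rw [← Real.rpow_natCast, ← Real.rpow_mul (by positivity), one_div_mul_cancel (hf i), Real.rpow_one]
  have hfs : ∀ i, Nat.factorial (k+(i+1)) = Nat.factorial (k+i) * (k+i+1) := fun i => by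
    rw [← add_assoc, Nat.factorial_succ]; ring
  have hmono : Monotone lo := monotone_nat_of_le_succ fun i => by
    refine le_of_pow_le_pow_left₀ (Nat.factorial_ne_zero (k+(i+1))) (hlo0 _) ?_
    rw [hlop, hfs, pow_mul, hlop]
    exact_mod_cast (h1 i).le
  have hanti : Antitone up := antitone_nat_of_succ_le fun i => by
    refine le_of_pow_le_pow_left₀ (Nat.factorial_ne_zero (k+(i+1))) (hup0 _) ?_
    rw [hupp, hfs, pow_mul, hupp]
    exact_mod_cast (h2 i).le
  have hle : lo ≤ up := fun i => by
    rw [hlo, hup]; simp only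
    exact Real.rpow_le_rpow (by positivity) (by linarith) (by positivity)
  have hB := hmono.ciSup_mem_iInter_Icc_of_antitone hanti hle
  set B := ⨆ n, lo n
  rw [Set.mem_iInter] at hB
  have hB0 : 0 ≤ B := (hlo0 0).trans (hB 0).1
  refine ⟨B, hB0, fun i => ⟨?_, ?_⟩⟩
  · rw [← hlop]; exact pow_le_pow_left₀ (hlo0 i) (hB i).1 _
  · have : B^(Nat.factorial (k+(i+1))) ≤ q (i+1) + 1 := by
      rw [← hupp]; exact pow_le_pow_left₀ hB0 (hB (i+1)).2 _
    rw [hfs, pow_mul] at this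
    have h3 : ((q (i+1) : ℝ)) + 1 < ((q i : ℝ)+1)^(k+i+1) := by exact_mod_cast h2 i
    exact lt_of_pow_lt_pow_left₀ (k+i+1) (by positivity) (this.trans_lt h3)

/-- Mills-type extension: any large prime at a high level extends to a chain. -/
lemma mills_ext : ∃ k0 : ℕ, ∀ k ≥ k0, ∀ p : ℕ, p.Prime → ∃ B : ℝ, 0 ≤ B ∧
    (p:ℝ) ≤ B^(Nat.factorial k) ∧ B^(Nat.factorial k) < p + 1 ∧
    ∀ j ≥ k, ∃ q : ℕ, q.Prime ∧ (q:ℝ) ≤ B^(Nat.factorial j) ∧ B^(Nat.factorial j) < q + 1 := by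
  obtain ⟨k0, hk0⟩ := prime_between 0
  refine ⟨k0, fun k hk p hp => ?_⟩
  have step : ∀ (i : ℕ) (q : {q : ℕ // q.Prime}), ∃ r : {q : ℕ // q.Prime}, q.1^(k+i+1) < r.1 ∧ r.1 + 1 < (q.1+1)^(k+i+1) := by
    intro i q
    obtain ⟨r, hr, r1, r2⟩ := hk0 (k+i+1) (by omega) q.1 (q.1+1) (by exact_mod_cast q.2.two_le) (by simp)
    exact ⟨⟨r, hr⟩, by exact_mod_cast r1, by exact_mod_cast r2⟩
  choose f hf1 hf2 using step
  let q : ℕ → {q : ℕ // q.Prime} := fun i => Nat.rec ⟨p, hp⟩ (fun i x => f i x) i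
  obtain ⟨B, hB0, hB⟩ := mills_limit k (fun i => (q i).1) (fun i => hf1 i (q i)) (fun i => hf2 i (q i))
  refine ⟨B, hB0, (hB 0).1, (hB 0).2, fun j hj => ?_⟩
  obtain ⟨i, rfl⟩ := Nat.exists_eq_add_of_le hj
  exact ⟨(q i).1, (q i).2, (hB i).1, (hB i).2⟩
end HH

namespace HH
open Set

lemma W_two_le {x : ℝ} (hx : x ∈ Wfact) : 2 ≤ x := by
  have h := hx.2 1 le_rfl
  rw [Nat.factorial_one, pow_one] at h
  have h1 := hx.1
  by_contra hcon
  push Not at hcon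
  have : ⌊x⌋ = 1 := by rw [Int.floor_eq_iff]; norm_num; exact ⟨h1.le, hcon⟩
  rw [this] at h
  exact h.not_unit isUnit_one

lemma floor_pow_right (x : ℝ) (n : ℕ) : ∃ ε > 0, ∀ y ∈ Ico x (x+ε), 0 ≤ x → ⌊y^n⌋ = ⌊x^n⌋ := by
  have hc : ContinuousAt (fun y : ℝ => y^n) x := by fun_prop
  have h := hc.eventually_lt_const (Int.lt_floor_add_one (x^n))
  obtain ⟨ε, hε, h⟩ := Metric.eventually_nhds_iff.1 h
  refine ⟨ε, hε, fun y hy hx => ?_⟩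
  have h1 := h (y := y) (by rw [Real.dist_eq, abs_of_nonneg (by linarith [hy.1])]; linarith [hy.2])
  rw [Int.floor_eq_iff]
  exact ⟨(Int.floor_le _).trans (pow_le_pow_left₀ hx hy.1 n), h1⟩

lemma compl_right_open (x : ℝ) (hx : x ∉ Wfact) : ∃ ε > 0, ∀ y ∈ Ico x (x+ε), y ∉ Wfact := by
  by_cases h2 : x < 2
  · exact ⟨2-x, by linarith, fun y hy hw => by have := W_two_le hw; linarith [hy.2]⟩
  · push Not at h2
    have : ∃ k, 1 ≤ k ∧ ¬ Prime ⌊x ^ Nat.factorial k⌋ := by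
      by_contra hcon
      push Not at hcon
      exact hx ⟨by linarith, hcon⟩
    obtain ⟨k, hk, hnp⟩ := this
    obtain ⟨ε, hε, h⟩ := floor_pow_right x (Nat.factorial k)
    refine ⟨ε, hε, fun y hy hw => hnp ?_⟩
    rw [← h y hy (by linarith)]
    exact hw.2 k hk

/-- `n`-th power below `m` but close. -/
lemma floor_pow_left (x : ℝ) (n : ℕ) (hn : n ≠ 0) (hx : 0 < x) (m : ℤ) (hm : (m:ℝ) < x^n) (hm2 : x^n ≤ m+1) :
    ∃ ε > 0, ∀ y ∈ Ioo (x-ε) x, ⌊y^n⌋ = m := by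
  have hc : ContinuousAt (fun y : ℝ => y^n) x := by fun_prop
  have h := hc.eventually_const_lt hm
  obtain ⟨ε, hε, h⟩ := Metric.eventually_nhds_iff.1 h
  refine ⟨min ε x, by positivity, fun y hy => ?_⟩
  have m1 := min_le_left ε x
  have m2 := min_le_right ε x
  have h1 := h (y := y) (by rw [Real.dist_eq, abs_sub_comm, abs_of_nonneg (by linarith [hy.2])]; linarith [hy.1])
  rw [Int.floor_eq_iff]
  refine ⟨h1.le, lt_of_lt_of_le (pow_lt_pow_left₀ hy.2 (by linarith [hy.1]) hn) hm2⟩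

lemma not_prime_pow_sub_one (n : ℤ) (hn : 3 ≤ n) (m : ℕ) (hm : 2 ≤ m) : ¬ Prime (n^m - 1) := by
  intro h
  obtain ⟨c, hc⟩ := sub_one_dvd_pow_sub_one n m
  rcases h.irreducible.isUnit_or_isUnit hc with h1 | h1
  · rw [Int.isUnit_iff] at h1; omega
  · rw [Int.isUnit_iff] at h1
    have h3 : n^2 ≤ n^m := pow_le_pow_right₀ (by omega) hm
    rcases h1 with rfl | rfl
    · nlinarith
    · nlinarith
where
  sub_one_dvd_pow_sub_one (n : ℤ) (m : ℕ) : n - 1 ∣ n^m - 1 := by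
    simpa using sub_dvd_pow_sub_pow n 1 m

/-- If `x ∉ W` then `x` is not approached by `W` from the left. -/
lemma compl_left (x : ℝ) (hx : x ∉ Wfact) : ∃ ε > 0, ∀ y ∈ Ioo (x-ε) x, y ∉ Wfact := by
  by_cases h2 : x ≤ 2
  · exact ⟨1, by linarith, fun y hy hw => by have := W_two_le hw; linarith [hy.2]⟩
  · push Not at h2
    have : ∃ k, 1 ≤ k ∧ ¬ Prime ⌊x ^ Nat.factorial k⌋ := by
      by_contra hcon
      push Not at hcon
      exact hx ⟨by linarith, hcon⟩
    obtain ⟨k, hk, hnp⟩ := this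
    rcases (Int.floor_le (x ^ Nat.factorial k)).lt_or_eq with hlt | heq
    · obtain ⟨ε, hε, h⟩ := floor_pow_left x (Nat.factorial k) (Nat.factorial_ne_zero _) (by linarith) _ hlt (Int.lt_floor_add_one _).le
      refine ⟨ε, hε, fun y hy hw => hnp ?_⟩
      rw [← h y hy]
      exact hw.2 k hk
    · set n := ⌊x ^ Nat.factorial k⌋ with hn
      have hn3 : 3 ≤ n := by
        have : x ≤ x ^ Nat.factorial k := le_self_pow₀ (by linarith) (Nat.factorial_ne_zero _)
        have : (2:ℝ) < n := by linarith
        exact_mod_cast this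
      have e : x ^ Nat.factorial (k+1) = ((n^(k+1) : ℤ) : ℝ) := by
        rw [Nat.factorial_succ, mul_comm, pow_mul, ← heq]; push_cast; rfl
      obtain ⟨ε, hε, h⟩ := floor_pow_left x (Nat.factorial (k+1)) (Nat.factorial_ne_zero _) (by linarith) (n^(k+1)-1)
        (by rw [e]; push_cast; linarith) (by rw [e]; push_cast; linarith)
      refine ⟨ε, hε, fun y hy hw => not_prime_pow_sub_one n hn3 (k+1) (by omega) ?_⟩
      rw [← h y hy]
      exact hw.2 (k+1) (by omega)

lemma icc_sub_comp {S : Set ℝ} {x y a b : ℝ} (hy : y ∈ connectedComponentIn S x) (hya : y ∈ Icc a b) (hab : Icc a b ⊆ S) :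
    Icc a b ⊆ connectedComponentIn S x := by
  rw [connectedComponentIn_eq hy]
  exact isPreconnected_Icc.subset_connectedComponentIn hya hab

lemma sub_boundary_gap (A : ℝ) (hA : A ∈ subB Wfact) : A ∈ Wfact ∧ ∃ ε > 0,
    (∀ y ∈ Ioo (A-ε) A, y ∉ Wfact) ∨ (∀ y ∈ Ioo A (A+ε), y ∉ Wfact) := by
  rcases hA with ⟨U, ⟨x, hx, rfl⟩, hb, hA⟩ | ⟨U, ⟨x, hx, rfl⟩, hb, hA⟩
  · have hxU := mem_connectedComponentIn hx
    have hsub := connectedComponentIn_subset Wfactᶜ x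
    have hord : OrdConnected (connectedComponentIn Wfactᶜ x) := isPreconnected_connectedComponentIn.ordConnected
    have hle : ∀ y ∈ connectedComponentIn Wfactᶜ x, y ≤ A := fun y hy => by rw [hA]; exact le_csSup hb hy
    have hin : ∀ z, x ≤ z → z < A → z ∈ connectedComponentIn Wfactᶜ x := fun z h1 h2 => by
      rw [hA] at h2
      obtain ⟨u, hu, hzu⟩ := exists_lt_of_lt_csSup ⟨x, hxU⟩ h2
      exact hord.out hxU hu ⟨h1, hzu.le⟩
    have hAW : A ∈ Wfact := by
      by_contra hcon
      obtain ⟨ε, hε, h⟩ := compl_right_open A hcon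
      have := icc_sub_comp (a := x) (b := A+ε/2) hxU ⟨le_rfl, by linarith [hle x hxU]⟩ (by
        intro z hz
        by_cases hzA : z < A
        · exact hsub (hin z hz.1 hzA)
        · exact h z ⟨by linarith, by linarith [hz.2]⟩)
      have := hle _ (this ⟨by linarith [hle x hxU], le_rfl⟩)
      linarith
    refine ⟨hAW, A - x, ?_, Or.inl fun y hy => hsub (hin y (by linarith [hy.1]) hy.2)⟩
    have : x ≠ A := by rintro rfl; exact hx hAW
    have := lt_of_le_of_ne (hle x hxU) this
    linarith
  · have hxU := mem_connectedComponentIn hx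
    have hsub := connectedComponentIn_subset Wfactᶜ x
    have hord : OrdConnected (connectedComponentIn Wfactᶜ x) := isPreconnected_connectedComponentIn.ordConnected
    have hle : ∀ y ∈ connectedComponentIn Wfactᶜ x, A ≤ y := fun y hy => by rw [hA]; exact csInf_le hb hy
    have hin : ∀ z, z ≤ x → A < z → z ∈ connectedComponentIn Wfactᶜ x := fun z h1 h2 => by
      rw [hA] at h2
      obtain ⟨u, hu, hzu⟩ := exists_lt_of_csInf_lt ⟨x, hxU⟩ h2
      exact hord.out hu hxU ⟨hzu.le, h1⟩
    have hAW : A ∈ Wfact := by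
      by_contra hcon
      obtain ⟨ε, hε, h⟩ := compl_left A hcon
      have := icc_sub_comp (a := A-ε/2) (b := x) hxU ⟨by linarith [hle x hxU], le_rfl⟩ (by
        intro z hz
        rcases lt_trichotomy z A with hzA | rfl | hzA
        · exact h z ⟨by linarith [hz.1], hzA⟩
        · exact hcon
        · exact hsub (hin z hz.2 hzA))
      have := hle _ (this ⟨le_rfl, by linarith [hle x hxU]⟩)
      linarith
    refine ⟨hAW, x - A, ?_, Or.inr fun y hy => hsub (hin y (by linarith [hy.2]) hy.1)⟩
    have : A ≠ x := by rintro rfl; exact hx hAW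
    have := lt_of_le_of_ne (hle x hxU) this
    linarith
end HH

namespace HH
open Set

lemma floor_root (x y : ℝ) (hx : 0 ≤ x) (hy : 0 ≤ y) (r : ℕ) (hr : r ≠ 0) (p : ℕ)
    (hx1 : (p:ℝ) ≤ x^r) (hx2 : x^r < p+1) (hy1 : (p:ℝ) ≤ y^r) (hy2 : y^r < p+1) : ⌊x⌋ = ⌊y⌋ := by
  have key : ∀ x y : ℝ, 0 ≤ x → 0 ≤ y → x^r < p+1 → (p:ℝ) ≤ y^r → ⌊x⌋ ≤ ⌊y⌋ := by
    intro x y hx hy h1 h2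
    rw [Int.le_floor]
    have hf : 0 ≤ ⌊x⌋ := Int.floor_nonneg.2 hx
    obtain ⟨m, hm⟩ := Int.eq_ofNat_of_zero_le hf
    rw [hm, Int.cast_natCast]
    have hmx : (m:ℝ) ≤ x := by have := Int.floor_le x; rw [hm] at this; exact_mod_cast this
    have h3 : (m:ℝ)^r ≤ x^r := pow_le_pow_left₀ (by positivity) hmx r
    have h4 : (m:ℝ)^r < p+1 := h3.trans_lt h1
    have h5 : m^r ≤ p := by
      have : m^r < p+1 := by exact_mod_cast h4
      omega
    have h6 : (m:ℝ)^r ≤ p := by exact_mod_cast h5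
    exact le_of_pow_le_pow_left₀ hr hy (h6.trans h2)
  exact le_antisymm (key x y hx hy hx2 hy1) (key y x hy hx hy2 hx1)

lemma pow_close (x y : ℝ) (hx : 1 ≤ x) (hy : 1 ≤ y) (r : ℕ) (p : ℝ)
    (hx2 : x^r < p+1) (hy1 : p ≤ y^r) : r*(x-y) ≤ 1 := by
  rcases le_total y x with h | h
  · have := pow_lin y x hy h r; linarith
  · have : r*(x-y) ≤ 0 := mul_nonpos_of_nonneg_of_nonpos (by positivity) (by linarith)
    linarith

lemma finish : ∃ k0 : ℕ, ∀ k ≥ k0, 1 ≤ k → ∀ A ∈ Wfact, ∀ p : ℕ, (p:ℝ) ≤ A^Nat.factorial k → A^Nat.factorial k < p+1 →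
    ∀ q : ℕ, q.Prime → p^(k+1) ≤ q → q+1 ≤ (p+1)^(k+1) → ∃ B ∈ Wfact, (q:ℝ) ≤ B^Nat.factorial (k+1) ∧
      B^Nat.factorial (k+1) < q+1 ∧ k*|B-A| ≤ 1 := by
  obtain ⟨k0, h⟩ := mills_ext
  refine ⟨k0, fun k hk hk1 A hA p hp1 hp2 q hq hq1 hq2 => ?_⟩
  obtain ⟨B, hB0, b1, b2, b3⟩ := h (k+1) (by omega) q hq
  have hA1 := hA.1
  have hfs : Nat.factorial (k+1) = Nat.factorial k * (k+1) := by rw [Nat.factorial_succ, mul_comm]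
  have c1 : (p:ℝ) ≤ B^Nat.factorial k := by
    refine le_of_pow_le_pow_left₀ (by omega : k+1 ≠ 0) (by positivity) ?_
    rw [← pow_mul, ← hfs]
    refine le_trans ?_ b1
    exact_mod_cast hq1
  have c2 : B^Nat.factorial k < p+1 := by
    refine lt_of_pow_lt_pow_left₀ (k+1) (by positivity) ?_
    rw [← pow_mul, ← hfs]
    refine lt_of_lt_of_le b2 ?_
    exact_mod_cast hq2
  have hq2' := hq.two_le
  have hBgt : 1 < B := by
    by_contra hcon
    push Not at hcon
    have : B^Nat.factorial (k+1) ≤ 1 := pow_le_one₀ hB0 hcon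
    have h2 : (2:ℝ) ≤ q := by exact_mod_cast hq2'
    linarith
  refine ⟨B, ⟨hBgt, ?_⟩, b1, b2, ?_⟩
  · intro j hj
    rcases Nat.lt_or_ge k j with hlt | hge
    · obtain ⟨r, hr, r1, r2⟩ := b3 j hlt
      have : ⌊B ^ Nat.factorial j⌋ = (r:ℤ) := by
        rw [Int.floor_eq_iff]; exact ⟨by exact_mod_cast r1, by exact_mod_cast r2⟩
      rw [this]; exact Nat.prime_iff_prime_int.1 hr
    · obtain ⟨r, hr⟩ := Nat.factorial_dvd_factorial hge
      have hr0 : r ≠ 0 := by rintro rfl; simp at hr; exact Nat.factorial_ne_zero _ hr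
      rw [hr, pow_mul] at c1 c2 hp1 hp2
      rw [floor_root (B^Nat.factorial j) (A^Nat.factorial j) (by positivity) (by positivity) r hr0 p c1 c2 hp1 hp2]
      exact hA.2 j hj
  · have e1 := pow_close B A hBgt.le hA1.le _ p c2 hp1
    have e2 := pow_close A B hA1.le hBgt.le _ p hp2 c1
    have e3 : (k:ℝ) ≤ Nat.factorial k := by exact_mod_cast Nat.self_le_factorial k
    have e4 : (k:ℝ)*|B-A| ≤ Nat.factorial k * |B-A| := by gcongr
    refine e4.trans ?_
    rcases abs_cases (B-A) with ⟨h, _⟩ | ⟨h, _⟩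
    · rw [h]; exact e1
    · rw [h, neg_sub]; exact e2

theorem main (A : ℝ) (hA : A ∈ subB Wfact) : Transcendental ℚ A := by
  intro halg
  obtain ⟨hAW, ε, hε, hgap⟩ := sub_boundary_gap A hA
  have hA1 := hAW.1
  obtain ⟨K, hK1, hK⟩ := liouville_pow A halg hA1
  obtain ⟨s, hs⟩ := pow_unbounded_of_one_lt K hA1
  obtain ⟨k1, hk1⟩ := prime_between (2*s)
  obtain ⟨k2, hk2⟩ := finish
  obtain ⟨k3, hk3⟩ := exists_nat_gt (1/ε)
  set k := max (max k1 k2) (max k3 1) with hk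
  have l1 : k1 ≤ k := (le_max_left _ _).trans (le_max_left _ _)
  have l2 : k2 ≤ k := (le_max_right _ _).trans (le_max_left _ _)
  have l3 : k3 ≤ k := (le_max_left _ _).trans (le_max_right _ _)
  have l4 : 1 ≤ k := (le_max_right _ _).trans (le_max_right _ _)
  clear_value k
  have hkε : 1 < k * ε := by
    rw [div_lt_iff₀ hε] at hk3
    have : (k3:ℝ) ≤ k := by exact_mod_cast l3
    nlinarith
  have hfs : Nat.factorial (k+1) = Nat.factorial k * (k+1) := by rw [Nat.factorial_succ, mul_comm]
  set y := A^Nat.factorial k with hy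
  have hyk : y^(k+1) = A^Nat.factorial (k+1) := by rw [hfs, pow_mul]
  have hprime := hAW.2 k l4
  rw [← hy] at hprime
  have hy1 : 1 ≤ y := one_le_pow₀ hA1.le
  obtain ⟨p, hp⟩ := Int.eq_ofNat_of_zero_le (Int.floor_nonneg.2 (by linarith : 0 ≤ y))
  rw [hp] at hprime
  have hpp : p.Prime := Nat.prime_iff_prime_int.2 hprime
  have p1 : (p:ℝ) ≤ y := by have := Int.floor_le y; rw [hp] at this; exact_mod_cast this
  have p2 : y < p+1 := by have := Int.lt_floor_add_one y; rw [hp] at this; exact_mod_cast this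
  have hp2 : (2:ℝ) ≤ p := by exact_mod_cast hpp.two_le
  have hne : y ≠ p := by
    intro h
    have h1 := hAW.2 (k+1) (by omega)
    rw [← hyk, h] at h1
    have : ⌊(p:ℝ)^(k+1)⌋ = (p:ℤ)^(k+1) := by
      rw [show (p:ℝ)^(k+1) = (((p:ℤ)^(k+1) : ℤ) : ℝ) by push_cast; rfl, Int.floor_intCast]
    rw [this] at h1
    exact not_prime_pow (by omega) h1
  have hKy : K^Nat.factorial k ≤ y^s := by
    calc _ ≤ (A^s)^Nat.factorial k := pow_le_pow_left₀ (by linarith) hs.le _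
      _ = _ := by rw [hy, ← pow_mul, ← pow_mul, mul_comm]
  have hyp : y ≤ p^2 := by nlinarith
  have L1 : 1 ≤ (p:ℝ)^(2*s)*(y-p) := by
    have := hK (Nat.factorial k) (Nat.factorial_pos k) p (by
      rw [Int.cast_natCast, abs_of_nonneg (by positivity), ← hy]; linarith) (by rw [Int.cast_natCast]; exact hne)
    rw [Int.cast_natCast, ← hy, abs_of_nonneg (by linarith)] at this
    refine this.trans ?_
    have h1 : y^s ≤ ((p:ℝ)^2)^s := pow_le_pow_left₀ (by linarith) hyp s
    rw [pow_mul]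
    exact mul_le_mul_of_nonneg_right (hKy.trans h1) (by linarith)
  have L2 : 1 ≤ y^(2*s)*((p+1)-y) := by
    have := hK (Nat.factorial k) (Nat.factorial_pos k) (p+1) (by
      push_cast
      rw [abs_of_nonneg (by positivity), ← hy]; linarith) (by push_cast; exact p2.ne)
    push_cast at this
    rw [← hy, abs_sub_comm, abs_of_nonneg (by linarith)] at this
    refine this.trans ?_
    have h1 : y^s ≤ y^(2*s) := pow_le_pow_right₀ hy1 (by omega)
    exact mul_le_mul_of_nonneg_right (hKy.trans h1) (by linarith)
  have hA0 : 0 ≤ A := by linarith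
  rcases hgap with hg | hg
  · obtain ⟨q, hq, q1, q2⟩ := hk1 (k+1) (by omega) p y hp2 L1
    have q3 : y^(k+1) < ((p:ℝ)+1)^(k+1) := pow_lt_pow_left₀ p2 (by linarith) (by omega)
    obtain ⟨B, hBW, b1, b2, b3⟩ := hk2 k l2 l4 A hAW p p1 p2 q hq (by exact_mod_cast q1.le) (by exact_mod_cast (q2.trans q3).le)
    have hlt : B < A := lt_of_pow_lt_pow_left₀ (Nat.factorial (k+1)) hA0 (by rw [← hyk]; linarith)
    refine hg B ⟨?_, hlt⟩ hBW
    rw [abs_of_neg (by linarith)] at b3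
    by_contra hcon
    push Not at hcon
    have : (k:ℝ)*ε ≤ k * -(B-A) := by gcongr; linarith
    linarith
  · obtain ⟨q, hq, q1, q2⟩ := hk1 (k+1) (by omega) y (p+1) (by linarith) L2
    have q3 : (p:ℝ)^(k+1) ≤ y^(k+1) := pow_le_pow_left₀ (by positivity) p1 _
    obtain ⟨B, hBW, b1, b2, b3⟩ := hk2 k l2 l4 A hAW p p1 p2 q hq (by exact_mod_cast (q3.trans q1.le)) (by exact_mod_cast q2.le)
    have hB0 : 0 ≤ B := by linarith [hBW.1]
    have hlt : A < B := lt_of_pow_lt_pow_left₀ (Nat.factorial (k+1)) hB0 (by rw [← hyk]; linarith)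
    refine hg B ⟨hlt, ?_⟩ hBW
    rw [abs_of_pos (by linarith)] at b3
    by_contra hcon
    push Not at hcon
    have : (k:ℝ)*ε ≤ k * (B-A) := by gcongr; linarith
    linarith
end HH

theorem transcendental_of_mem_subBoundary_Wfact :
    ∀ A ∈ subB Wfact, Transcendental ℚ A := by
  exact fun A hA => HH.main A hA
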